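/- arXiv:math/0410522 — 2 statements merged into one kernel-verified Lean document; each statement's English description precedes it below -/
import Mathlib

section
/- Landau's theorem on sums of two squares: there exists a constant c > 0 such that #{n ∈ ℤ : 1 ≤ n ≤ x and r(n) > 0} is asymptotically equal to c·x/√(log x) as x → ∞, i.e. the quotient of the two quantities tends to 1. -/
open Real Filter

/-- `r n` is the number of representations of `n` as a sum of two squares of integers. -/
noncomputable def rTwoSquares (n : ℕ) : ℕ :=
  {p : ℤ × ℤ | p.1 ^ 2 + p.2 ^ 2 = (n : ℤ)}.ncard

open MeasureTheory Topology

/-- The Fejér kernel `2 (1 - cos w) / w ^ 2`, the Fourier transform of the triangle function. -/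
noncomputable def fejerKernel (w : ℝ) : ℝ := 2 * (1 - Real.cos w) / w ^ 2

lemma fejerKernel_nonneg (w : ℝ) : 0 ≤ fejerKernel w := by
  have := Real.cos_le_one w
  unfold fejerKernel
  have : 0 ≤ 1 - Real.cos w := by linarith
  positivity

lemma fejerKernel_le (w : ℝ) : fejerKernel w ≤ 5 * (1 + w ^ 2)⁻¹ := by
  unfold fejerKernel
  rcases eq_or_ne w 0 with rfl | hw
  · norm_num
  have hw2 : 0 < w ^ 2 := by positivity
  rw [← div_eq_mul_inv, div_le_div_iff₀ hw2 (by positivity)]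
  have h1 := Real.one_sub_sq_div_two_le_cos (x := w)
  have h2 := Real.neg_one_le_cos w
  rcases le_total (w ^ 2) 4 with h | h
  · nlinarith
  · nlinarith

lemma measurable_fejerKernel : Measurable fejerKernel := by
  unfold fejerKernel
  fun_prop

lemma integrable_fejerKernel : Integrable fejerKernel := by
  refine (integrable_inv_one_add_sq.const_mul 5).mono'
    measurable_fejerKernel.aestronglyMeasurable (Eventually.of_forall fun w => ?_)
  rw [Real.norm_of_nonneg (fejerKernel_nonneg w)]
  exact fejerKernel_le w

lemma integral_fejerKernel_pos : 0 < ∫ w, fejerKernel w := by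
  rw [integral_pos_iff_support_of_nonneg fejerKernel_nonneg integrable_fejerKernel]
  have hsub : Set.Ioo (0 : ℝ) 1 ⊆ Function.support fejerKernel := by
    intro w hw
    have h1 : Real.cos w < 1 := by
      have := Real.cos_lt_cos_of_nonneg_of_le_pi le_rfl
        (by linarith [Real.pi_gt_three, hw.2] : w ≤ Real.pi) hw.1
      simpa using this
    have h2 : (w : ℝ) ≠ 0 := hw.1.ne'
    have h3 : (1 - Real.cos w) ≠ 0 := by linarith
    simp [fejerKernel, h2, h3]
  refine lt_of_lt_of_le ?_ (measure_mono hsub)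
  simp

lemma fejerKernel_eq_integral {w : ℝ} (hw : w ≠ 0) :
    (fejerKernel w : ℂ) =
      ∫ t in (-1 : ℝ)..1, ((1 - |t| : ℝ) : ℂ) * Complex.exp (Complex.I * w * t) := by
  set z : ℂ := Complex.I * w with hz
  have hz0 : z ≠ 0 := by simp [hz, hw]
  have hexp : ∀ t : ℝ, HasDerivAt (fun t : ℝ => Complex.exp (z * t)) (Complex.exp (z * t) * z) t := by
    intro t
    have h1 : HasDerivAt (fun t : ℝ => z * (t : ℂ)) z t := by
      simpa using (Complex.ofRealCLM.hasDerivAt (x := t)).const_mul z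
    exact h1.cexp
  have hid : ∀ t : ℝ, HasDerivAt (fun t : ℝ => (t : ℂ)) 1 t := fun t => by
    exact Complex.ofRealCLM.hasDerivAt
  have hcont : Continuous fun t : ℝ => ((1 - |t| : ℝ) : ℂ) * Complex.exp (z * t) := by fun_prop
  rw [← intervalIntegral.integral_add_adjacent_intervals (b := 0)
    (hcont.intervalIntegrable _ _) (hcont.intervalIntegrable _ _)]
  have e1 : ∫ t in (-1 : ℝ)..0, ((1 - |t| : ℝ) : ℂ) * Complex.exp (z * t)
      = ∫ t in (-1 : ℝ)..0, (1 + (t : ℂ)) * Complex.exp (z * t) := by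
    refine intervalIntegral.integral_congr fun t ht => ?_
    rw [Set.uIcc_of_le (by norm_num)] at ht
    simp [abs_of_nonpos ht.2]
  have e2 : ∫ t in (0 : ℝ)..1, ((1 - |t| : ℝ) : ℂ) * Complex.exp (z * t)
      = ∫ t in (0 : ℝ)..1, (1 - (t : ℂ)) * Complex.exp (z * t) := by
    refine intervalIntegral.integral_congr fun t ht => ?_
    rw [Set.uIcc_of_le (by norm_num)] at ht
    simp [abs_of_nonneg ht.1]
  rw [e1, e2,
    intervalIntegral.integral_eq_sub_of_hasDerivAt
      (f := fun t : ℝ => (1 + (t : ℂ)) * Complex.exp (z * t) / z - Complex.exp (z * t) / z ^ 2)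
      (fun t _ => ?_) (Continuous.intervalIntegrable (by fun_prop) _ _),
    intervalIntegral.integral_eq_sub_of_hasDerivAt
      (f := fun t : ℝ => (1 - (t : ℂ)) * Complex.exp (z * t) / z + Complex.exp (z * t) / z ^ 2)
      (fun t _ => ?_) (Continuous.intervalIntegrable (by fun_prop) _ _)]
  · have hcos : Complex.exp z + Complex.exp (-z) = 2 * Complex.cos w := by
      rw [Complex.cos, hz]
      ring_nf
    have hz2 : z ^ 2 = -(w : ℂ) ^ 2 := by
      rw [hz, mul_pow, Complex.I_sq]; ring
    have hwc : (w : ℂ) ≠ 0 := by exact_mod_cast hw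
    have : (fejerKernel w : ℂ) = (Complex.exp z + Complex.exp (-z) - 2) / z ^ 2 := by
      rw [hcos, hz2, fejerKernel]
      push_cast
      field_simp
      ring
    rw [this]
    simp
    field_simp
    ring
  · have := ((((hid t).const_sub 1).mul (hexp t)).div_const z).add ((hexp t).div_const (z ^ 2))
    convert! this using 1
    field_simp
    ring
  · have := ((((hid t).const_add 1).mul (hexp t)).div_const z).sub ((hexp t).div_const (z ^ 2))
    convert! this using 1
    field_simp
    ring

lemma tendsto_integral_fejerKernel_Icc :
    Tendsto (fun δ : ℝ => ∫ w in Set.Icc (-δ⁻¹) δ⁻¹, fejerKernel w) (𝓝[>] 0)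
      (𝓝 (∫ w, fejerKernel w)) := by
  have h := intervalIntegral_tendsto_integral (μ := volume) (f := fejerKernel)
    (l := 𝓝[>] (0 : ℝ)) (a := fun δ => -δ⁻¹) (b := fun δ => δ⁻¹) integrable_fejerKernel
    (tendsto_neg_atTop_atBot.comp tendsto_inv_nhdsGT_zero) tendsto_inv_nhdsGT_zero
  refine h.congr' ?_
  filter_upwards [self_mem_nhdsWithin] with δ hδ
  have hδ : (0 : ℝ) < δ⁻¹ := inv_pos.2 hδ
  rw [intervalIntegral.integral_of_le (by linarith), integral_Icc_eq_integral_Ioc]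

lemma tendsto_of_tendsto_fejer_mean {φ : ℝ → ℝ} {A C : ℝ} (h0 : ∀ u, 0 ≤ φ u)
    (hC : ∀ u, φ u ≤ C) (hmeas : Measurable φ) (hmono : Monotone fun u => φ u * Real.exp u)
    (hP : ∀ l : ℝ, 0 < l → Tendsto (fun v => ∫ w, φ (v + w / l) * fejerKernel w) atTop
      (𝓝 (A * ∫ w, fejerKernel w))) :
    Tendsto φ atTop (𝓝 A) := by
  set I := ∫ w, fejerKernel w with hI
  have hIpos : 0 < I := integral_fejerKernel_pos
  set J : ℝ → ℝ := fun δ => ∫ w in Set.Icc (-δ⁻¹) δ⁻¹, fejerKernel w with hJ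
  have hJlim : Tendsto J (𝓝[>] 0) (𝓝 I) := tendsto_integral_fejerKernel_Icc
  have hexp : Tendsto (fun δ : ℝ => Real.exp (2 * δ)) (𝓝[>] 0) (𝓝 1) := by
    have : ContinuousAt (fun δ : ℝ => Real.exp (2 * δ)) 0 := by fun_prop
    simpa [ContinuousAt] using this.tendsto.mono_left nhdsWithin_le_nhds
  have hinteg : ∀ (l v : ℝ), Integrable fun w => φ (v + w / l) * fejerKernel w := by
    intro l v
    refine (integrable_fejerKernel.const_mul C).mono'
      ((hmeas.comp (by fun_prop)).mul measurable_fejerKernel).aestronglyMeasurable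
      (Eventually.of_forall fun w => ?_)
    rw [Real.norm_of_nonneg (mul_nonneg (h0 _) (fejerKernel_nonneg w))]
    exact mul_le_mul_of_nonneg_right (hC _) (fejerKernel_nonneg w)
  have hslow : ∀ {a b δ : ℝ}, a ≤ b → b ≤ a + 2 * δ → φ a ≤ φ b * Real.exp (2 * δ) := by
    intro a b δ hab hba
    have h1 : φ a * Real.exp a ≤ φ b * Real.exp b := hmono hab
    have h2 : Real.exp b ≤ Real.exp (2 * δ) * Real.exp a := by
      rw [← Real.exp_add]; exact Real.exp_le_exp.2 (by linarith)
    have h3 : φ a * Real.exp a ≤ φ b * Real.exp (2 * δ) * Real.exp a := by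
      rw [mul_assoc]
      exact h1.trans (mul_le_mul_of_nonneg_left h2 (h0 b))
    exact le_of_mul_le_mul_right h3 (Real.exp_pos a)
  have hwin : ∀ {δ w : ℝ}, 0 < δ → w ∈ Set.Icc (-δ⁻¹) δ⁻¹ → |w / (δ⁻¹ / δ)| ≤ δ := by
    intro δ w hδ hw
    have hw' : |w| ≤ δ⁻¹ := abs_le.2 hw
    rw [abs_div, abs_of_pos (by positivity : 0 < δ⁻¹ / δ), div_le_iff₀ (by positivity)]
    calc |w| ≤ δ⁻¹ := hw'
      _ = δ * (δ⁻¹ / δ) := by field_simp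
  have hlow : ∀ {δ : ℝ}, 0 < δ → ∀ v, φ (v - δ) * J δ ≤
      Real.exp (2 * δ) * ∫ w, φ (v + w / (δ⁻¹ / δ)) * fejerKernel w := by
    intro δ hδ v
    rw [hJ, ← integral_const_mul, ← integral_const_mul]
    refine le_trans ?_ (setIntegral_le_integral (s := Set.Icc (-δ⁻¹) δ⁻¹)
      ((hinteg _ v).const_mul _) (Eventually.of_forall fun w => ?_))
    · refine setIntegral_mono_on (integrable_fejerKernel.const_mul _).integrableOn
        ((hinteg _ v).const_mul _).integrableOn measurableSet_Icc fun w hw => ?_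
      have h1 := abs_le.1 (hwin hδ hw)
      have h2 := hslow (a := v - δ) (b := v + w / (δ⁻¹ / δ)) (δ := δ) (by linarith) (by linarith)
      calc φ (v - δ) * fejerKernel w
          ≤ (φ (v + w / (δ⁻¹ / δ)) * Real.exp (2 * δ)) * fejerKernel w :=
            mul_le_mul_of_nonneg_right h2 (fejerKernel_nonneg w)
        _ = _ := by ring
    · exact mul_nonneg (Real.exp_pos _).le (mul_nonneg (h0 _) (fejerKernel_nonneg w))
  have hupp : ∀ {δ : ℝ}, 0 < δ → ∀ v, (∫ w, φ (v + w / (δ⁻¹ / δ)) * fejerKernel w) ≤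
      φ (v + δ) * Real.exp (2 * δ) * J δ + C * (I - J δ) := by
    intro δ hδ v
    have hsplit := integral_add_compl (s := Set.Icc (-δ⁻¹) δ⁻¹) measurableSet_Icc
      (hinteg (δ⁻¹ / δ) v)
    have hsplit' := integral_add_compl (s := Set.Icc (-δ⁻¹) δ⁻¹) measurableSet_Icc
      integrable_fejerKernel
    have hcompl : I - J δ = ∫ w in (Set.Icc (-δ⁻¹) δ⁻¹)ᶜ, fejerKernel w := by
      rw [hI, ← hsplit']; simp [hJ]
    rw [← hsplit, hcompl, hJ, ← integral_const_mul, ← integral_const_mul]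
    refine add_le_add ?_ ?_
    · refine setIntegral_mono_on (hinteg _ v).integrableOn
        (integrable_fejerKernel.const_mul _).integrableOn measurableSet_Icc fun w hw => ?_
      have h1 := abs_le.1 (hwin hδ hw)
      have h2 := hslow (a := v + w / (δ⁻¹ / δ)) (b := v + δ) (δ := δ) (by linarith) (by linarith)
      exact mul_le_mul_of_nonneg_right h2 (fejerKernel_nonneg w)
    · refine setIntegral_mono_on (hinteg _ v).integrableOn
        (integrable_fejerKernel.const_mul _).integrableOn measurableSet_Icc.compl fun w hw => ?_
      exact mul_le_mul_of_nonneg_right (hC _) (fejerKernel_nonneg w)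
  have hJpos : ∀ᶠ δ in 𝓝[>] (0 : ℝ), 0 < J δ := hJlim.eventually (lt_mem_nhds hIpos)
  refine tendsto_order.2 ⟨fun a ha => ?_, fun a ha => ?_⟩
  · have hlim : Tendsto (fun δ => a * Real.exp (2 * δ) * J δ + C * (I - J δ)) (𝓝[>] 0)
        (𝓝 (a * 1 * I + C * (I - I))) :=
      ((hexp.const_mul a).mul hJlim).add ((hJlim.const_sub I).const_mul C)
    have hlt : a * 1 * I + C * (I - I) < A * I := by nlinarith
    obtain ⟨δ, hδ, hJδ, hδ0⟩ := ((hlim.eventually (gt_mem_nhds hlt)).and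
      (hJpos.and self_mem_nhdsWithin)).exists
    have hδ0 : 0 < δ := hδ0
    have hev := (hP (δ⁻¹ / δ) (by positivity)).eventually (lt_mem_nhds hδ)
    have hev' : ∀ᶠ v in atTop, a < φ (v + δ) := by
      filter_upwards [hev] with v hv
      have h1 := hv.trans_le (hupp hδ0 v)
      have h2 : a * (Real.exp (2 * δ) * J δ) < φ (v + δ) * (Real.exp (2 * δ) * J δ) := by
        linarith
      exact lt_of_mul_lt_mul_right h2 (by positivity)
    have := (tendsto_atTop_add_const_right atTop (-δ) tendsto_id).eventually hev'
    simpa using this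
  · have hlim : Tendsto (fun δ => a * J δ / Real.exp (2 * δ)) (𝓝[>] 0) (𝓝 (a * I / 1)) :=
      (hJlim.const_mul a).div hexp one_ne_zero
    have hlt : A * I < a * I / 1 := by rw [div_one]; exact mul_lt_mul_of_pos_right ha hIpos
    obtain ⟨δ, hδ, hJδ, hδ0⟩ := ((hlim.eventually (lt_mem_nhds hlt)).and
      (hJpos.and self_mem_nhdsWithin)).exists
    have hδ0 : 0 < δ := hδ0
    have hev := (hP (δ⁻¹ / δ) (by positivity)).eventually (gt_mem_nhds hδ)
    have hev' : ∀ᶠ v in atTop, φ (v - δ) < a := by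
      filter_upwards [hev] with v hv
      have h1 := hlow hδ0 v
      rw [lt_div_iff₀ (Real.exp_pos _)] at hv
      have h2 : φ (v - δ) * J δ < a * J δ := by linarith
      exact lt_of_mul_lt_mul_right h2 hJδ.le
    have := (tendsto_atTop_add_const_right atTop δ tendsto_id).eventually hev'
    simpa using this

lemma integrableOn_laplace {h : ℝ → ℝ} {H : ℝ} (hmeas : Measurable h) (hH : ∀ u, |h u| ≤ H)
    {s : ℂ} (hs : 0 < s.re) :
    IntegrableOn (fun u : ℝ => (h u : ℂ) * Complex.exp (-s * u)) (Set.Ioi 0) := by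
  have h1 : IntegrableOn (fun u : ℝ => H * Real.exp (-s.re * u)) (Set.Ioi 0) :=
    (integrableOn_exp_mul_Ioi (by linarith) 0).const_mul H
  refine h1.mono' (by fun_prop) (Eventually.of_forall fun u => ?_)
  rw [norm_mul, Complex.norm_exp]
  simp only [Complex.norm_real, Real.norm_eq_abs]
  have : (-s * (u : ℂ)).re = -s.re * u := by simp
  rw [this]
  exact mul_le_mul_of_nonneg_right (hH u) (Real.exp_pos _).le

lemma integral_mul_fejerKernel_eq {h : ℝ → ℝ} {H : ℝ} (hmeas : Measurable h)
    (hH : ∀ u, |h u| ≤ H) {ε : ℝ} (hε : 0 < ε) {l : ℝ} (hl : 0 < l) (v : ℝ) :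
    ∫ u in Set.Ioi (0 : ℝ),
        (h u : ℂ) * Complex.exp (-(ε : ℂ) * u) * (fejerKernel (l * (u - v)) : ℂ) =
      ∫ t in (-1 : ℝ)..1, ((1 - |t| : ℝ) : ℂ) * Complex.exp (-(Complex.I * l * v * t)) *
        ∫ u in Set.Ioi (0 : ℝ), (h u : ℂ) * Complex.exp (-(ε - Complex.I * l * t) * u) := by
  have hae : ∀ᵐ u : ℝ ∂(volume.restrict (Set.Ioi (0 : ℝ))), u ≠ v :=
    ae_restrict_of_ae (Measure.ae_ne volume v)
  rw [intervalIntegral.integral_of_le (by norm_num)]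
  have hleft : ∫ u in Set.Ioi (0 : ℝ),
        (h u : ℂ) * Complex.exp (-(ε : ℂ) * u) * (fejerKernel (l * (u - v)) : ℂ) =
      ∫ u in Set.Ioi (0 : ℝ), ∫ t in Set.Ioc (-1 : ℝ) 1,
        ((1 - |t| : ℝ) : ℂ) * Complex.exp (-(Complex.I * l * v * t)) *
          ((h u : ℂ) * Complex.exp (-(ε - Complex.I * l * t) * u)) := by
    refine integral_congr_ae (hae.mono fun u hu => ?_)
    have h0 : l * (u - v) ≠ 0 := mul_ne_zero hl.ne' (sub_ne_zero.2 hu)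
    simp only
    rw [fejerKernel_eq_integral h0, intervalIntegral.integral_of_le (by norm_num),
      ← integral_const_mul]
    refine integral_congr_ae (Eventually.of_forall fun t => ?_)
    simp only
    rw [show (h u : ℂ) * Complex.exp (-(ε : ℂ) * u) * (((1 - |t| : ℝ) : ℂ) *
        Complex.exp (Complex.I * ((l * (u - v) : ℝ) : ℂ) * t)) =
        ((1 - |t| : ℝ) : ℂ) * (h u : ℂ) * (Complex.exp (-(ε : ℂ) * u) *
        Complex.exp (Complex.I * ((l * (u - v) : ℝ) : ℂ) * t)) by ring,
      show ((1 - |t| : ℝ) : ℂ) * Complex.exp (-(Complex.I * l * v * t)) *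
          ((h u : ℂ) * Complex.exp (-(ε - Complex.I * l * t) * u)) =
        ((1 - |t| : ℝ) : ℂ) * (h u : ℂ) * (Complex.exp (-(Complex.I * l * v * t)) *
          Complex.exp (-(ε - Complex.I * l * t) * u)) by ring,
      ← Complex.exp_add, ← Complex.exp_add]
    congr 2
    push_cast
    ring
  rw [hleft, integral_integral_swap]
  · refine integral_congr_ae (Eventually.of_forall fun t => ?_)
    simp only
    rw [integral_const_mul]
  · have hb : Integrable (fun p : ℝ × ℝ => (H * Real.exp (-ε * p.1)) * (1 : ℝ))
        ((volume.restrict (Set.Ioi (0 : ℝ))).prod (volume.restrict (Set.Ioc (-1 : ℝ) 1))) :=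
      Integrable.mul_prod (f := fun u : ℝ => H * Real.exp (-ε * u)) (g := fun _ : ℝ => (1 : ℝ))
        ((integrableOn_exp_mul_Ioi (by linarith) 0).const_mul H) (integrable_const _)
    have hprod : ((volume.restrict (Set.Ioi (0 : ℝ))).prod
        (volume.restrict (Set.Ioc (-1 : ℝ) 1))) =
        (volume.prod volume).restrict (Set.Ioi (0 : ℝ) ×ˢ Set.Ioc (-1 : ℝ) 1) :=
      Measure.prod_restrict _ _
    refine hb.mono' (Measurable.aestronglyMeasurable ?_) ?_
    · unfold Function.uncurry
      fun_prop
    · rw [hprod]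
      refine (ae_restrict_iff' (measurableSet_Ioi.prod measurableSet_Ioc)).2
        (Eventually.of_forall fun p hp => ?_)
      obtain ⟨u, t⟩ := p
      have ht : t ∈ Set.Ioc (-1 : ℝ) 1 := hp.2
      have hT : |t| ≤ 1 := abs_le.2 ⟨ht.1.le, ht.2⟩
      simp only [Function.uncurry, norm_mul, Complex.norm_exp, Complex.norm_real,
        Real.norm_eq_abs]
      have e1 : (-(Complex.I * l * v * t)).re = 0 := by simp
      have e2 : (-(ε - Complex.I * l * t) * (u : ℂ)).re = -ε * u := by simp
      rw [e1, e2, Real.exp_zero, mul_one, mul_one, abs_of_nonneg (by linarith : 0 ≤ 1 - |t|)]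
      have h1 := hH u
      have h2 := Real.exp_pos (-ε * u)
      calc (1 - |t|) * (|h u| * Real.exp (-ε * u))
          ≤ 1 * (|h u| * Real.exp (-ε * u)) :=
            mul_le_mul_of_nonneg_right (by linarith [abs_nonneg t]) (by positivity)
        _ ≤ H * Real.exp (-ε * u) := by
            rw [one_mul]; exact mul_le_mul_of_nonneg_right h1 h2.le

lemma integral_mul_fejerKernel_eq_boundary {h : ℝ → ℝ} {H : ℝ} (hmeas : Measurable h)
    (hH : ∀ u, |h u| ≤ H) {G : ℂ → ℂ} (hG : ContinuousOn G {s | 0 ≤ s.re})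
    (hGh : ∀ s : ℂ, 0 < s.re →
      G s = ∫ u in Set.Ioi (0 : ℝ), (h u : ℂ) * Complex.exp (-s * u))
    {l : ℝ} (hl : 0 < l) (v : ℝ) :
    ((∫ u in Set.Ioi (0 : ℝ), h u * fejerKernel (l * (u - v)) : ℝ) : ℂ) =
      ∫ t in (-1 : ℝ)..1, ((1 - |t| : ℝ) : ℂ) * Complex.exp (-(Complex.I * l * v * t)) *
        G (-(Complex.I * l * t)) := by
  have hKint : Integrable (fun u : ℝ => H * fejerKernel (l * (u - v)))
      (volume.restrict (Set.Ioi (0 : ℝ))) := by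
    have := ((integrable_fejerKernel.comp_mul_left' hl.ne').comp_sub_right v).const_mul H
    exact this.integrableOn
  have lim1 : Tendsto (fun ε : ℝ => ∫ u in Set.Ioi (0 : ℝ),
        (h u : ℂ) * Complex.exp (-(ε : ℂ) * u) * (fejerKernel (l * (u - v)) : ℂ)) (𝓝[>] 0)
      (𝓝 ((∫ u in Set.Ioi (0 : ℝ), h u * fejerKernel (l * (u - v)) : ℝ) : ℂ)) := by
    rw [← integral_complex_ofReal]
    refine tendsto_integral_filter_of_dominated_convergence
      (fun u => H * fejerKernel (l * (u - v))) ?_ ?_ hKint ?_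
    · refine Eventually.of_forall fun ε => Measurable.aestronglyMeasurable ?_
      have := measurable_fejerKernel
      fun_prop
    · filter_upwards [self_mem_nhdsWithin] with ε hε
      refine (ae_restrict_iff' measurableSet_Ioi).2 (Eventually.of_forall fun u hu => ?_)
      have hu : 0 < u := hu
      have hε : 0 < ε := hε
      rw [norm_mul, norm_mul, Complex.norm_exp]
      simp only [Complex.norm_real, Real.norm_eq_abs, abs_of_nonneg (fejerKernel_nonneg _)]
      have e1 : (-(ε : ℂ) * u).re = -ε * u := by simp
      rw [e1]
      have h1 : Real.exp (-ε * u) ≤ 1 := Real.exp_le_one_iff.2 (by nlinarith)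
      refine mul_le_mul_of_nonneg_right ?_ (fejerKernel_nonneg _)
      calc |h u| * Real.exp (-ε * u) ≤ |h u| * 1 :=
            mul_le_mul_of_nonneg_left h1 (abs_nonneg _)
        _ ≤ H := by rw [mul_one]; exact hH u
    · refine Eventually.of_forall fun u => ?_
      have hc : Continuous fun ε : ℝ =>
          (h u : ℂ) * Complex.exp (-(ε : ℂ) * u) * (fejerKernel (l * (u - v)) : ℂ) := by fun_prop
      have := (hc.tendsto 0).mono_left (nhdsWithin_le_nhds (s := Set.Ioi 0))
      simpa using this
  have lim2 : Tendsto (fun ε : ℝ => ∫ t in (-1 : ℝ)..1,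
        ((1 - |t| : ℝ) : ℂ) * Complex.exp (-(Complex.I * l * v * t)) *
          G (ε - Complex.I * l * t)) (𝓝[>] 0)
      (𝓝 (∫ t in (-1 : ℝ)..1, ((1 - |t| : ℝ) : ℂ) * Complex.exp (-(Complex.I * l * v * t)) *
          G (-(Complex.I * l * t)))) := by
    have hmaps : Set.MapsTo (fun p : ℝ × ℝ => (p.1 : ℂ) - Complex.I * l * p.2)
        (Set.Icc 0 1 ×ˢ Set.Icc (-1) 1) {s | 0 ≤ s.re} := by
      intro p hp
      simpa using hp.1.1
    have hcont : ContinuousOn (fun p : ℝ × ℝ => G ((p.1 : ℂ) - Complex.I * l * p.2))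
        (Set.Icc 0 1 ×ˢ Set.Icc (-1) 1) :=
      hG.comp (Continuous.continuousOn (by fun_prop)) hmaps
    obtain ⟨B, hB⟩ := (isCompact_Icc.prod isCompact_Icc).exists_bound_of_continuousOn hcont
    have hslice : ∀ ε ∈ Set.Icc (0 : ℝ) 1, ContinuousOn
        (fun t : ℝ => ((1 - |t| : ℝ) : ℂ) * Complex.exp (-(Complex.I * l * v * t)) *
          G (ε - Complex.I * l * t)) (Set.Icc (-1) 1) := by
      intro ε hε
      refine ContinuousOn.mul (Continuous.continuousOn (by fun_prop)) ?_
      exact hcont.comp (f := fun t : ℝ => (ε, t)) (Continuous.continuousOn (by fun_prop))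
        fun t ht => ⟨hε, ht⟩
    have hsmall : ∀ᶠ ε in 𝓝[>] (0 : ℝ), ε ∈ Set.Icc (0 : ℝ) 1 := by
      filter_upwards [Ioc_mem_nhdsGT (zero_lt_one' ℝ)] with ε hε using ⟨hε.1.le, hε.2⟩
    refine intervalIntegral.tendsto_integral_filter_of_dominated_convergence (fun _ => B) ?_ ?_
      intervalIntegrable_const ?_
    · filter_upwards [hsmall] with ε hε
      rw [Set.uIoc_of_le (by norm_num)]
      exact ((hslice ε hε).mono Set.Ioc_subset_Icc_self).aestronglyMeasurable measurableSet_Ioc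
    · filter_upwards [hsmall] with ε hε
      refine Eventually.of_forall fun t ht => ?_
      rw [Set.uIoc_of_le (by norm_num)] at ht
      have ht' : t ∈ Set.Icc (-1 : ℝ) 1 := Set.Ioc_subset_Icc_self ht
      have hT : |t| ≤ 1 := abs_le.2 ht'
      have hb := hB (ε, t) ⟨hε, ht'⟩
      simp only [norm_mul, Complex.norm_exp, Complex.norm_real, Real.norm_eq_abs]
      have e1 : (-(Complex.I * l * v * t)).re = 0 := by simp
      rw [e1, Real.exp_zero, mul_one, abs_of_nonneg (by linarith : 0 ≤ 1 - |t|)]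
      calc (1 - |t|) * ‖G (ε - Complex.I * l * t)‖ ≤ 1 * ‖G (ε - Complex.I * l * t)‖ :=
            mul_le_mul_of_nonneg_right (by linarith [abs_nonneg t]) (norm_nonneg _)
        _ ≤ B := by rw [one_mul]; exact hb
    · refine Eventually.of_forall fun t _ => Tendsto.const_mul _ ?_
      have h0 : ContinuousWithinAt G {s | 0 ≤ s.re} (-(Complex.I * l * t)) :=
        hG _ (by simp)
      refine h0.tendsto.comp (tendsto_nhdsWithin_iff.2 ⟨?_, ?_⟩)
      · have hc : Continuous fun ε : ℝ => (ε : ℂ) - Complex.I * l * t := by fun_prop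
        have := (hc.tendsto 0).mono_left (nhdsWithin_le_nhds (s := Set.Ioi 0))
        simpa using this
      · filter_upwards [hsmall] with ε hε
        simpa using hε.1
  refine tendsto_nhds_unique lim1 (lim2.congr' ?_)
  filter_upwards [self_mem_nhdsWithin] with ε hε
  have hε : 0 < ε := hε
  rw [integral_mul_fejerKernel_eq hmeas hH hε hl v]
  refine intervalIntegral.integral_congr fun t _ => ?_
  rw [hGh (ε - Complex.I * l * t) (by simpa using hε)]

/-- If the Laplace transform of a bounded function extends continuously to the imaginary axis,
its Fejér means at every scale tend to zero. -/
lemma tendsto_fejer_mean_zero {h : ℝ → ℝ} {H : ℝ} (hmeas : Measurable h)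
    (hH : ∀ u, |h u| ≤ H) (hneg : ∀ u < 0, h u = 0) {G : ℂ → ℂ}
    (hG : ContinuousOn G {s | 0 ≤ s.re})
    (hGh : ∀ s : ℂ, 0 < s.re →
      G s = ∫ u in Set.Ioi (0 : ℝ), (h u : ℂ) * Complex.exp (-s * u))
    {l : ℝ} (hl : 0 < l) :
    Tendsto (fun v => ∫ w, h (v + w / l) * fejerKernel w) atTop (𝓝 0) := by
  set B : ℝ → ℂ := (Set.Ioc (-1 : ℝ) 1).indicator
    fun t => ((1 - |t| : ℝ) : ℂ) * G (-(Complex.I * l * t)) with hB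
  have hRL := (Real.tendsto_integral_exp_smul_cocompact B).mono_left atTop_le_cocompact
  have hscale : Tendsto (fun v : ℝ => l * v / (2 * Real.pi)) atTop atTop :=
    (tendsto_id.const_mul_atTop hl).atTop_div_const (by positivity)
  have hRL' := (hRL.comp hscale).norm.const_mul l
  rw [norm_zero, mul_zero] at hRL'
  rw [tendsto_zero_iff_norm_tendsto_zero]
  refine hRL'.congr fun v => ?_
  have hchange : ∫ w, h (v + w / l) * fejerKernel w =
      l * ∫ u in Set.Ioi (0 : ℝ), h u * fejerKernel (l * (u - v)) := by
    have e1 : ∫ u in Set.Ioi (0 : ℝ), h u * fejerKernel (l * (u - v)) =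
        ∫ u, h u * fejerKernel (l * (u - v)) := by
      rw [← integral_Ici_eq_integral_Ioi]
      refine setIntegral_eq_integral_of_forall_compl_eq_zero fun u hu => ?_
      rw [hneg u (by simpa using hu), zero_mul]
    have e2 := Measure.integral_comp_mul_left
      (fun w => h (v + w / l) * fejerKernel w) l
    have e3 := integral_sub_right_eq_self (μ := volume)
      (fun u => h (v + (l * u) / l) * fejerKernel (l * u)) v
    rw [e1]
    have e4 : ∫ u, h u * fejerKernel (l * (u - v)) =
        ∫ u, h (v + (l * (u - v)) / l) * fejerKernel (l * (u - v)) := by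
      refine integral_congr_ae (Eventually.of_forall fun u => ?_)
      simp only
      rw [mul_div_cancel_left₀ _ hl.ne', add_sub_cancel]
    rw [e4, e3, e2, abs_of_pos (inv_pos.2 hl), smul_eq_mul, ← mul_assoc, mul_inv_cancel₀ hl.ne',
      one_mul]
  rw [hchange, norm_mul, Real.norm_of_nonneg hl.le]
  congr 1
  rw [← Complex.norm_real, integral_mul_fejerKernel_eq_boundary hmeas hH hG hGh hl v,
    intervalIntegral.integral_of_le (by norm_num), ← integral_indicator measurableSet_Ioc]
  congr 1
  refine integral_congr_ae (Eventually.of_forall fun t => ?_)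
  simp only [hB, Set.indicator_apply]
  split_ifs
  · rw [Circle.smul_def, Real.fourierChar_apply, smul_eq_mul]
    have : ((2 * Real.pi * -(t * (l * v / (2 * Real.pi))) : ℝ) : ℂ) * Complex.I =
        -(Complex.I * l * v * t) := by
      have hpi : (Real.pi : ℂ) ≠ 0 := by exact_mod_cast Real.pi_ne_zero
      push_cast
      field_simp
    rw [this]
    ring
  · simp

lemma integral_exp_summatory_eq_LSeries {f : ℕ → ℝ} (hf : ∀ n, 0 ≤ f n) {C : ℝ}
    (hC : ∀ x : ℝ, 0 ≤ x → ∑ k ∈ Finset.Icc 1 ⌊x⌋₊, f k ≤ C * x) {z : ℂ} (hz : 1 < z.re) :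
    z * ∫ u in Set.Ioi (0 : ℝ),
        ((∑ k ∈ Finset.Icc 1 ⌊Real.exp u⌋₊, f k : ℝ) : ℂ) * Complex.exp (-z * u) =
      LSeries (fun n => (f n : ℂ)) z := by
  have hO : (fun n : ℕ => ∑ k ∈ Finset.Icc 1 n, f k) =O[atTop] fun n => (n : ℝ) ^ (1 : ℝ) := by
    refine Asymptotics.IsBigO.of_bound C (Eventually.of_forall fun n => ?_)
    have h := hC n n.cast_nonneg
    rw [Nat.floor_natCast] at h
    rw [Real.rpow_one, Real.norm_of_nonneg (Finset.sum_nonneg fun k _ => hf k),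
      Real.norm_of_nonneg n.cast_nonneg]
    exact h
  rw [LSeries_eq_mul_integral_of_nonneg f zero_le_one hz hO hf]
  congr 1
  have himg : Real.exp '' Set.Ioi 0 = Set.Ioi 1 := by
    ext t
    constructor
    · rintro ⟨u, hu, rfl⟩
      exact Real.one_lt_exp_iff.2 hu
    · intro ht
      have ht : 1 < t := ht
      exact ⟨Real.log t, Real.log_pos ht, Real.exp_log (by linarith)⟩
  rw [← himg, integral_image_eq_integral_abs_deriv_smul measurableSet_Ioi
    (fun u _ => (Real.hasDerivAt_exp u).hasDerivWithinAt) Real.exp_injective.injOn]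
  refine integral_congr_ae (Eventually.of_forall fun u => ?_)
  simp only
  rw [abs_of_pos (Real.exp_pos u), Complex.real_smul, Complex.ofReal_exp,
    Complex.cpow_def_of_ne_zero (Complex.exp_ne_zero _), ← Complex.ofReal_exp,
    ← Complex.ofReal_log (Real.exp_pos u).le, Real.log_exp, Complex.ofReal_exp, mul_left_comm,
    ← Complex.exp_add]
  push_cast
  congr 2
  ring

/-- The **Wiener–Ikehara theorem**, under a Chebyshev upper bound. -/
theorem wienerIkehara_of_le {f : ℕ → ℝ} (hf : ∀ n, 0 ≤ f n) {C : ℝ}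
    (hC : ∀ x : ℝ, 0 ≤ x → ∑ k ∈ Finset.Icc 1 ⌊x⌋₊, f k ≤ C * x) {A : ℝ} {g : ℂ → ℂ}
    (hg : ContinuousOn g {s | 1 ≤ s.re})
    (hgf : ∀ s : ℂ, 1 < s.re → g s = LSeries (fun n => (f n : ℂ)) s - A / (s - 1)) :
    Tendsto (fun x : ℝ => (∑ k ∈ Finset.Icc 1 ⌊x⌋₊, f k) / x) atTop (𝓝 A) := by
  set S : ℝ → ℝ := fun x => ∑ k ∈ Finset.Icc 1 ⌊x⌋₊, f k with hS
  have hSmono : Monotone S := fun x y hxy =>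
    Finset.sum_le_sum_of_subset_of_nonneg
      (Finset.Icc_subset_Icc_right (Nat.floor_mono hxy)) fun k _ _ => hf k
  have hS0 : ∀ x, 0 ≤ S x := fun x => Finset.sum_nonneg fun k _ => hf k
  set φ : ℝ → ℝ := fun u => S (Real.exp u) * Real.exp (-u) with hφ
  have hφ0 : ∀ u, 0 ≤ φ u := fun u => mul_nonneg (hS0 _) (Real.exp_pos _).le
  have hφC : ∀ u, φ u ≤ C := by
    intro u
    calc S (Real.exp u) * Real.exp (-u) ≤ (C * Real.exp u) * Real.exp (-u) :=
          mul_le_mul_of_nonneg_right (hC _ (Real.exp_pos u).le) (Real.exp_pos _).le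
      _ = C := by rw [mul_assoc, ← Real.exp_add]; simp
  have hφmeas : Measurable φ := (hSmono.measurable.comp Real.measurable_exp).mul (by fun_prop)
  have hφneg : ∀ u < 0, φ u = 0 := by
    intro u hu
    have : ⌊Real.exp u⌋₊ = 0 := Nat.floor_eq_zero.2 (Real.exp_lt_one_iff.2 hu)
    simp [hφ, hS, this]
  have hφmono : Monotone fun u => φ u * Real.exp u := by
    have : (fun u => φ u * Real.exp u) = fun u => S (Real.exp u) := by
      ext u
      rw [hφ, mul_assoc, ← Real.exp_add]; simp
    rw [this]
    exact hSmono.comp Real.exp_monotone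
  set θ : ℝ → ℝ := (Set.Ici (0 : ℝ)).indicator fun _ => 1 with hθ
  have hθmeas : Measurable θ := measurable_const.indicator measurableSet_Ici
  have hθle : ∀ u, |θ u| ≤ 1 := by
    intro u
    simp only [hθ, Set.indicator_apply]
    split_ifs <;> simp
  set h : ℝ → ℝ := fun u => φ u - A * θ u with hh
  have hhmeas : Measurable h := hφmeas.sub (hθmeas.const_mul A)
  have hhbd : ∀ u, |h u| ≤ C + |A| := by
    intro u
    calc |φ u - A * θ u| ≤ |φ u| + |A * θ u| := abs_sub _ _
      _ ≤ C + |A| := by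
        rw [abs_of_nonneg (hφ0 u), abs_mul]
        have := mul_le_mul_of_nonneg_left (hθle u) (abs_nonneg A)
        linarith [hφC u]
  have hhneg : ∀ u < 0, h u = 0 := by
    intro u hu
    simp [hh, hφneg u hu, hθ, hu]
  set G : ℂ → ℂ := fun s => (g (s + 1) - A) / (s + 1) with hG
  have hGcont : ContinuousOn G {s | 0 ≤ s.re} := by
    refine ContinuousOn.div ((hg.comp (by fun_prop) ?_).sub continuousOn_const) (by fun_prop) ?_
    · intro s hs
      have hs : 0 ≤ s.re := hs
      simpa using hs
    · intro s hs h0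
      have hs : 0 ≤ s.re := hs
      have := congrArg Complex.re h0
      simp at this
      linarith
  have hGh : ∀ s : ℂ, 0 < s.re →
      G s = ∫ u in Set.Ioi (0 : ℝ), (h u : ℂ) * Complex.exp (-s * u) := by
    intro s hs
    have hs0 : s ≠ 0 := by rintro rfl; simp at hs
    have hs1 : s + 1 ≠ 0 := by
      intro h0
      have := congrArg Complex.re h0
      simp at this
      linarith
    have hs' : 1 < (s + 1).re := by simpa using hs
    have hφbd : ∀ u, |φ u| ≤ C := fun u => by rw [abs_of_nonneg (hφ0 u)]; exact hφC u
    have e1 : ∫ u in Set.Ioi (0 : ℝ), (h u : ℂ) * Complex.exp (-s * u) =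
        (∫ u in Set.Ioi (0 : ℝ), (φ u : ℂ) * Complex.exp (-s * u)) -
          A * ∫ u in Set.Ioi (0 : ℝ), (θ u : ℂ) * Complex.exp (-s * u) := by
      rw [← integral_const_mul, ← integral_sub (integrableOn_laplace hφmeas hφbd hs)
        ((integrableOn_laplace hθmeas hθle hs).const_mul _)]
      refine integral_congr_ae (Eventually.of_forall fun u => ?_)
      simp only [hh]
      push_cast
      ring
    have e2 : ∫ u in Set.Ioi (0 : ℝ), (θ u : ℂ) * Complex.exp (-s * u) = 1 / s := by
      have : ∫ u in Set.Ioi (0 : ℝ), (θ u : ℂ) * Complex.exp (-s * u) =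
          ∫ u in Set.Ioi (0 : ℝ), Complex.exp (-s * u) := by
        refine setIntegral_congr_fun measurableSet_Ioi fun u hu => ?_
        have hu : 0 < u := hu
        simp [hθ, hu.le]
      rw [this, integral_exp_mul_complex_Ioi (by simpa using hs)]
      simp
    have e3 : ∫ u in Set.Ioi (0 : ℝ), (φ u : ℂ) * Complex.exp (-s * u) =
        LSeries (fun n => (f n : ℂ)) (s + 1) / (s + 1) := by
      rw [eq_div_iff hs1, mul_comm, ← integral_exp_summatory_eq_LSeries hf hC hs']
      congr 1
      refine integral_congr_ae (Eventually.of_forall fun u => ?_)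
      simp only [hφ, hS]
      rw [Complex.ofReal_mul, mul_assoc, Complex.ofReal_exp, ← Complex.exp_add]
      congr 2
      push_cast
      ring
    rw [e1, e2, e3, hG]
    simp only
    rw [hgf (s + 1) hs', add_sub_cancel_right]
    field_simp
    ring
  have hmean : ∀ l : ℝ, 0 < l → Tendsto (fun v => ∫ w, φ (v + w / l) * fejerKernel w) atTop
      (𝓝 (A * ∫ w, fejerKernel w)) := by
    intro l hl
    have h1 := tendsto_fejer_mean_zero hhmeas hhbd hhneg hGcont hGh hl
    have h2 : Tendsto (fun v => ∫ w, θ (v + w / l) * fejerKernel w) atTop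
        (𝓝 (∫ w, fejerKernel w)) := by
      refine tendsto_integral_filter_of_dominated_convergence fejerKernel
        (Eventually.of_forall fun v => ((hθmeas.comp (by fun_prop)).mul
          measurable_fejerKernel).aestronglyMeasurable)
        (Eventually.of_forall fun v => Eventually.of_forall fun w => ?_)
        integrable_fejerKernel (Eventually.of_forall fun w => ?_)
      · rw [norm_mul, Real.norm_of_nonneg (fejerKernel_nonneg w)]
        exact mul_le_of_le_one_left (fejerKernel_nonneg w) (hθle _)
      · refine tendsto_const_nhds.congr' ?_
        filter_upwards [eventually_ge_atTop (-(w / l))] with v hv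
        have : 0 ≤ v + w / l := by linarith
        simp [hθ, this]
    have h3 := h1.add (h2.const_mul A)
    rw [zero_add] at h3
    refine h3.congr fun v => ?_
    rw [← integral_const_mul, ← integral_add]
    · refine integral_congr_ae (Eventually.of_forall fun w => ?_)
      simp only [hh]
      ring
    · refine (integrable_fejerKernel.const_mul (C + |A|)).mono'
        ((hhmeas.comp (by fun_prop)).mul measurable_fejerKernel).aestronglyMeasurable
        (Eventually.of_forall fun w => ?_)
      rw [norm_mul, Real.norm_of_nonneg (fejerKernel_nonneg w)]
      exact mul_le_mul_of_nonneg_right (hhbd _) (fejerKernel_nonneg w)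
    · refine (integrable_fejerKernel.mono'
        ((hθmeas.comp (by fun_prop)).mul measurable_fejerKernel).aestronglyMeasurable
        (Eventually.of_forall fun w => ?_)).const_mul A
      rw [Pi.mul_apply, norm_mul, Real.norm_of_nonneg (fejerKernel_nonneg w)]
      exact mul_le_of_le_one_left (fejerKernel_nonneg w) (hθle _)
  have hlim := tendsto_of_tendsto_fejer_mean hφ0 hφC hφmeas hφmono hmean
  refine (hlim.comp Real.tendsto_log_atTop).congr' ?_
  filter_upwards [eventually_gt_atTop 0] with x hx
  simp only [Function.comp, hφ]
  rw [Real.exp_log hx, Real.exp_neg, Real.exp_log hx, div_eq_mul_inv]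

open ArithmeticFunction in
lemma sum_Ioc_sum_divisorsAntidiagonal (f g : ℕ → ℝ) (N : ℕ) :
    ∑ n ∈ Finset.Ioc 0 N, ∑ p ∈ n.divisorsAntidiagonal, f p.1 * g p.2 =
      ∑ d ∈ Finset.Ioc 0 N, f d * ∑ m ∈ Finset.Ioc 0 (N / d), g m := by
  let F : ArithmeticFunction ℝ := ⟨fun n => if n = 0 then 0 else f n, if_pos rfl⟩
  let G : ArithmeticFunction ℝ := ⟨fun n => if n = 0 then 0 else g n, if_pos rfl⟩
  have hF : ∀ n, 0 < n → F n = f n := fun n hn => if_neg hn.ne'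
  have hG : ∀ n, 0 < n → G n = g n := fun n hn => if_neg hn.ne'
  have h := sum_Ioc_mul_eq_sum_sum F G N
  calc _ = ∑ n ∈ Finset.Ioc 0 N, (F * G) n := by
        refine Finset.sum_congr rfl fun n _ => ?_
        rw [mul_apply]
        refine Finset.sum_congr rfl fun p hp => ?_
        rw [hF _ (Nat.pos_of_ne_zero (Nat.ne_zero_of_mem_divisorsAntidiagonal hp).1),
          hG _ (Nat.pos_of_ne_zero (Nat.ne_zero_of_mem_divisorsAntidiagonal hp).2)]
    _ = _ := by
        rw [h]
        refine Finset.sum_congr rfl fun d hd => ?_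
        rw [hF _ (Finset.mem_Ioc.1 hd).1]
        congr 1
        exact Finset.sum_congr rfl fun m hm => hG _ (Finset.mem_Ioc.1 hm).1

lemma mul_log_sub_self_le_sum_log (N : ℕ) :
    N * Real.log N - N ≤ ∑ n ∈ Finset.Ioc 0 N, Real.log n := by
  induction N with
  | zero => simp
  | succ n ih =>
    rw [← Finset.insert_Ioc_right_eq_Ioc_add_one n.zero_le, Finset.sum_insert (by simp)]
    rcases n.eq_zero_or_pos with rfl | hn
    · simp
    have hn' : (0 : ℝ) < n := by exact_mod_cast hn
    have h := Real.log_le_sub_one_of_pos (show (0 : ℝ) < (n + 1) / n by positivity)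
    rw [Real.log_div (by positivity) hn'.ne', add_div, div_self hn'.ne', add_sub_cancel_left] at h
    have h2 := mul_le_mul_of_nonneg_left h hn'.le
    rw [mul_one_div_cancel hn'.ne'] at h2
    push_cast
    linarith

lemma sum_log_le_mul_log (N : ℕ) : ∑ n ∈ Finset.Ioc 0 N, Real.log n ≤ N * Real.log N := by
  calc ∑ n ∈ Finset.Ioc 0 N, Real.log n ≤ ∑ n ∈ Finset.Ioc 0 N, Real.log N := by
        refine Finset.sum_le_sum fun n hn => ?_
        rw [Finset.mem_Ioc] at hn
        exact Real.log_le_log (by exact_mod_cast hn.1) (by exact_mod_cast hn.2)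
    _ = N * Real.log N := by simp

open ArithmeticFunction in
lemma sum_vonMangoldt_le (N : ℕ) :
    ∑ n ∈ Finset.Ioc 0 N, vonMangoldt n ≤ (Real.log 4 + 4) * N := by
  have := Chebyshev.psi_le_const_mul_self (x := N) N.cast_nonneg
  rwa [Chebyshev.psi, Nat.floor_natCast] at this

lemma natCast_div_bounds (N d : ℕ) (hd : 0 < d) :
    (N : ℝ) / d < (N / d : ℕ) + 1 ∧ ((N / d : ℕ) : ℝ) ≤ N / d := by
  refine ⟨?_, Nat.cast_div_le⟩
  rw [div_lt_iff₀ (by exact_mod_cast hd)]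
  have := Nat.lt_div_mul_add hd (a := N)
  have h2 : N < (N / d + 1) * d := by linarith
  exact_mod_cast h2

open ArithmeticFunction in
/-- **Mertens' first theorem**. -/
lemma abs_sum_vonMangoldt_div_sub_log_le {N : ℕ} (hN : 1 ≤ N) :
    |∑ d ∈ Finset.Ioc 0 N, vonMangoldt d / d - Real.log N| ≤ Real.log 4 + 5 := by
  have hN' : (0 : ℝ) < N := by exact_mod_cast hN
  have hsum : ∑ n ∈ Finset.Ioc 0 N, Real.log n =
      ∑ d ∈ Finset.Ioc 0 N, vonMangoldt d * ((N / d : ℕ) : ℝ) := by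
    rw [← sum_Ioc_mul_zeta_eq_sum, vonMangoldt_mul_zeta]
    rfl
  have hup : ∑ d ∈ Finset.Ioc 0 N, vonMangoldt d * ((N / d : ℕ) : ℝ) ≤
      N * ∑ d ∈ Finset.Ioc 0 N, vonMangoldt d / d := by
    rw [Finset.mul_sum]
    refine Finset.sum_le_sum fun d hd => ?_
    have := mul_le_mul_of_nonneg_left
      (natCast_div_bounds N d (Finset.mem_Ioc.1 hd).1).2 (vonMangoldt_nonneg (n := d))
    calc _ ≤ _ := this
      _ = _ := by ring
  have hlow : N * ∑ d ∈ Finset.Ioc 0 N, vonMangoldt d / d ≤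
      ∑ d ∈ Finset.Ioc 0 N, vonMangoldt d * ((N / d : ℕ) : ℝ) +
        ∑ d ∈ Finset.Ioc 0 N, vonMangoldt d := by
    rw [Finset.mul_sum, ← Finset.sum_add_distrib]
    refine Finset.sum_le_sum fun d hd => ?_
    have := mul_le_mul_of_nonneg_left
      (natCast_div_bounds N d (Finset.mem_Ioc.1 hd).1).1.le (vonMangoldt_nonneg (n := d))
    calc _ = vonMangoldt d * ((N : ℝ) / d) := by ring
      _ ≤ _ := this
      _ = _ := by ring
  rw [← hsum] at hup hlow
  have h1 := mul_log_sub_self_le_sum_log N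
  have h2 := sum_log_le_mul_log N
  have h3 := sum_vonMangoldt_le N
  have h4 : 0 ≤ Real.log 4 := Real.log_nonneg (by norm_num)
  rw [abs_le]
  constructor
  · refine le_of_mul_le_mul_left ?_ hN'
    nlinarith
  · refine le_of_mul_le_mul_left ?_ hN'
    nlinarith

/-- Abel's inequality. -/
lemma abs_sum_Ico_mul_le_of_antitone {c P f : ℕ → ℝ} (hP : ∀ k, P (k + 1) = P k + c k)
    (hPb : ∀ j k, |P j - P k| ≤ 1) {a b : ℕ} (hab : a ≤ b) (hf0 : ∀ k, a ≤ k → 0 ≤ f k)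
    (hf : ∀ k, a ≤ k → f (k + 1) ≤ f k) : |∑ k ∈ Finset.Ico a b, c k * f k| ≤ f a := by
  have key : |∑ k ∈ Finset.Ico a b, c k * f k - (P b - P a) * f b| ≤ f a - f b := by
    induction b, hab using Nat.le_induction with
    | base => simp
    | succ b hab ih =>
      rw [Finset.sum_Ico_succ_top hab]
      have e : ∑ k ∈ Finset.Ico a b, c k * f k + c b * f b - (P (b + 1) - P a) * f (b + 1) =
          (∑ k ∈ Finset.Ico a b, c k * f k - (P b - P a) * f b) +
            (P (b + 1) - P a) * (f b - f (b + 1)) := by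
        rw [hP b]; ring
      rw [e]
      refine (abs_add_le _ _).trans ?_
      have h1 : |(P (b + 1) - P a) * (f b - f (b + 1))| ≤ f b - f (b + 1) := by
        rw [abs_mul, abs_of_nonneg (sub_nonneg.2 (hf b hab))]
        exact mul_le_of_le_one_left (sub_nonneg.2 (hf b hab)) (hPb _ _)
      linarith
  have h2 : |(P b - P a) * f b| ≤ f b := by
    rw [abs_mul, abs_of_nonneg (hf0 b hab)]
    exact mul_le_of_le_one_left (hf0 b hab) (hPb _ _)
  have := abs_add_le (∑ k ∈ Finset.Ico a b, c k * f k - (P b - P a) * f b) ((P b - P a) * f b)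
  rw [sub_add_cancel] at this
  linarith

/-- The nontrivial character modulo four, as a real-valued function. -/
noncomputable def chiFour (n : ℕ) : ℝ := (ZMod.χ₄ n : ℤ)

lemma chiFour_eq (n : ℕ) :
    chiFour n = if n % 2 = 0 then 0 else if n % 4 = 1 then 1 else -1 := by
  rw [chiFour, ZMod.χ₄_nat_eq_if_mod_four]
  split_ifs <;> simp

lemma chiFour_mul (m n : ℕ) : chiFour (m * n) = chiFour m * chiFour n := by
  rw [chiFour, Nat.cast_mul, map_mul, Int.cast_mul, chiFour, chiFour]

lemma abs_chiFour_le (n : ℕ) : |chiFour n| ≤ 1 := by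
  rw [chiFour_eq]
  split_ifs <;> simp

lemma abs_sum_Ico_chiFour_mul_le {f : ℕ → ℝ} {a b : ℕ} (hab : a ≤ b)
    (hf0 : ∀ k, a ≤ k → 0 ≤ f k) (hf : ∀ k, a ≤ k → f (k + 1) ≤ f k) :
    |∑ k ∈ Finset.Ico a b, chiFour k * f k| ≤ f a := by
  refine abs_sum_Ico_mul_le_of_antitone
    (P := fun k => if k % 4 = 2 ∨ k % 4 = 3 then 1 else 0) (fun k => ?_) (fun j k => ?_) hab hf0 hf
  · rw [chiFour_eq]
    have : k % 4 < 4 := Nat.mod_lt _ (by norm_num)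
    have h2 : k % 2 = k % 4 % 2 := by omega
    have h3 : (k + 1) % 4 = (k % 4 + 1) % 4 := by omega
    simp only [h2, h3]
    interval_cases k % 4 <;> simp
  · split_ifs <;> simp

lemma exists_tendsto_sum_chiFour_div :
    ∃ L : ℝ, 0 < L ∧
      ∀ K : ℕ, |∑ m ∈ Finset.Ioc 0 K, chiFour m / m - L| ≤ 1 / ((K : ℝ) + 1) := by
  set c : ℕ → ℝ := fun K => ∑ m ∈ Finset.Ioc 0 K, chiFour m / m with hc
  have hcauchy : ∀ K M : ℕ, K ≤ M → |c M - c K| ≤ 1 / ((K : ℝ) + 1) := by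
    intro K M hKM
    have h1 : c M - c K = ∑ m ∈ Finset.Ico (K + 1) (M + 1), chiFour m * (1 / (m : ℝ)) := by
      rw [hc]
      simp only
      rw [← Finset.sum_Ioc_consecutive _ K.zero_le hKM, add_sub_cancel_left]
      refine Finset.sum_congr ?_ fun m _ => by ring
      ext m
      simp only [Finset.mem_Ioc, Finset.mem_Ico]
      omega
    rw [h1]
    refine (abs_sum_Ico_chiFour_mul_le (by omega) (fun k _ => by positivity)
      fun k hk => ?_).trans (by push_cast; exact le_rfl)
    have hk0 : (0 : ℝ) < k := by exact_mod_cast (by omega : 0 < k)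
    exact one_div_le_one_div_of_le hk0 (by push_cast; linarith)
  have hC : CauchySeq c := by
    refine cauchySeq_of_le_tendsto_0 (fun K : ℕ => 2 * (1 / ((K : ℝ) + 1))) (fun n m K hn hm => ?_) ?_
    · rw [Real.dist_eq]
      have h1 := hcauchy K n hn
      have h2 := hcauchy K m hm
      rw [abs_le] at *
      constructor <;> linarith
    · simpa using (tendsto_one_div_add_atTop_nhds_zero_nat (𝕜 := ℝ)).const_mul 2
  obtain ⟨L, hL⟩ := cauchySeq_tendsto_of_complete hC
  have hbd : ∀ K : ℕ, |c K - L| ≤ 1 / ((K : ℝ) + 1) := by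
    intro K
    rw [abs_sub_comm]
    refine le_of_tendsto (hL.sub_const (c K)).abs ?_
    filter_upwards [eventually_ge_atTop K] with M hM using hcauchy K M hM
  refine ⟨L, ?_, hbd⟩
  have h2 := hbd 2
  have e : c 2 = 1 := by
    rw [hc]
    simp [Finset.sum_Ioc_succ_top, chiFour_eq]
  rw [e, abs_le] at h2
  norm_num at h2
  linarith

open ArithmeticFunction in
lemma exists_abs_sum_chiFour_mul_vonMangoldt_div_le :
    ∃ K : ℝ, ∀ N : ℕ, |∑ d ∈ Finset.Ioc 0 N, chiFour d * vonMangoldt d / d| ≤ K := by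
  obtain ⟨L, hL0, hL⟩ := exists_tendsto_sum_chiFour_div
  refine ⟨(1 + (Real.log 4 + 4)) / L, fun N => ?_⟩
  rcases N.eq_zero_or_pos with rfl | hN
  · have : 0 ≤ Real.log 4 := Real.log_nonneg (by norm_num)
    simp
    positivity
  have hN' : (0 : ℝ) < N := by exact_mod_cast hN
  have hlog : |∑ n ∈ Finset.Ioc 0 N, chiFour n * Real.log n / n| ≤ 1 := by
    have h1 : |∑ n ∈ Finset.Ico 3 (max 3 (N + 1)), chiFour n * (Real.log n / n)| ≤
        Real.log (3 : ℕ) / (3 : ℕ) := by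
      refine abs_sum_Ico_chiFour_mul_le (f := fun n : ℕ => Real.log n / n) (le_max_left _ _)
        (fun k _ => by positivity) fun k hk => ?_
      have hk : (3 : ℝ) ≤ k := by exact_mod_cast hk
      have he := Real.exp_one_lt_three
      refine Real.log_div_self_antitoneOn ?_ ?_ (by push_cast; linarith)
      · change Real.exp 1 ≤ k
        linarith
      · change Real.exp 1 ≤ ((k + 1 : ℕ) : ℝ)
        push_cast
        linarith
    have h2 : ∑ n ∈ Finset.Ioc 0 N, chiFour n * Real.log n / n =
        ∑ n ∈ Finset.Ico 3 (max 3 (N + 1)), chiFour n * (Real.log n / n) := by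
      symm
      calc ∑ n ∈ Finset.Ico 3 (max 3 (N + 1)), chiFour n * (Real.log n / n)
          = ∑ n ∈ Finset.Ico 3 (max 3 (N + 1)), chiFour n * Real.log n / n :=
            Finset.sum_congr rfl fun n _ => by ring
        _ = _ := by
          refine Finset.sum_subset (fun n hn => ?_) fun n hn hn' => ?_
          · simp only [Finset.mem_Ico, Finset.mem_Ioc] at *
            omega
          · have : n = 1 ∨ n = 2 := by
              simp only [Finset.mem_Ico, Finset.mem_Ioc] at *
              omega
            rcases this with rfl | rfl <;> simp [chiFour_eq]
    rw [h2]
    refine h1.trans ?_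
    have := Real.log_le_sub_one_of_pos (show (0 : ℝ) < 3 by norm_num)
    push_cast
    linarith
  have hconv : ∑ n ∈ Finset.Ioc 0 N, chiFour n * Real.log n / n =
      ∑ d ∈ Finset.Ioc 0 N, chiFour d * vonMangoldt d / d *
        ∑ m ∈ Finset.Ioc 0 (N / d), chiFour m / m := by
    rw [← sum_Ioc_sum_divisorsAntidiagonal]
    refine Finset.sum_congr rfl fun n hn => ?_
    rw [← vonMangoldt_sum, ← Nat.sum_divisorsAntidiagonal fun i _ => vonMangoldt i,
      Finset.mul_sum, Finset.sum_div]
    refine Finset.sum_congr rfl fun p hp => ?_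
    obtain ⟨hp, -⟩ := Nat.mem_divisorsAntidiagonal.1 hp
    rw [← hp, chiFour_mul]
    push_cast
    ring
  have hdiff : |∑ n ∈ Finset.Ioc 0 N, chiFour n * Real.log n / n -
      (∑ d ∈ Finset.Ioc 0 N, chiFour d * vonMangoldt d / d) * L| ≤ Real.log 4 + 4 := by
    rw [hconv, Finset.sum_mul, ← Finset.sum_sub_distrib]
    calc _ ≤ ∑ d ∈ Finset.Ioc 0 N, |chiFour d * vonMangoldt d / d *
            (∑ m ∈ Finset.Ioc 0 (N / d), chiFour m / m) - chiFour d * vonMangoldt d / d * L| :=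
          Finset.abs_sum_le_sum_abs _ _
      _ ≤ ∑ d ∈ Finset.Ioc 0 N, vonMangoldt d / N := by
          refine Finset.sum_le_sum fun d hd => ?_
          have hd0 : 0 < d := (Finset.mem_Ioc.1 hd).1
          have hd : (0 : ℝ) < d := by exact_mod_cast hd0
          rw [← mul_sub, abs_mul, abs_div, abs_mul, abs_of_pos hd,
            abs_of_nonneg (vonMangoldt_nonneg (n := d))]
          have h1 : 1 / (((N / d : ℕ) : ℝ) + 1) ≤ d / N := by
            rw [← one_div_div (N : ℝ) d]
            exact one_div_le_one_div_of_le (by positivity) (natCast_div_bounds N d hd0).1.le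
          calc _ ≤ 1 * vonMangoldt d / d * (d / N) := by
                have := abs_chiFour_le d
                have := vonMangoldt_nonneg (n := d)
                have := (hL (N / d)).trans h1
                gcongr
            _ = _ := by field_simp
      _ ≤ Real.log 4 + 4 := by
          rw [← Finset.sum_div, div_le_iff₀ hN']
          exact sum_vonMangoldt_le N
  rw [le_div_iff₀ hL0]
  rw [show ∀ t : ℝ, |t| * L = |t * L| from fun t => by rw [abs_mul, abs_of_pos hL0]]
  rw [abs_le] at *
  constructor <;> linarith

open ArithmeticFunction in
/-- The class of weights that agree with the von Mangoldt function of the residue class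
`1` modulo four up to bounded changes at the prime two and at the proper prime powers. -/
structure IsHalfMangoldt (w : ℕ → ℝ) : Prop where
  nonneg : ∀ n, 0 ≤ w n
  le : ∀ n, w n ≤ 2 * vonMangoldt n
  eq_of_prime : ∀ p, p.Prime → p ≠ 2 → w p = if p % 4 = 1 then Real.log p else 0

open ArithmeticFunction in
lemma isHalfMangoldt_residueClass : IsHalfMangoldt (vonMangoldt.residueClass (1 : ZMod 4)) where
  nonneg := vonMangoldt.residueClass_nonneg _
  le n := (vonMangoldt.residueClass_le _ n).trans (by linarith [vonMangoldt_nonneg (n := n)])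
  eq_of_prime p hp _ := by
    have : ((p : ZMod 4) = 1) ↔ p % 4 = 1 := by
      rw [← Nat.cast_one, ZMod.natCast_eq_natCast_iff']
    simp only [Set.indicator_apply, Set.mem_ofPred_eq, this, vonMangoldt_apply_prime hp]

open ArithmeticFunction in
lemma isHalfMangoldt_half_one_add_chiFour :
    IsHalfMangoldt fun n => (1 + chiFour n) / 2 * vonMangoldt n where
  nonneg n := by
    have := abs_le.1 (abs_chiFour_le n)
    exact mul_nonneg (by linarith) vonMangoldt_nonneg
  le n := by
    have := abs_le.1 (abs_chiFour_le n)
    exact mul_le_mul_of_nonneg_right (by linarith) vonMangoldt_nonneg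
  eq_of_prime p hp h2 := by
    have := hp.eq_two_or_odd
    rw [chiFour_eq, vonMangoldt_apply_prime hp, if_neg (by omega)]
    split_ifs <;> norm_num

open ArithmeticFunction in
lemma IsHalfMangoldt.abs_sub_le {v w : ℕ → ℝ} (hv : IsHalfMangoldt v) (hw : IsHalfMangoldt w)
    (n : ℕ) : |v n - w n| ≤
      2 * ((if n.Prime then 0 else vonMangoldt n) + if n = 2 then Real.log 2 else 0) := by
  have h : |v n - w n| ≤ 2 * vonMangoldt n := by
    have := hv.nonneg n
    have := hw.nonneg n
    have := hv.le n
    have := hw.le n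
    rw [abs_le]
    constructor <;> linarith
  by_cases hp : n.Prime
  · rcases eq_or_ne n 2 with rfl | h2
    · rw [vonMangoldt_apply_prime hp] at h
      simpa [hp] using h
    · rw [hv.eq_of_prime n hp h2, hw.eq_of_prime n hp h2, if_pos hp, if_neg h2]
      simp
  · rw [if_neg hp]
    refine h.trans ?_
    split_ifs
    · have := Real.log_nonneg (show (1 : ℝ) ≤ 2 by norm_num)
      linarith
    · linarith

open ArithmeticFunction in
lemma sum_vonMangoldt_not_prime_div_le (N : ℕ) :
    ∑ d ∈ Finset.Ioc 0 N, (if d.Prime then 0 else vonMangoldt d) / (d : ℝ) ≤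
      ∑' d : ℕ, (if d.Prime then 0 else vonMangoldt d) / (d : ℝ) := by
  have h := vonMangoldt.summable_residueClass_non_primes_div (1 : ZMod 1)
  have e : ∀ n, vonMangoldt.residueClass (1 : ZMod 1) n = vonMangoldt n := fun n =>
    Set.indicator_of_mem (s := {n : ℕ | (n : ZMod 1) = 1}) (Subsingleton.elim _ _) _
  simp only [e] at h
  refine h.sum_le_tsum _ fun d _ => ?_
  split_ifs
  · simp
  · exact div_nonneg vonMangoldt_nonneg d.cast_nonneg

open ArithmeticFunction in
lemma sum_vonMangoldt_not_prime_eq (N : ℕ) :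
    ∑ d ∈ Finset.Ioc 0 N, (if d.Prime then 0 else vonMangoldt d) =
      Chebyshev.psi N - Chebyshev.theta N := by
  rw [Chebyshev.psi, Chebyshev.theta, Nat.floor_natCast, Finset.sum_filter,
    ← Finset.sum_sub_distrib]
  refine Finset.sum_congr rfl fun d _ => ?_
  split_ifs with hp
  · rw [vonMangoldt_apply_prime hp, sub_self]
  · rw [sub_zero]

lemma sum_Ioc_ite_eq_two_le {c : ℝ} (hc : 0 ≤ c) (N : ℕ) :
    ∑ d ∈ Finset.Ioc 0 N, (if d = 2 then c else 0) ≤ c := by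
  rw [Finset.sum_ite_eq']
  split_ifs <;> linarith

open ArithmeticFunction in
lemma IsHalfMangoldt.exists_abs_sum_div_sub_le {w : ℕ → ℝ} (hw : IsHalfMangoldt w) :
    ∃ K : ℝ, 0 ≤ K ∧ ∀ N : ℕ, 1 ≤ N →
      |∑ d ∈ Finset.Ioc 0 N, w d / d - 1 / 2 * Real.log N| ≤ K := by
  obtain ⟨K, hK⟩ := exists_abs_sum_chiFour_mul_vonMangoldt_div_le
  have hlog2 : 0 ≤ Real.log 2 := Real.log_nonneg (by norm_num)
  set Q := ∑' d : ℕ, (if d.Prime then 0 else vonMangoldt d) / (d : ℝ) with hQ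
  have hb : ∀ N : ℕ, 1 ≤ N → |∑ d ∈ Finset.Ioc 0 N, w d / d - 1 / 2 * Real.log N| ≤
      2 * (Q + Real.log 2) + (K + (Real.log 4 + 5)) / 2 := by
    intro N hN
    have h1 := hK N
    have h2 := abs_sum_vonMangoldt_div_sub_log_le hN
    have h3 : |∑ d ∈ Finset.Ioc 0 N,
        (w d - (1 + chiFour d) / 2 * vonMangoldt d) / d| ≤ 2 * (Q + Real.log 2) := by
      refine (Finset.abs_sum_le_sum_abs _ _).trans ?_
      have : ∀ d ∈ Finset.Ioc 0 N, |(w d - (1 + chiFour d) / 2 * vonMangoldt d) / d| ≤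
          2 * ((if d.Prime then 0 else vonMangoldt d) / (d : ℝ) +
            if d = 2 then Real.log 2 else 0) := by
        intro d hd
        have hd1 : (1 : ℝ) ≤ d := by exact_mod_cast (Finset.mem_Ioc.1 hd).1
        have hd0 : (0 : ℝ) < d := by linarith
        rw [abs_div, abs_of_pos hd0, div_le_iff₀ hd0]
        refine (hw.abs_sub_le isHalfMangoldt_half_one_add_chiFour d).trans ?_
        have e : (if d.Prime then 0 else vonMangoldt d) / (d : ℝ) * d =
          if d.Prime then 0 else vonMangoldt d := div_mul_cancel₀ _ hd0.ne'
        rw [mul_assoc, add_mul, e]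
        have : (0 : ℝ) ≤ if d = 2 then Real.log 2 else 0 := by split_ifs <;> simp [hlog2]
        have := le_mul_of_one_le_right this hd1
        linarith
      refine (Finset.sum_le_sum this).trans ?_
      rw [← Finset.mul_sum, Finset.sum_add_distrib]
      have := sum_vonMangoldt_not_prime_div_le N
      have := sum_Ioc_ite_eq_two_le hlog2 N
      linarith
    have e : ∑ d ∈ Finset.Ioc 0 N, (w d - (1 + chiFour d) / 2 * vonMangoldt d) / d =
        ∑ d ∈ Finset.Ioc 0 N, w d / d - (∑ d ∈ Finset.Ioc 0 N, vonMangoldt d / d +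
          ∑ d ∈ Finset.Ioc 0 N, chiFour d * vonMangoldt d / d) / 2 := by
      rw [← Finset.sum_add_distrib, Finset.sum_div, ← Finset.sum_sub_distrib]
      exact Finset.sum_congr rfl fun d _ => by ring
    rw [e] at h3
    rw [abs_le] at *
    constructor <;> linarith
  exact ⟨_, (abs_nonneg _).trans (hb 1 le_rfl), hb⟩

open ArithmeticFunction in
lemma tendsto_sum_residueClass_one_div :
    Tendsto (fun N : ℕ => (∑ d ∈ Finset.Ioc 0 N, vonMangoldt.residueClass (1 : ZMod 4) d) / N)
      atTop (𝓝 (1 / 2)) := by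
  have hIcc : ∀ N : ℕ, Finset.Icc 1 N = Finset.Ioc 0 N := fun N => by
    ext; simp [Nat.succ_le_iff]
  have h := wienerIkehara_of_le (f := vonMangoldt.residueClass (1 : ZMod 4))
    (vonMangoldt.residueClass_nonneg _) (C := Real.log 4 + 4) (A := 1 / 2)
    (g := vonMangoldt.LFunctionResidueClassAux (1 : ZMod 4)) (fun x hx => ?_)
    (vonMangoldt.continuousOn_LFunctionResidueClassAux _) fun s hs => ?_
  · simpa only [hIcc, Function.comp_def, Nat.floor_natCast] using
      h.comp tendsto_natCast_atTop_atTop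
  · rw [hIcc]
    exact (Finset.sum_le_sum fun d _ => vonMangoldt.residueClass_le _ d).trans
      (Chebyshev.psi_le_const_mul_self hx)
  · rw [vonMangoldt.eqOn_LFunctionResidueClassAux isUnit_one hs]
    have : Nat.totient 4 = 2 := by decide
    simp [this]

lemma tendsto_psi_sub_theta_div :
    Tendsto (fun N : ℕ => (Chebyshev.psi N - Chebyshev.theta N) / N) atTop (𝓝 0) := by
  have h : Tendsto (fun x : ℝ => 2 * (Real.log x / x ^ (1 / 2 : ℝ))) atTop (𝓝 0) := by
    simpa using (isLittleO_log_rpow_atTop (show (0 : ℝ) < 1 / 2 by norm_num)).tendsto_div_nhds_zero.const_mul 2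
  refine tendsto_of_tendsto_of_tendsto_of_le_of_le' tendsto_const_nhds
    (h.comp tendsto_natCast_atTop_atTop) (Eventually.of_forall fun N => ?_) ?_
  · exact div_nonneg (sub_nonneg.2 (Chebyshev.theta_le_psi _)) N.cast_nonneg
  · filter_upwards [eventually_ge_atTop 1] with N hN
    have hN : (1 : ℝ) ≤ N := by exact_mod_cast hN
    have hN0 : (0 : ℝ) < N := by linarith
    have h1 := Chebyshev.psi_sub_theta_le hN
    simp only [Function.comp]
    rw [← Real.sqrt_eq_rpow, div_le_iff₀ hN0]
    refine h1.trans (le_of_eq ?_)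
    have h2 := Real.mul_self_sqrt hN0.le
    have h3 := (Real.sqrt_pos.2 hN0).ne'
    calc 2 * √(N : ℝ) * Real.log N = 2 * (Real.log N / √(N : ℝ)) * (√(N : ℝ) * √(N : ℝ)) := by
          field_simp
      _ = _ := by rw [h2]

open ArithmeticFunction in
/-- The prime number theorem for half of the primes. -/
lemma IsHalfMangoldt.tendsto_sum_div {w : ℕ → ℝ} (hw : IsHalfMangoldt w) :
    Tendsto (fun N : ℕ => (∑ d ∈ Finset.Ioc 0 N, w d) / N) atTop (𝓝 (1 / 2)) := by
  have hlog2 : 0 ≤ Real.log 2 := Real.log_nonneg (by norm_num)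
  have hdiff : Tendsto (fun N : ℕ => (∑ d ∈ Finset.Ioc 0 N,
      (w d - vonMangoldt.residueClass (1 : ZMod 4) d)) / N) atTop (𝓝 0) := by
    have h := (tendsto_psi_sub_theta_div.add
      (tendsto_const_div_atTop_nhds_zero_nat (Real.log 2))).const_mul 2
    rw [add_zero, mul_zero] at h
    refine squeeze_zero_norm (fun N => ?_) h
    rw [norm_div, Real.norm_natCast, Real.norm_eq_abs, ← add_div, ← mul_div_assoc]
    refine div_le_div_of_nonneg_right ?_ N.cast_nonneg
    refine (Finset.abs_sum_le_sum_abs _ _).trans ((Finset.sum_le_sum fun d _ =>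
      hw.abs_sub_le isHalfMangoldt_residueClass d).trans ?_)
    rw [← Finset.mul_sum, Finset.sum_add_distrib, sum_vonMangoldt_not_prime_eq]
    have := sum_Ioc_ite_eq_two_le hlog2 N
    linarith
  have := hdiff.add tendsto_sum_residueClass_one_div
  rw [zero_add] at this
  refine this.congr fun N => ?_
  rw [← add_div, ← Finset.sum_add_distrib]
  simp

lemma exists_tendsto_of_abs_deriv_right_le_div_sq {Φ Φ' : ℝ → ℝ} {a K : ℝ} (ha : 0 < a)
    (hK : 0 ≤ K) (hcont : ContinuousOn Φ (Set.Ici a))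
    (hderiv : ∀ u, a ≤ u → HasDerivWithinAt Φ (Φ' u) (Set.Ici u) u)
    (hbound : ∀ u, a ≤ u → |Φ' u| ≤ K / u ^ 2) : ∃ L, Tendsto Φ atTop (𝓝 L) := by
  have key : ∀ s t, a ≤ s → s ≤ t → |Φ t - Φ s| ≤ K / s := by
    intro s t has hst
    have hs0 : 0 < s := ha.trans_le has
    have h := image_norm_le_of_norm_deriv_right_le_deriv_boundary' (f := fun u => Φ u - Φ s)
      (f' := Φ') (a := s) (b := t) (B := fun u => K / s - K / u) (B' := fun u => K / u ^ 2)
      ((hcont.mono fun u hu => has.trans hu.1).sub continuousOn_const)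
      (fun u hu => (hderiv u (has.trans hu.1)).sub_const _) (by simp) (by
        refine continuousOn_const.sub (continuousOn_const.div continuousOn_id fun u hu => ?_)
        exact (hs0.trans_le hu.1).ne')
      (fun u hu => by
        have hu0 : u ≠ 0 := (hs0.trans_le hu.1).ne'
        have := ((hasDerivAt_inv hu0).const_mul K).const_sub (K / s)
        refine (this.congr_deriv ?_).hasDerivWithinAt.congr_of_eventuallyEq ?_ ?_
        · field_simp
        · exact Eventually.of_forall fun v => by simp [div_eq_mul_inv]
        · simp [div_eq_mul_inv])
      (fun u hu => hbound u (has.trans hu.1)) (x := t) ⟨hst, le_rfl⟩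
    have h2 : 0 ≤ K / t := div_nonneg hK (hs0.le.trans hst)
    rw [Real.norm_eq_abs] at h
    linarith
  refine cauchySeq_tendsto_of_complete (Metric.cauchySeq_iff'.2 fun ε hε => ?_)
  refine ⟨max a (K / ε + 1), fun t ht => ?_⟩
  rw [Real.dist_eq]
  have hs : 0 < max a (K / ε + 1) := ha.trans_le (le_max_left _ _)
  refine (key _ t (le_max_left _ _) ht).trans_lt ?_
  rw [div_lt_iff₀ hs]
  have : K / ε + 1 ≤ max a (K / ε + 1) := le_max_right _ _
  have h2 := mul_le_mul_of_nonneg_left this hε.le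
  rw [mul_add, mul_div_cancel₀ _ hε.ne'] at h2
  linarith

lemma sum_log_div_le {x : ℝ} (hx : 1 ≤ x) :
    ∑ n ∈ Finset.Ioc 0 ⌊x⌋₊, (Real.log x - Real.log n) ≤ x := by
  have hx0 : 0 < x := by linarith
  have hN : (1 : ℝ) ≤ ⌊x⌋₊ := by exact_mod_cast Nat.le_floor (a := x) (n := 1) (by simpa using hx)
  have hN0 : (0 : ℝ) < ⌊x⌋₊ := by linarith
  rw [Finset.sum_sub_distrib]
  have h1 := mul_log_sub_self_le_sum_log ⌊x⌋₊
  have h2 := Real.log_le_sub_one_of_pos (div_pos hx0 hN0)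
  rw [Real.log_div hx0.ne' hN0.ne'] at h2
  have h3 := mul_le_mul_of_nonneg_left h2 hN0.le
  rw [mul_sub, mul_sub, mul_div_cancel₀ _ hN0.ne'] at h3
  simp only [Finset.sum_const, Nat.card_Ioc, tsub_zero, nsmul_eq_mul]
  linarith

/-- The hypotheses of Wirsing's theorem with exponent one half: a bounded nonnegative function `b`
whose logarithmic derivative `w` has mean value `1 / 2` and satisfies a Mertens type estimate. -/
structure IsWirsingPair (b w : ℕ → ℝ) (K : ℝ) : Prop where
  nonneg : ∀ n, 0 ≤ b n
  le_one : ∀ n, b n ≤ 1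
  apply_one : b 1 = 1
  mul_log : ∀ n, 0 < n → b n * Real.log n = ∑ p ∈ n.divisorsAntidiagonal, b p.1 * w p.2
  abs_sum_div_sub_le : ∀ N : ℕ, 1 ≤ N →
    |∑ d ∈ Finset.Ioc 0 N, w d / d - 1 / 2 * Real.log N| ≤ K
  tendsto_sum_div : Tendsto (fun N : ℕ => (∑ d ∈ Finset.Ioc 0 N, w d) / N) atTop (𝓝 (1 / 2))

namespace IsWirsingPair

variable {b w : ℕ → ℝ} {K : ℝ}

lemma const_nonneg (h : IsWirsingPair b w K) : 0 ≤ K :=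
  (abs_nonneg _).trans (h.abs_sum_div_sub_le 1 le_rfl)

lemma abs_sum_floor_div_sub_le (h : IsWirsingPair b w K) {y : ℝ} (hy : 1 ≤ y) :
    |∑ d ∈ Finset.Ioc 0 ⌊y⌋₊, w d / d - 1 / 2 * Real.log y| ≤ K + 1 := by
  have hN : 1 ≤ ⌊y⌋₊ := Nat.le_floor (by simpa using hy)
  have hN' : (1 : ℝ) ≤ ⌊y⌋₊ := by exact_mod_cast hN
  have hN0 : (0 : ℝ) < ⌊y⌋₊ := by linarith
  have hy0 : 0 < y := by linarith
  have h1 := h.abs_sum_div_sub_le _ hN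
  have h2 := Real.log_le_sub_one_of_pos (div_pos hy0 hN0)
  have h3 : y / ⌊y⌋₊ ≤ 2 := by
    rw [div_le_iff₀ hN0]
    linarith [Nat.lt_floor_add_one y]
  rw [Real.log_div hy0.ne' hN0.ne'] at h2
  have h4 := Real.log_le_log hN0 (Nat.floor_le hy0.le)
  rw [abs_le] at *
  constructor <;> linarith

lemma abs_log_mul_sub_le (h : IsWirsingPair b w K) {x : ℝ} (hx : 0 < x) :
    |Real.log x * ∑ n ∈ Finset.Ioc 0 ⌊x⌋₊, b n / n -
      3 / 2 * ∑ n ∈ Finset.Ioc 0 ⌊x⌋₊, b n / n * (Real.log x - Real.log n)| ≤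
      (K + 1) * ∑ n ∈ Finset.Ioc 0 ⌊x⌋₊, b n / n := by
  have hlog : ∑ n ∈ Finset.Ioc 0 ⌊x⌋₊, b n / n * Real.log n =
      ∑ n ∈ Finset.Ioc 0 ⌊x⌋₊, b n / n * ∑ d ∈ Finset.Ioc 0 ⌊x / n⌋₊, w d / d := by
    simp only [Nat.floor_div_natCast]
    rw [← sum_Ioc_sum_divisorsAntidiagonal (fun n => b n / n) (fun d => w d / d)]
    refine Finset.sum_congr rfl fun n hn => ?_
    rw [div_mul_eq_mul_div, h.mul_log n (Finset.mem_Ioc.1 hn).1, Finset.sum_div]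
    refine Finset.sum_congr rfl fun p hp => ?_
    rw [← (Nat.mem_divisorsAntidiagonal.1 hp).1]
    push_cast
    ring
  have e : Real.log x * ∑ n ∈ Finset.Ioc 0 ⌊x⌋₊, b n / n -
      3 / 2 * ∑ n ∈ Finset.Ioc 0 ⌊x⌋₊, b n / n * (Real.log x - Real.log n) =
      ∑ n ∈ Finset.Ioc 0 ⌊x⌋₊, b n / n * (∑ d ∈ Finset.Ioc 0 ⌊x / n⌋₊, w d / d -
        1 / 2 * (Real.log x - Real.log n)) := by
    simp only [mul_sub, Finset.sum_sub_distrib]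
    rw [← hlog, Finset.mul_sum]
    simp only [Finset.mul_sum, ← Finset.sum_sub_distrib]
    exact Finset.sum_congr rfl fun n _ => by ring
  rw [e, Finset.mul_sum]
  refine (Finset.abs_sum_le_sum_abs _ _).trans (Finset.sum_le_sum fun n hn => ?_)
  have hn := Finset.mem_Ioc.1 hn
  have hn0 : (0 : ℝ) < n := by exact_mod_cast hn.1
  have hnx : (n : ℝ) ≤ x := (Nat.le_floor_iff hx.le).1 hn.2
  rw [abs_mul, abs_of_nonneg (div_nonneg (h.nonneg n) hn0.le), mul_comm,
    ← Real.log_div hx.ne' hn0.ne']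
  exact mul_le_mul_of_nonneg_right (h.abs_sum_floor_div_sub_le ((one_le_div hn0).2 hnx))
    (div_nonneg (h.nonneg n) hn0.le)

lemma exists_tendsto_sum_div (h : IsWirsingPair b w K) :
    ∃ C : ℝ, 0 < C ∧ Tendsto (fun x : ℝ =>
      (∑ n ∈ Finset.Ioc 0 ⌊x⌋₊, b n / n) / √(Real.log x)) atTop (𝓝 C) := by
  have hK := h.const_nonneg
  set m : ℝ → ℝ := fun u => ∑ n ∈ Finset.Ioc 0 ⌊Real.exp u⌋₊, b n / n with hm
  set T : ℝ → ℝ := fun u => ∑ n ∈ Finset.Ioc 0 ⌊Real.exp u⌋₊, b n / n * (u - Real.log n) with hT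
  have hmT : ∀ u, |u * m u - 3 / 2 * T u| ≤ (K + 1) * m u := by
    intro u
    have := h.abs_log_mul_sub_le (Real.exp_pos u)
    rwa [Real.log_exp] at this
  have hTmax : ∀ (N : ℕ) (u : ℝ), ⌊Real.exp u⌋₊ ≤ N →
      T u = ∑ n ∈ Finset.Ioc 0 N, b n / n * max 0 (u - Real.log n) := by
    intro N u hN
    calc T u = ∑ n ∈ Finset.Ioc 0 ⌊Real.exp u⌋₊, b n / n * max 0 (u - Real.log n) := by
          refine Finset.sum_congr rfl fun n hn => ?_
          have hn := Finset.mem_Ioc.1 hn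
          have h1 := Real.log_le_log (by exact_mod_cast hn.1)
            ((Nat.le_floor_iff (Real.exp_pos u).le).1 hn.2)
          rw [Real.log_exp] at h1
          rw [max_eq_right (by linarith)]
      _ = _ := by
          refine Finset.sum_subset (Finset.Ioc_subset_Ioc_right hN) fun n hn hn' => ?_
          have hn := Finset.mem_Ioc.1 hn
          have hlt : Real.exp u < n := by
            rw [← Nat.floor_lt (Real.exp_pos u).le]
            by_contra hcon
            exact hn' (Finset.mem_Ioc.2 ⟨hn.1, not_lt.1 hcon⟩)
          have := (Real.lt_log_iff_exp_lt (by exact_mod_cast hn.1)).2 hlt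
          rw [max_eq_left (by linarith), mul_zero]
  have hTcont : Continuous T := by
    refine continuous_iff_continuousAt.2 fun u => ?_
    have hc : Continuous fun v : ℝ => ∑ n ∈ Finset.Ioc 0 ⌊Real.exp (u + 1)⌋₊,
        b n / n * max 0 (v - Real.log n) := by fun_prop
    refine hc.continuousAt.congr ?_
    filter_upwards [Iio_mem_nhds (lt_add_one u)] with v hv
    exact (hTmax _ v (Nat.floor_mono (Real.exp_le_exp.2 (le_of_lt hv)))).symm
  have hTderiv : ∀ u, HasDerivWithinAt T (m u) (Set.Ici u) u := by
    intro u
    have h1 : HasDerivAt (fun v : ℝ => ∑ n ∈ Finset.Ioc 0 ⌊Real.exp u⌋₊,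
        b n / n * (v - Real.log n)) (∑ n ∈ Finset.Ioc 0 ⌊Real.exp u⌋₊, b n / n * 1) u :=
      HasDerivAt.fun_sum fun n _ => ((hasDerivAt_id u).sub_const _).const_mul _
    simp only [mul_one] at h1
    refine h1.hasDerivWithinAt.congr_of_eventuallyEq ?_ rfl
    have h2 : ∀ᶠ v in 𝓝 u, Real.exp v < ⌊Real.exp u⌋₊ + 1 :=
      Real.continuous_exp.continuousAt.eventually_lt_const (Nat.lt_floor_add_one _)
    filter_upwards [h2.filter_mono nhdsWithin_le_nhds, self_mem_nhdsWithin] with v hv huv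
    have hfl : ⌊Real.exp v⌋₊ = ⌊Real.exp u⌋₊ := by
      rw [Nat.floor_eq_iff (Real.exp_pos v).le]
      exact ⟨(Nat.floor_le (Real.exp_pos u).le).trans (Real.exp_le_exp.2 huv), hv⟩
    simp only [hT, hfl]
  have hone : ∀ u, 0 ≤ u → 1 ∈ Finset.Ioc 0 ⌊Real.exp u⌋₊ := fun u hu =>
    Finset.mem_Ioc.2 ⟨one_pos, Nat.le_floor (by simpa using hu)⟩
  have hTpos : ∀ u, 0 < u → 0 < T u := by
    intro u hu
    have : b 1 / (1 : ℕ) * max 0 (u - Real.log (1 : ℕ)) ≤ T u := by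
      rw [hTmax _ u le_rfl]
      exact Finset.single_le_sum
        (f := fun n : ℕ => b n / n * max 0 (u - Real.log n))
        (fun n _ => mul_nonneg (div_nonneg (h.nonneg n) n.cast_nonneg) (le_max_left _ _))
        (hone u hu.le)
    rw [h.apply_one] at this
    simp at this
    linarith [this.1, this.2]
  have hm0 : ∀ u, 0 ≤ m u := fun u =>
    Finset.sum_nonneg fun n _ => div_nonneg (h.nonneg n) n.cast_nonneg
  set a : ℝ := 2 * (K + 1) with ha
  have ha0 : 0 < a := by positivity
  have hmle : ∀ u, a ≤ u → u * m u ≤ 3 * T u := by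
    intro u hu
    have h1 := (abs_le.1 (hmT u)).2
    have h2 := mul_le_mul_of_nonneg_right hu (hm0 u)
    rw [ha] at h2
    linarith
  obtain ⟨L, hL⟩ := exists_tendsto_of_abs_deriv_right_le_div_sq
    (Φ := fun u => Real.log (T u) - 3 / 2 * Real.log u)
    (Φ' := fun u => m u / T u - 3 / 2 * u⁻¹) (K := 3 * (K + 1)) ha0 (by positivity)
    ((hTcont.continuousOn.log fun u hu => (hTpos u (ha0.trans_le hu)).ne').sub
      (continuousOn_const.mul (continuousOn_id.log fun u hu => (ha0.trans_le hu).ne')))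
    (fun u hu => ((hTderiv u).log (hTpos u (ha0.trans_le hu)).ne').sub
      (((Real.hasDerivAt_log (ha0.trans_le hu).ne').const_mul _).hasDerivWithinAt))
    (fun u hu => by
      have hu0 : 0 < u := ha0.trans_le hu
      have hT0 := hTpos u hu0
      have e : m u / T u - 3 / 2 * u⁻¹ = (u * m u - 3 / 2 * T u) / (u * T u) := by
        field_simp
      rw [e, abs_div, abs_of_pos (mul_pos hu0 hT0), div_le_div_iff₀ (by positivity) (by positivity)]
      have h1 := mul_le_mul_of_nonneg_right (hmT u) (sq_nonneg u)
      have h2 := mul_le_mul_of_nonneg_left (hmle u hu) (show 0 ≤ (K + 1) * u by positivity)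
      linarith)
  have hTlim : Tendsto (fun u => T u / (u * √u)) atTop (𝓝 (Real.exp L)) := by
    refine ((Real.continuous_exp.tendsto L).comp hL).congr' ?_
    filter_upwards [eventually_gt_atTop 0] with u hu
    have hs : 0 < √u := Real.sqrt_pos.2 hu
    simp only [Function.comp]
    rw [show Real.log (T u) - 3 / 2 * Real.log u = Real.log (T u / (u * √u)) by
      rw [Real.log_div (hTpos u hu).ne' (by positivity), Real.log_mul hu.ne' hs.ne',
        Real.log_sqrt hu.le]
      ring]
    exact Real.exp_log (div_pos (hTpos u hu) (by positivity))
  have herr : Tendsto (fun u => m u / √u - 3 / 2 * (T u / (u * √u))) atTop (𝓝 0) := by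
    have h0 : Tendsto (fun u : ℝ => 3 * (K + 1) * (u⁻¹ * (T u / (u * √u)))) atTop (𝓝 0) := by
      have := (tendsto_inv_atTop_zero.mul hTlim).const_mul (3 * (K + 1))
      simpa using this
    refine squeeze_zero_norm' ?_ h0
    filter_upwards [eventually_ge_atTop a] with u hu
    have hu0 : 0 < u := ha0.trans_le hu
    have hs : 0 < √u := Real.sqrt_pos.2 hu0
    have e : m u / √u - 3 / 2 * (T u / (u * √u)) = (u * m u - 3 / 2 * T u) / (u * √u) := by
      field_simp
    rw [e, norm_div, Real.norm_eq_abs, Real.norm_of_nonneg (by positivity : 0 ≤ u * √u)]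
    rw [show 3 * (K + 1) * (u⁻¹ * (T u / (u * √u))) = (K + 1) * (3 * T u / u) / (u * √u) by ring]
    refine div_le_div_of_nonneg_right ((hmT u).trans ?_) (by positivity)
    refine mul_le_mul_of_nonneg_left ?_ (by positivity)
    rw [le_div_iff₀ hu0, mul_comm]
    exact hmle u hu
  refine ⟨3 / 2 * Real.exp L, by positivity, ?_⟩
  have hlim := herr.add (hTlim.const_mul (3 / 2))
  rw [zero_add] at hlim
  refine (hlim.comp Real.tendsto_log_atTop).congr' ?_
  filter_upwards [eventually_gt_atTop 0] with x hx
  simp [hm, Real.exp_log hx]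

lemma abs_sum_floor_sub_le (h : IsWirsingPair b w K) {ε : ℝ} (hε : 0 < ε) :
    ∃ D : ℝ, 0 ≤ D ∧ ∀ y : ℝ, 0 ≤ y → |∑ d ∈ Finset.Ioc 0 ⌊y⌋₊, w d - y / 2| ≤ ε * y + D := by
  obtain ⟨N, hN⟩ := eventually_atTop.1
    ((Metric.tendsto_nhds.1 h.tendsto_sum_div ε hε).and (eventually_gt_atTop 0))
  set D := ∑ k ∈ Finset.range N, |∑ d ∈ Finset.Ioc 0 k, w d - k / 2| with hD
  have hD0 : 0 ≤ D := Finset.sum_nonneg fun _ _ => abs_nonneg _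
  have hnat : ∀ k : ℕ, |∑ d ∈ Finset.Ioc 0 k, w d - k / 2| ≤ ε * k + D := by
    intro k
    rcases lt_or_ge k N with hk | hk
    · have : |∑ d ∈ Finset.Ioc 0 k, w d - k / 2| ≤ D :=
        Finset.single_le_sum (f := fun k : ℕ => |∑ d ∈ Finset.Ioc 0 k, w d - k / 2|)
          (fun _ _ => abs_nonneg _) (Finset.mem_range.2 hk)
      have : 0 ≤ ε * k := by positivity
      linarith
    · obtain ⟨h1, h2⟩ := hN k hk
      have hk0 : (0 : ℝ) < k := by exact_mod_cast h2
      rw [Real.dist_eq] at h1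
      have e : ∑ d ∈ Finset.Ioc 0 k, w d - k / 2 = ((∑ d ∈ Finset.Ioc 0 k, w d) / k - 1 / 2) * k := by
        field_simp
      rw [e, abs_mul, abs_of_pos hk0]
      have := mul_le_mul_of_nonneg_right h1.le hk0.le
      linarith
  refine ⟨D + 1 / 2, by positivity, fun y hy => ?_⟩
  have h1 := hnat ⌊y⌋₊
  have h2 := Nat.floor_le hy
  have h3 := Nat.lt_floor_add_one y
  have h4 := mul_le_mul_of_nonneg_left h2 hε.le
  rw [abs_le] at *
  constructor <;> linarith

lemma abs_sum_mul_log_sub_le (h : IsWirsingPair b w K) {ε : ℝ} (hε : 0 < ε) :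
    ∃ D : ℝ, 0 ≤ D ∧ ∀ x : ℝ, 1 ≤ x →
      |(∑ n ∈ Finset.Ioc 0 ⌊x⌋₊, b n) * Real.log x -
        x / 2 * ∑ n ∈ Finset.Ioc 0 ⌊x⌋₊, b n / n| ≤
      ε * x * (∑ n ∈ Finset.Ioc 0 ⌊x⌋₊, b n / n) + D * x := by
  obtain ⟨D, hD0, hD⟩ := h.abs_sum_floor_sub_le hε
  refine ⟨D + 1, by positivity, fun x hx => ?_⟩
  have hx0 : 0 < x := by linarith
  have hmem : ∀ n ∈ Finset.Ioc 0 ⌊x⌋₊, (0 : ℝ) < n ∧ (n : ℝ) ≤ x := fun n hn =>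
    ⟨by exact_mod_cast (Finset.mem_Ioc.1 hn).1,
      (Nat.le_floor_iff hx0.le).1 (Finset.mem_Ioc.1 hn).2⟩
  have hlog : ∑ n ∈ Finset.Ioc 0 ⌊x⌋₊, b n * Real.log n =
      ∑ n ∈ Finset.Ioc 0 ⌊x⌋₊, b n * ∑ d ∈ Finset.Ioc 0 ⌊x / n⌋₊, w d := by
    simp only [Nat.floor_div_natCast]
    rw [← sum_Ioc_sum_divisorsAntidiagonal]
    exact Finset.sum_congr rfl fun n hn => h.mul_log n (Finset.mem_Ioc.1 hn).1
  have h1 : |∑ n ∈ Finset.Ioc 0 ⌊x⌋₊, b n * Real.log n -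
      x / 2 * ∑ n ∈ Finset.Ioc 0 ⌊x⌋₊, b n / n| ≤
      ε * x * (∑ n ∈ Finset.Ioc 0 ⌊x⌋₊, b n / n) + D * x := by
    have e : ∑ n ∈ Finset.Ioc 0 ⌊x⌋₊, b n * Real.log n -
        x / 2 * ∑ n ∈ Finset.Ioc 0 ⌊x⌋₊, b n / n =
        ∑ n ∈ Finset.Ioc 0 ⌊x⌋₊, b n * (∑ d ∈ Finset.Ioc 0 ⌊x / n⌋₊, w d - x / n / 2) := by
      rw [hlog, Finset.mul_sum, ← Finset.sum_sub_distrib]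
      exact Finset.sum_congr rfl fun n _ => by ring
    rw [e]
    calc _ ≤ ∑ n ∈ Finset.Ioc 0 ⌊x⌋₊, (ε * x * (b n / n) + D) := by
          refine (Finset.abs_sum_le_sum_abs _ _).trans (Finset.sum_le_sum fun n hn => ?_)
          rw [abs_mul, abs_of_nonneg (h.nonneg n)]
          have h2 := mul_le_mul_of_nonneg_left
            (hD (x / n) (div_nonneg hx0.le (hmem n hn).1.le)) (h.nonneg n)
          have h3 := mul_le_mul_of_nonneg_right (h.le_one n) hD0
          calc _ ≤ _ := h2
            _ = ε * x * (b n / n) + b n * D := by ring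
            _ ≤ _ := by linarith
      _ ≤ _ := by
          rw [Finset.sum_add_distrib, ← Finset.mul_sum]
          have h2 := mul_le_mul_of_nonneg_left (Nat.floor_le hx0.le) hD0
          simp only [Finset.sum_const, Nat.card_Ioc, tsub_zero, nsmul_eq_mul]
          linarith
  have h2 : |∑ n ∈ Finset.Ioc 0 ⌊x⌋₊, b n * (Real.log x - Real.log n)| ≤ x := by
    have hnn : ∀ n ∈ Finset.Ioc 0 ⌊x⌋₊, 0 ≤ Real.log x - Real.log n := fun n hn =>
      sub_nonneg.2 (Real.log_le_log (hmem n hn).1 (hmem n hn).2)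
    rw [abs_of_nonneg (Finset.sum_nonneg fun n hn => mul_nonneg (h.nonneg n) (hnn n hn))]
    exact (Finset.sum_le_sum fun n hn => mul_le_of_le_one_left (hnn n hn) (h.le_one n)).trans
      (sum_log_div_le hx)
  have e : (∑ n ∈ Finset.Ioc 0 ⌊x⌋₊, b n) * Real.log x =
      ∑ n ∈ Finset.Ioc 0 ⌊x⌋₊, b n * Real.log n +
        ∑ n ∈ Finset.Ioc 0 ⌊x⌋₊, b n * (Real.log x - Real.log n) := by
    rw [Finset.sum_mul, ← Finset.sum_add_distrib]
    exact Finset.sum_congr rfl fun n _ => by ring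
  rw [e]
  rw [abs_le] at *
  constructor <;> linarith

/-- **Wirsing's theorem** with exponent one half. -/
theorem exists_tendsto_sum (h : IsWirsingPair b w K) :
    ∃ C : ℝ, 0 < C ∧ Tendsto (fun x : ℝ =>
      (∑ n ∈ Finset.Ioc 0 ⌊x⌋₊, b n) * √(Real.log x) / x) atTop (𝓝 C) := by
  obtain ⟨C, hC0, hC⟩ := h.exists_tendsto_sum_div
  refine ⟨C / 2, by positivity, ?_⟩
  have hsqrt : Tendsto (fun x : ℝ => √(Real.log x)) atTop atTop :=
    Real.tendsto_sqrt_atTop.comp Real.tendsto_log_atTop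
  have hdiff : Tendsto (fun x : ℝ => (∑ n ∈ Finset.Ioc 0 ⌊x⌋₊, b n) * √(Real.log x) / x -
      (∑ n ∈ Finset.Ioc 0 ⌊x⌋₊, b n / n) / √(Real.log x) / 2) atTop (𝓝 0) := by
    rw [Metric.tendsto_nhds]
    intro ε hε
    obtain ⟨D, hD0, hD⟩ := h.abs_sum_mul_log_sub_le (ε := ε / (2 * (C + 1))) (by positivity)
    have hDlim : Tendsto (fun x : ℝ => D / √(Real.log x)) atTop (𝓝 0) := hsqrt.const_div_atTop D
    filter_upwards [hDlim.eventually_lt_const (half_pos hε), hC.eventually_lt_const (lt_add_one C),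
      eventually_gt_atTop 1] with x h1 h2 hx
    have hx0 : 0 < x := by linarith
    have hl : 0 < Real.log x := Real.log_pos hx
    have hs : 0 < √(Real.log x) := Real.sqrt_pos.2 hl
    have hss := Real.mul_self_sqrt hl.le
    have h3 := hD x hx.le
    set S := ∑ n ∈ Finset.Ioc 0 ⌊x⌋₊, b n
    set M := ∑ n ∈ Finset.Ioc 0 ⌊x⌋₊, b n / n
    set s := √(Real.log x)
    have e : S * s / x - M / s / 2 = (S * Real.log x - x / 2 * M) / (x * s) := by
      rw [← hss]
      field_simp
    rw [dist_zero_right, Real.norm_eq_abs, e, abs_div, abs_of_pos (mul_pos hx0 hs)]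
    calc _ ≤ (ε / (2 * (C + 1)) * x * M + D * x) / (x * s) := by gcongr
      _ = ε / (2 * (C + 1)) * (M / s) + D / s := by field_simp
      _ < ε / (2 * (C + 1)) * (C + 1) + ε / 2 := by gcongr
      _ = ε := by field_simp; ring
  have := hdiff.add (hC.div_const 2)
  rw [zero_add] at this
  refine this.congr fun x => ?_
  ring

end IsWirsingPair

/-- The natural numbers in whose factorization the primes congruent to three modulo four
have even exponents. -/
def HasEvenThreeModFour (n : ℕ) : Prop :=
  ∀ q : ℕ, q.Prime → q % 4 = 3 → Even (padicValNat q n)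

lemma exists_eq_sq_add_sq_iff_hasEvenThreeModFour {n : ℕ} :
    (∃ x y : ℕ, n = x ^ 2 + y ^ 2) ↔ HasEvenThreeModFour n := by
  rw [Nat.eq_sq_add_sq_iff]
  refine ⟨fun h q hq h3 => ?_, fun h q hq h3 => h q (Nat.prime_of_mem_primeFactors hq) h3⟩
  by_cases hmem : q ∈ n.primeFactors
  · exact h q hmem h3
  · have hz : padicValNat q n = 0 := by
      rw [← Nat.factorization_def n hq]
      exact Finsupp.notMem_support_iff.1 hmem
    rw [hz]
    exact Even.zero

lemma hasEvenThreeModFour_mul_iff {m d : ℕ} (hm : m ≠ 0) (hd : d ≠ 0)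
    (h : HasEvenThreeModFour d) : HasEvenThreeModFour (m * d) ↔ HasEvenThreeModFour m := by
  refine forall_congr' fun q => forall_congr' fun hq => forall_congr' fun h3 => ?_
  have : Fact q.Prime := ⟨hq⟩
  rw [padicValNat.mul hm hd, Nat.even_add]
  simp [h q hq h3]

open Classical in
/-- The indicator function of the positive sums of two squares. -/
noncomputable def twoSquaresIndicator (n : ℕ) : ℝ :=
  if 0 < n ∧ HasEvenThreeModFour n then 1 else 0

open Classical ArithmeticFunction in
/-- The coefficients of the logarithmic derivative of the Dirichlet series of
`twoSquaresIndicator`. -/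
noncomputable def twoSquaresMangoldt (d : ℕ) : ℝ :=
  if d.minFac % 4 = 3 then (if IsSquare d then 2 * vonMangoldt d else 0) else vonMangoldt d

open ArithmeticFunction in
lemma isHalfMangoldt_twoSquaresMangoldt : IsHalfMangoldt twoSquaresMangoldt where
  nonneg d := by
    have := vonMangoldt_nonneg (n := d)
    rw [twoSquaresMangoldt]
    split_ifs <;> linarith
  le d := by
    have := vonMangoldt_nonneg (n := d)
    rw [twoSquaresMangoldt]
    split_ifs <;> linarith
  eq_of_prime p hp h2 := by
    have hodd := hp.eq_two_or_odd
    rw [twoSquaresMangoldt, hp.minFac_eq, if_neg (fun hsq => hp.prime.not_isSquare hsq),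
      vonMangoldt_apply_prime hp]
    split_ifs <;> first | rfl | omega

lemma isSquare_prime_pow_iff {p k : ℕ} (hp : p.Prime) : IsSquare (p ^ k) ↔ Even k := by
  refine ⟨?_, fun hk => hk.isSquare_pow p⟩
  rintro ⟨r, hr⟩
  have hr0 : r ≠ 0 := by
    rintro rfl
    exact pow_ne_zero k hp.ne_zero (by simpa using hr)
  have : Fact p.Prime := ⟨hp⟩
  have h := congrArg (padicValNat p) hr
  rw [padicValNat.prime_pow, padicValNat.mul hr0 hr0] at h
  exact ⟨_, h⟩

open ArithmeticFunction in
lemma hasEvenThreeModFour_of_twoSquaresMangoldt_ne_zero {d : ℕ} (hd : twoSquaresMangoldt d ≠ 0) :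
    HasEvenThreeModFour d := by
  have hpp : IsPrimePow d := by
    rw [← vonMangoldt_ne_zero_iff]
    intro h0
    simp [twoSquaresMangoldt, h0] at hd
  obtain ⟨p, k, hp, hk, rfl⟩ := (isPrimePow_nat_iff _).1 hpp
  intro q hq h3
  have : Fact q.Prime := ⟨hq⟩
  by_cases hqp : q = p
  · subst hqp
    rw [twoSquaresMangoldt, hq.pow_minFac hk.ne', if_pos h3] at hd
    rw [padicValNat.prime_pow]
    by_contra hcon
    exact hd (if_neg (mt (isSquare_prime_pow_iff hq).1 hcon))
  · rw [padicValNat.pow, padicValNat_primes (hp := ⟨hq⟩) (hq := ⟨hp⟩) hqp]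
    simp

open Classical ArithmeticFunction in
lemma sum_twoSquaresMangoldt_eq_log {n : ℕ} (hn : n ≠ 0) (h : HasEvenThreeModFour n) :
    ∑ d ∈ n.divisors, twoSquaresMangoldt d = Real.log n := by
  rw [← vonMangoldt_sum, ← sub_eq_zero, ← Finset.sum_sub_distrib]
  have hval : ∀ p k : ℕ, p.Prime → k ≠ 0 → twoSquaresMangoldt (p ^ k) - vonMangoldt (p ^ k) =
      if p % 4 = 3 then (if Even k then Real.log p else -Real.log p) else 0 := by
    intro p k hp hk
    rw [twoSquaresMangoldt, hp.pow_minFac hk, vonMangoldt_apply_pow hk, vonMangoldt_apply_prime hp]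
    simp only [isSquare_prime_pow_iff hp]
    split_ifs <;> ring
  let g : ℕ → ℕ := fun d =>
    if IsPrimePow d ∧ d.minFac % 4 = 3 then
      (if IsSquare d then d / d.minFac else d * d.minFac) else d
  have hg : ∀ p k : ℕ, p.Prime → k ≠ 0 → p % 4 = 3 →
      g (p ^ k) = if Even k then p ^ (k - 1) else p ^ (k + 1) := by
    intro p k hp hk h3
    have hpp : IsPrimePow (p ^ k) := (isPrimePow_nat_iff _).2 ⟨p, k, hp, Nat.pos_of_ne_zero hk, rfl⟩
    have hdiv : p ^ k / p = p ^ (k - 1) := by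
      obtain ⟨j, rfl⟩ := Nat.exists_eq_succ_of_ne_zero hk
      rw [pow_succ, Nat.mul_div_cancel _ hp.pos, Nat.succ_sub_one]
    simp only [g, hp.pow_minFac hk, hpp, h3, and_self, if_true, isSquare_prime_pow_iff hp, hdiv,
      ← pow_succ]
  have hg' : ∀ d, ¬(IsPrimePow d ∧ d.minFac % 4 = 3) → g d = d := fun d hd => if_neg hd
  have hcases : ∀ d, ¬(IsPrimePow d ∧ d.minFac % 4 = 3) ∨
      ∃ p k, p.Prime ∧ k ≠ 0 ∧ p % 4 = 3 ∧ d = p ^ k := by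
    intro d
    by_cases hd : IsPrimePow d ∧ d.minFac % 4 = 3
    · obtain ⟨p, k, hp, hk, rfl⟩ := (isPrimePow_nat_iff _).1 hd.1
      rw [hp.pow_minFac hk.ne'] at hd
      exact Or.inr ⟨p, k, hp, hk.ne', hd.2, rfl⟩
    · exact Or.inl hd
  have hzero : ∀ d, ¬(IsPrimePow d ∧ d.minFac % 4 = 3) →
      twoSquaresMangoldt d - vonMangoldt d = 0 := by
    intro d hd
    by_cases hpp : IsPrimePow d
    · rw [twoSquaresMangoldt, if_neg (fun h3 => hd ⟨hpp, h3⟩), sub_self]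
    · rw [← vonMangoldt_eq_zero_iff] at hpp
      simp [twoSquaresMangoldt, hpp]
  have hodd : ∀ k : ℕ, Even k → k ≠ 0 → ¬Even (k - 1) := fun k hk h0 => by
    rw [Nat.not_even_iff_odd]
    exact Nat.Even.sub_odd (Nat.pos_of_ne_zero h0) hk odd_one
  refine Finset.sum_involution (fun d _ => g d) (fun d hd => ?_) (fun d hd hne => ?_)
    (fun d hd => ?_) (fun d hd => ?_)
  · rcases hcases d with hd' | ⟨p, k, hp, hk, h3, rfl⟩
    · rw [hg' d hd', hzero d hd', add_zero]
    · rw [hg p k hp hk h3]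
      by_cases he : Even k
      · have h1 := hodd k he hk
        rw [if_pos he, hval p k hp hk, hval p (k - 1) hp (fun h0 => h1 (h0 ▸ Even.zero)),
          if_pos h3, if_pos h3, if_pos he, if_neg h1, add_neg_cancel]
      · rw [if_neg he, hval p k hp hk, hval p (k + 1) hp k.succ_ne_zero, if_pos h3, if_pos h3,
          if_neg he, if_pos (Nat.even_add_one.2 he), neg_add_cancel]
  · rcases hcases d with hd' | ⟨p, k, hp, hk, h3, rfl⟩
    · exact absurd (hzero d hd') hne
    · rw [hg p k hp hk h3]
      intro heq
      split_ifs at heq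
      · have := Nat.pow_right_injective hp.two_le heq
        omega
      · have := Nat.pow_right_injective hp.two_le heq
        omega
  · rcases hcases d with hd' | ⟨p, k, hp, hk, h3, rfl⟩
    · rwa [hg' d hd']
    · have : Fact p.Prime := ⟨hp⟩
      have hdvd := (Nat.mem_divisors.1 hd).1
      rw [hg p k hp hk h3, Nat.mem_divisors]
      refine ⟨?_, hn⟩
      split_ifs with he
      · exact (pow_dvd_pow p (Nat.sub_le k 1)).trans hdvd
      · rw [padicValNat_dvd_iff_le hn] at hdvd ⊢
        refine Nat.succ_le_of_lt (lt_of_le_of_ne hdvd fun heq => he ?_)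
        rw [heq]
        exact h p hp h3
  · rcases hcases d with hd' | ⟨p, k, hp, hk, h3, rfl⟩
    · simp only [hg' d hd']
    · simp only [hg p k hp hk h3]
      by_cases he : Even k
      · have h1 := hodd k he hk
        rw [if_pos he, hg p (k - 1) hp (fun h0 => h1 (h0 ▸ Even.zero)) h3, if_neg h1,
          Nat.sub_add_cancel (Nat.pos_of_ne_zero hk)]
      · rw [if_neg he, hg p (k + 1) hp k.succ_ne_zero h3, if_pos (Nat.even_add_one.2 he),
          Nat.add_sub_cancel]

open Classical in
lemma exists_isWirsingPair_twoSquaresIndicator :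
    ∃ K, IsWirsingPair twoSquaresIndicator twoSquaresMangoldt K := by
  obtain ⟨K, -, hK⟩ := isHalfMangoldt_twoSquaresMangoldt.exists_abs_sum_div_sub_le
  refine ⟨K, fun n => ?_, fun n => ?_, ?_, fun n hn => ?_, hK,
    isHalfMangoldt_twoSquaresMangoldt.tendsto_sum_div⟩
  · rw [twoSquaresIndicator]
    split_ifs <;> norm_num
  · rw [twoSquaresIndicator]
    split_ifs <;> norm_num
  · exact if_pos ⟨one_pos, fun q _ _ => by simp⟩
  · have hterm : ∀ p ∈ n.divisorsAntidiagonal, twoSquaresIndicator p.1 * twoSquaresMangoldt p.2 =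
        twoSquaresIndicator n * twoSquaresMangoldt p.2 := by
      intro p hp
      rcases eq_or_ne (twoSquaresMangoldt p.2) 0 with h0 | h0
      · rw [h0, mul_zero, mul_zero]
      · obtain ⟨hm, hd⟩ := Nat.ne_zero_of_mem_divisorsAntidiagonal hp
        have := hasEvenThreeModFour_mul_iff hm hd
          (hasEvenThreeModFour_of_twoSquaresMangoldt_ne_zero h0)
        rw [(Nat.mem_divisorsAntidiagonal.1 hp).1] at this
        have hiff : (0 < p.1 ∧ HasEvenThreeModFour p.1) ↔ (0 < n ∧ HasEvenThreeModFour n) := by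
          simp only [this, hn, Nat.pos_of_ne_zero hm]
        rw [twoSquaresIndicator, twoSquaresIndicator]
        congr 1
        exact if_congr hiff rfl rfl
    rw [Finset.sum_congr rfl hterm, ← Finset.mul_sum,
      Nat.sum_divisorsAntidiagonal fun _ d => twoSquaresMangoldt d,
      Nat.sum_div_divisors n twoSquaresMangoldt]
    by_cases h : HasEvenThreeModFour n
    · rw [sum_twoSquaresMangoldt_eq_log hn.ne' h]
    · rw [twoSquaresIndicator, if_neg (fun h' => h h'.2), zero_mul, zero_mul]

lemma rTwoSquares_pos_iff {n : ℕ} : 0 < rTwoSquares n ↔ HasEvenThreeModFour n := by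
  have hfin : {p : ℤ × ℤ | p.1 ^ 2 + p.2 ^ 2 = (n : ℤ)}.Finite := by
    refine ((Set.finite_Icc (-(n : ℤ)) n).prod (Set.finite_Icc (-(n : ℤ)) n)).subset ?_
    rintro ⟨x, y⟩ hxy
    have hxy : x ^ 2 + y ^ 2 = n := hxy
    have hx := Int.le_self_sq x
    have hx' := Int.le_self_sq (-x)
    have hy := Int.le_self_sq y
    have hy' := Int.le_self_sq (-y)
    rw [neg_sq] at hx' hy'
    have := sq_nonneg x
    have := sq_nonneg y
    simp only [Set.mem_prod, Set.mem_Icc]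
    refine ⟨⟨?_, ?_⟩, ?_, ?_⟩ <;> linarith
  rw [rTwoSquares, Set.ncard_pos hfin, ← exists_eq_sq_add_sq_iff_hasEvenThreeModFour]
  constructor
  · rintro ⟨⟨x, y⟩, hxy⟩
    have hxy : x ^ 2 + y ^ 2 = n := hxy
    refine ⟨x.natAbs, y.natAbs, ?_⟩
    zify
    rw [sq_abs, sq_abs, hxy]
  · rintro ⟨x, y, hxy⟩
    exact ⟨(x, y), by simp [hxy]⟩

lemma ncard_eq_sum_twoSquaresIndicator {x : ℝ} (hx : 0 ≤ x) :
    ({n : ℕ | 1 ≤ n ∧ (n : ℝ) ≤ x ∧ 0 < rTwoSquares n}.ncard : ℝ) =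
      ∑ n ∈ Finset.Ioc 0 ⌊x⌋₊, twoSquaresIndicator n := by
  classical
  have hset : {n : ℕ | 1 ≤ n ∧ (n : ℝ) ≤ x ∧ 0 < rTwoSquares n} =
      ((Finset.Ioc 0 ⌊x⌋₊).filter fun n => 0 < n ∧ HasEvenThreeModFour n : Finset ℕ) := by
    ext n
    simp only [Set.mem_ofPred_eq, Finset.coe_filter, Finset.mem_Ioc, rTwoSquares_pos_iff,
      Nat.le_floor_iff hx, Nat.succ_le_iff]
    tauto
  rw [hset, Set.ncard_coe_finset, Finset.card_filter]
  push_cast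
  refine Finset.sum_congr rfl fun n _ => ?_
  rw [twoSquaresIndicator]

theorem landau_sums_of_two_squares :
    ∃ c : ℝ, 0 < c ∧
      Tendsto (fun x : ℝ =>
          ({n : ℕ | 1 ≤ n ∧ (n : ℝ) ≤ x ∧ 0 < rTwoSquares n}.ncard : ℝ) /
            (c * x / Real.sqrt (Real.log x)))
        atTop (nhds 1) := by
  obtain ⟨K, hK⟩ := exists_isWirsingPair_twoSquaresIndicator
  obtain ⟨C, hC0, hC⟩ := hK.exists_tendsto_sum
  refine ⟨C, hC0, ?_⟩
  have h := hC.div_const C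
  rw [div_self hC0.ne'] at h
  refine h.congr' ?_
  filter_upwards [eventually_ge_atTop 0] with x hx
  rw [ncard_eq_sum_twoSquaresIndicator hx, div_div_eq_mul_div, div_div, mul_comm x C]
end

section
/- There is an absolute constant c > 0 such that for every integer h ≠ 0 and every real x ≥ 2: Σ_{1 ≤ n ≤ x, n+h ∈ B} r(n)² ≤ c · (|h|/φ(|h|))² · x · (log x)^{1/2}, where the sum is over positive integers n ≤ x with n + h ∈ B. -/
open Real Filter
open scoped Classical

/-- `rTwoSquaresZ n` is the number of representations of the integer `n` as a sum of two
squares of integers. -/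
noncomputable def rTwoSquaresZ (n : ℤ) : ℕ :=
  {p : ℤ × ℤ | p.1 ^ 2 + p.2 ^ 2 = n}.ncard

/-- The set of nonnegative integers representable as a sum of two squares. -/
def sumTwoSquaresSet : Set ℤ := {n : ℤ | 0 ≤ n ∧ 0 < rTwoSquaresZ n}

theorem sum_range_zmod_cast (q : ℕ) [NeZero q] (f : ZMod q → ℝ) :
    ∑ n ∈ Finset.range q, f n = ∑ x, f x := by
  refine Finset.sum_bij' (fun n _ => (n : ZMod q)) (fun x _ => x.val) ?_ ?_ ?_ ?_ ?_
  · simp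
  · intro x _; simpa using ZMod.val_lt x
  · intro n hn; exact ZMod.val_cast_of_lt (by simpa using hn)
  · simp
  · simp

theorem abs_sum_range_zmod_sub_le (q : ℕ) [NeZero q] (f : ZMod q → ℝ) (hf : ∀ x, |f x| ≤ 1)
    (N : ℕ) :
    |∑ n ∈ Finset.range N, f n - N * ((∑ x, f x) / q)| ≤ 2 * q := by
  have hq : (0 : ℝ) < q := by exact_mod_cast Nat.pos_of_ne_zero (NeZero.ne q)
  induction N using Nat.strong_induction_on with
  | _ N ih =>
    rcases lt_or_ge N q with h | h
    · have h1 : |∑ n ∈ Finset.range N, f n| ≤ N := by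
        refine (Finset.abs_sum_le_sum_abs _ _).trans ?_
        refine (Finset.sum_le_sum fun (i : ℕ) _ => hf (i : ZMod q)).trans ?_
        simp
      have h2 : |(∑ x, f x) / q| ≤ 1 := by
        rw [abs_div, abs_of_pos hq, div_le_one hq]
        refine (Finset.abs_sum_le_sum_abs _ _).trans ?_
        refine (Finset.sum_le_sum fun i _ => hf i).trans ?_
        simp
      have h3 : |(N : ℝ) * ((∑ x, f x) / q)| ≤ N := by
        rw [abs_mul, Nat.abs_cast]
        exact mul_le_of_le_one_right (Nat.cast_nonneg _) h2
      have h4 : (N : ℝ) ≤ q := by exact_mod_cast h.le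
      have := abs_sub (∑ n ∈ Finset.range N, f n) ((N : ℝ) * ((∑ x, f x) / q))
      linarith
    · obtain ⟨m, rfl⟩ := Nat.exists_eq_add_of_le h
      have := ih m (by have := Nat.pos_of_ne_zero (NeZero.ne q); omega)
      rw [Finset.sum_range_add, sum_range_zmod_cast]
      convert this using 2
      simp only [Nat.cast_add, CharP.cast_eq_zero, zero_add]
      field_simp
      ring

theorem sum_zmod_prod_eq {ι : Type*} [Fintype ι] (q : ι → ℕ) [∀ i, NeZero (q i)]
    [NeZero (∏ i, q i)] (hq : Pairwise (Function.onFun Nat.Coprime q)) 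
    (f : (i : ι) → ZMod (q i) → ℝ) :
    ∑ x : ZMod (∏ i, q i), ∏ i, f i (x.cast) = ∏ i, ∑ x, f i x := by
  rw [Fintype.prod_sum]
  refine Fintype.sum_equiv (ZMod.prodEquivPi q hq).toEquiv _ _ fun x => ?_
  refine Finset.prod_congr rfl fun i _ => ?_
  congr 1
  exact (ZMod.prodEquivPi_apply q hq x i).symm

theorem abs_sum_range_prod_zmod_sub_le {ι : Type*} [Fintype ι] (q : ι → ℕ) [∀ i, NeZero (q i)]
    (hq : Pairwise (Function.onFun Nat.Coprime q)) (f : (i : ι) → ZMod (q i) → ℝ)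
    (hf : ∀ i x, |f i x| ≤ 1) (N : ℕ) :
    |∑ n ∈ Finset.range N, ∏ i, f i n - N * ∏ i, ((∑ x, f i x) / q i)| ≤
      2 * ∏ i, (q i : ℝ) := by
  have : NeZero (∏ i, q i) := ⟨Finset.prod_ne_zero_iff.2 fun i _ => NeZero.ne _⟩
  have h := abs_sum_range_zmod_sub_le (∏ i, q i) (fun x => ∏ i, f i x.cast) (fun x => by
    rw [Finset.abs_prod]
    exact Finset.prod_le_one (fun _ _ => abs_nonneg _) fun i _ => hf i _) N
  rw [sum_zmod_prod_eq q hq f] at h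
  rw [Finset.prod_div_distrib]
  push_cast at h
  have h2 : ∀ n : ℕ, ∏ i, f i n = ∏ i, f i ((n : ZMod (∏ i, q i)).cast) := fun n =>
    Finset.prod_congr rfl fun i _ => by
      rw [ZMod.cast_natCast (Finset.dvd_prod_of_mem q (Finset.mem_univ i))]
  simpa only [h2] using h

theorem abs_sum_range_sum_range_prod_zmod_sub_le {ι : Type*} [Fintype ι] (q : ι → ℕ)
    [∀ i, NeZero (q i)] (hq : Pairwise (Function.onFun Nat.Coprime q))
    (f : (i : ι) → ZMod (q i) → ZMod (q i) → ℝ) (hf : ∀ i x y, |f i x y| ≤ 1) (N : ℕ) :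
    |∑ u ∈ Finset.range N, ∑ v ∈ Finset.range N, ∏ i, f i u v -
        N ^ 2 * ∏ i, ((∑ x, ∑ y, f i x y) / (q i) ^ 2)| ≤ 4 * N * ∏ i, (q i : ℝ) := by
  have h1 : |∑ u ∈ Finset.range N, (∑ v ∈ Finset.range N, ∏ i, f i u v -
      N * ∏ i, ((∑ y, f i u y) / q i))| ≤ N * (2 * ∏ i, (q i : ℝ)) := by
    refine (Finset.abs_sum_le_sum_abs _ _).trans ?_
    refine (Finset.sum_le_sum fun u _ =>
      abs_sum_range_prod_zmod_sub_le q hq (fun i y => f i u y) (fun i y => hf i _ _) N).trans ?_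
    simp
  have h2 := abs_sum_range_prod_zmod_sub_le q hq (fun i x => (∑ y, f i x y) / q i)
    (fun i x => by
      have hqi : (0 : ℝ) < q i := by exact_mod_cast Nat.pos_of_ne_zero (NeZero.ne (q i))
      rw [abs_div, abs_of_pos hqi, div_le_one hqi]
      refine (Finset.abs_sum_le_sum_abs _ _).trans ?_
      refine (Finset.sum_le_sum fun y _ => hf i x y).trans ?_
      simp) N
  have h3 : ∀ i, (∑ x, ∑ y, f i x y) / (q i : ℝ) ^ 2 = (∑ x, (∑ y, f i x y) / q i) / q i := by
    intro i
    rw [← Finset.sum_div, div_div, sq]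
  simp_rw [h3]
  rw [Finset.sum_sub_distrib, ← Finset.mul_sum] at h1
  rw [abs_le] at *
  have hN : (0 : ℝ) ≤ N := Nat.cast_nonneg N
  constructor <;> nlinarith [mul_le_mul_of_nonneg_left h2.1 hN, mul_le_mul_of_nonneg_left h2.2 hN]

theorem isUnit_zmod_sq_iff {p : ℕ} [hp : Fact p.Prime] (x : ZMod (p ^ 2)) :
    IsUnit x ↔ ZMod.castHom (dvd_pow_self p two_ne_zero) (ZMod p) x ≠ 0 := by
  obtain ⟨n, rfl⟩ := ZMod.natCast_zmod_surjective x
  rw [ZMod.isUnit_iff_coprime, map_natCast, Ne, ZMod.natCast_eq_zero_iff,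
    Nat.coprime_pow_right_iff two_pos, Nat.coprime_comm, hp.out.coprime_iff_not_dvd]

theorem card_isUnit_zmod (q : ℕ) [NeZero q] :
    (Finset.univ.filter fun x : ZMod q => IsUnit x).card = q.totient := by
  rw [← ZMod.card_units_eq_totient, ← Finset.card_univ]
  symm
  refine Finset.card_nbij (fun u => (u : ZMod q)) ?_ ?_ ?_
  · intro u _; simp
  · intro u _ v _ h; exact Units.ext h
  · intro x hx
    obtain ⟨u, rfl⟩ := (Finset.mem_filter.1 hx).2
    exact ⟨u, by simp, rfl⟩

theorem exists_sq_add_sq_eq_of_isUnit {p : ℕ} [hp : Fact p.Prime] (hp2 : p ≠ 2)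
    {c : ZMod (p ^ 2)} (hc : IsUnit c) : ∃ s t, s ^ 2 + t ^ 2 = c := by
  obtain ⟨n, rfl⟩ := ZMod.natCast_zmod_surjective c
  rw [ZMod.isUnit_iff_coprime] at hc
  have hcop : Nat.Coprime 4 (p ^ 2) := by
    have : Nat.Coprime 2 p := (Nat.coprime_primes Nat.prime_two hp.out).2 (Ne.symm hp2)
    exact Nat.Coprime.pow 2 2 this
  obtain ⟨k, hk4, hkn⟩ := Nat.chineseRemainder hcop 1 n
  have hk : IsUnit (k : ZMod (4 * p ^ 2)) := by
    rw [ZMod.isUnit_iff_coprime]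
    refine Nat.Coprime.mul_right ?_ ?_
    · rw [Nat.Coprime, hk4.gcd_eq]; simp
    · rw [Nat.Coprime, hkn.gcd_eq]; exact hc
  have : NeZero (4 * p ^ 2) := ⟨by have := hp.out.ne_zero; positivity⟩
  obtain ⟨P, -, hP, hPk⟩ := Nat.forall_exists_prime_gt_and_eq_mod hk 0
  rw [ZMod.natCast_eq_natCast_iff] at hPk
  have h1 : P % 4 = 1 := (hPk.of_mul_right _).trans hk4
  have h2 : (P : ZMod (p ^ 2)) = n :=
    (ZMod.natCast_eq_natCast_iff _ _ _).2 ((hPk.of_mul_left _).trans hkn)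
  have : Fact P.Prime := ⟨hP⟩
  obtain ⟨s, t, hst⟩ := Nat.Prime.sq_add_sq (p := P) (by omega)
  exact ⟨s, t, by rw [← h2, ← hst]; push_cast; ring⟩

theorem card_sq_add_sq_eq_of_unit {R : Type*} [CommRing R] [Fintype R] {s t : R}
    (hc : IsUnit (s ^ 2 + t ^ 2)) :
    (Finset.univ.filter fun z : R × R => z.1 ^ 2 + z.2 ^ 2 = s ^ 2 + t ^ 2).card =
      (Finset.univ.filter fun z : R × R => z.1 ^ 2 + z.2 ^ 2 = 1).card := by
  obtain ⟨w, hw⟩ := hc.exists_right_inv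
  symm
  refine Finset.card_nbij' (fun z => (s * z.1 - t * z.2, s * z.2 + t * z.1))
    (fun z => (w * (s * z.1 + t * z.2), w * (s * z.2 - t * z.1))) ?_ ?_ ?_ ?_
  · intro z hz
    simp only [Finset.coe_filter, Finset.mem_univ, true_and, Set.mem_ofPred_eq] at hz ⊢
    linear_combination (s ^ 2 + t ^ 2) * hz
  · intro z hz
    simp only [Finset.coe_filter, Finset.mem_univ, true_and, Set.mem_ofPred_eq] at hz ⊢
    linear_combination w ^ 2 * (s ^ 2 + t ^ 2) * hz + (w * (s ^ 2 + t ^ 2) + 1) * hw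
  · intro z _
    ext
    · simp only; linear_combination z.1 * hw
    · simp only; linear_combination z.2 * hw
  · intro z _
    ext
    · simp only; linear_combination z.1 * hw
    · simp only; linear_combination z.2 * hw

theorem isUnit_sq_add_sq_iff {p : ℕ} [hp : Fact p.Prime] (hp3 : p % 4 = 3) (u v : ZMod (p ^ 2)) :
    IsUnit (u ^ 2 + v ^ 2) ↔ IsUnit u ∨ IsUnit v := by
  simp only [isUnit_zmod_sq_iff, map_add, map_pow]
  generalize ZMod.castHom (dvd_pow_self p two_ne_zero) (ZMod p) u = x
  generalize ZMod.castHom (dvd_pow_self p two_ne_zero) (ZMod p) v = y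
  constructor
  · intro h
    by_contra! h2
    simp [h2.1, h2.2] at h
  · intro h h2
    have key : ∀ x y : ZMod p, x ^ 2 + y ^ 2 = 0 → x = 0 := by
      intro x y h
      by_contra hx
      exact ZMod.mod_four_ne_three_of_sq_eq_neg_sq' hx (x := y)
        (by linear_combination h) hp3
    rcases h with h | h
    · exact h (key x y h2)
    · exact h (key y x (by linear_combination h2))

theorem card_sq_add_sq_eq {p : ℕ} [hp : Fact p.Prime] (hp3 : p % 4 = 3) {c : ZMod (p ^ 2)}
    (hc : IsUnit c) :
    (Finset.univ.filter fun z : ZMod (p ^ 2) × ZMod (p ^ 2) => z.1 ^ 2 + z.2 ^ 2 = c).card =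
      p * (p + 1) := by
  set K := (Finset.univ.filter fun z : ZMod (p ^ 2) × ZMod (p ^ 2) =>
    z.1 ^ 2 + z.2 ^ 2 = 1).card with hK
  have hfib : ∀ c : ZMod (p ^ 2), IsUnit c → (Finset.univ.filter
      fun z : ZMod (p ^ 2) × ZMod (p ^ 2) => z.1 ^ 2 + z.2 ^ 2 = c).card = K := by
    intro c hc
    obtain ⟨s, t, rfl⟩ := exists_sq_add_sq_eq_of_isUnit (by rintro rfl; norm_num at hp3) hc
    rw [hK]
    convert card_sq_add_sq_eq_of_unit hc
  rw [hfib c hc]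
  have hp1 : 1 ≤ p := hp.out.one_lt.le
  have h1 : (Finset.univ.filter fun z : ZMod (p ^ 2) × ZMod (p ^ 2) =>
      IsUnit (z.1 ^ 2 + z.2 ^ 2)).card = p * (p - 1) * K := by
    rw [Finset.card_eq_sum_card_fiberwise (f := fun z => z.1 ^ 2 + z.2 ^ 2)
      (t := Finset.univ.filter fun x : ZMod (p ^ 2) => IsUnit x)]
    · rw [Finset.sum_congr rfl (g := fun _ => K)]
      · rw [Finset.sum_const, card_isUnit_zmod, Nat.totient_prime_pow hp.out two_pos]
        simp
      · intro c hc
        rw [← hfib c (Finset.mem_filter.1 hc).2, Finset.filter_filter]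
        congr 1
        refine Finset.filter_congr fun z _ => ?_
        refine ⟨fun h => h.2, fun h => ⟨h ▸ (Finset.mem_filter.1 hc).2, h⟩⟩
    · intro z hz
      simpa using hz
  have h2 : (Finset.univ.filter fun z : ZMod (p ^ 2) × ZMod (p ^ 2) =>
      ¬ IsUnit (z.1 ^ 2 + z.2 ^ 2)).card = p * p := by
    have h3 : (Finset.univ.filter fun x : ZMod (p ^ 2) => ¬ IsUnit x).card = p := by
      have h4 := Finset.card_filter_add_card_filter_not (s := (Finset.univ : Finset (ZMod (p ^ 2))))
        (fun x => IsUnit x)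
      rw [card_isUnit_zmod, Nat.totient_prime_pow hp.out two_pos, Finset.card_univ, ZMod.card] at h4
      obtain ⟨k, rfl⟩ := Nat.exists_eq_add_of_le hp1
      simp only [Nat.add_sub_cancel_left] at h4
      simp at h4 ⊢
      nlinarith
    refine Eq.trans ?_ (congrArg₂ (· * ·) h3 h3)
    rw [← Finset.card_product]
    congr 1
    ext z
    simp [isUnit_sq_add_sq_iff hp3]
  have h4 := Finset.card_filter_add_card_filter_not
    (s := (Finset.univ : Finset (ZMod (p ^ 2) × ZMod (p ^ 2))))
    (fun z => IsUnit (z.1 ^ 2 + z.2 ^ 2))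
  rw [h1, h2, Finset.card_univ, Fintype.card_prod, ZMod.card] at h4
  have hp2 : 2 ≤ p := hp.out.two_le
  obtain ⟨k, rfl⟩ := Nat.exists_eq_add_of_le hp2
  have e : 2 + k - 1 = k + 1 := by omega
  rw [e] at h4
  have : (2 + k) * (k + 1) * K = (2 + k) * (k + 1) * ((2 + k) * (2 + k + 1)) := by nlinarith
  exact Nat.eq_of_mul_eq_mul_left (by positivity) this

theorem card_nonunit_ne_zero {p : ℕ} [hp : Fact p.Prime] (hp3 : p % 4 = 3) {a h : ZMod (p ^ 2)}
    (ha : IsUnit a) (hh : IsUnit h) :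
    (Finset.univ.filter fun z : ZMod (p ^ 2) × ZMod (p ^ 2) =>
      ¬ IsUnit (a * (z.1 ^ 2 + z.2 ^ 2) + h) ∧ a * (z.1 ^ 2 + z.2 ^ 2) + h ≠ 0).card =
      (p - 1) * (p * (p + 1)) := by
  have hp1 : 1 ≤ p := hp.out.one_lt.le
  rw [Finset.card_eq_sum_card_fiberwise (f := fun z => a * (z.1 ^ 2 + z.2 ^ 2) + h)
      (t := Finset.univ.filter fun x : ZMod (p ^ 2) => ¬ IsUnit x ∧ x ≠ 0)]
  · rw [Finset.sum_congr rfl (g := fun _ => p * (p + 1))]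
    · rw [Finset.sum_const, smul_eq_mul]
      congr 1
      have h4 := Finset.card_filter_add_card_filter_not (s := (Finset.univ : Finset (ZMod (p ^ 2))))
        (fun x => IsUnit x)
      rw [card_isUnit_zmod, Nat.totient_prime_pow hp.out two_pos, Finset.card_univ, ZMod.card] at h4
      have h5 : (Finset.univ.filter fun x : ZMod (p ^ 2) => ¬ IsUnit x ∧ x ≠ 0) =
          (Finset.univ.filter fun x : ZMod (p ^ 2) => ¬ IsUnit x).erase 0 := by
        ext x; simp [and_comm]
      have : Fact (1 < p ^ 2) := ⟨Nat.one_lt_pow two_ne_zero hp.out.one_lt⟩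
      rw [h5, Finset.card_erase_of_mem (by simp)]
      obtain ⟨k, rfl⟩ := Nat.exists_eq_add_of_le hp1
      simp only [Nat.add_sub_cancel_left] at h4 ⊢
      simp at h4 ⊢
      have : ∀ m : ℕ, (1 + k) * k + m = (1 + k) ^ 2 → m - 1 = k := by
        intro m hm
        have : m = k + 1 := by nlinarith
        omega
      exact this _ h4
    · intro x hx
      have hx := (Finset.mem_filter.1 hx).2
      obtain ⟨b, hb⟩ := ha.exists_right_inv
      have hu : IsUnit (b * (x - h)) := by
        have h1 := hx.1
        rw [isUnit_zmod_sq_iff] at h1 hh ⊢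
        rw [isUnit_zmod_sq_iff] at ha
        simp only [ne_eq, not_not] at h1
        have h2 := congrArg (ZMod.castHom (dvd_pow_self p two_ne_zero) (ZMod p)) hb
        rw [map_mul, map_one] at h2
        rw [map_mul, map_sub, h1, zero_sub]
        exact mul_ne_zero (right_ne_zero_of_mul_eq_one h2) (neg_ne_zero.2 hh)
      rw [← card_sq_add_sq_eq hp3 hu, Finset.filter_filter]
      congr 1
      refine Finset.filter_congr fun z _ => ?_
      constructor
      · rintro ⟨-, h1⟩
        linear_combination b * h1 - (z.1 ^ 2 + z.2 ^ 2) * hb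
      · intro h1
        have h2 : a * (z.1 ^ 2 + z.2 ^ 2) + h = x := by
          linear_combination a * h1 + (x - h) * hb
        rw [h2]
        exact ⟨hx, rfl⟩
  · intro z hz
    simpa using hz

/-- The ratio `g / (1 - g)`, where `g = (p ^ 2 - 1) / p ^ 3` is the density of pairs `(u, v)` for
which `p` divides `a * (u ^ 2 + v ^ 2) + h` exactly once. -/
noncomputable def sieveRatio (p : ℕ) : ℝ := ((p : ℝ) ^ 2 - 1) / ((p : ℝ) ^ 3 - (p : ℝ) ^ 2 + 1)

theorem sieveRatio_bounds {p : ℕ} (hp : 2 ≤ p) :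
    0 < (p : ℝ) ^ 3 - (p : ℝ) ^ 2 + 1 ∧ 1 / (p : ℝ) ≤ sieveRatio p ∧ 0 ≤ sieveRatio p ∧
      sieveRatio p ≤ 1 := by
  have h2 : (2 : ℝ) ≤ p := by exact_mod_cast hp
  have hpos : 0 < (p : ℝ) ^ 3 - (p : ℝ) ^ 2 + 1 := by nlinarith [sq_nonneg (p : ℝ)]
  refine ⟨hpos, ?_, ?_, ?_⟩
  · rw [sieveRatio, div_le_div_iff₀ (by linarith) hpos]
    nlinarith
  · exact div_nonneg (by nlinarith) hpos.le
  · rw [sieveRatio, div_le_one hpos]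
    nlinarith [sq_nonneg (p : ℝ)]

theorem sieveRatio_mul {p : ℕ} (hp : 2 ≤ p) :
    sieveRatio p * ((p : ℝ) ^ 3 - (p : ℝ) ^ 2 + 1) = (p : ℝ) ^ 2 - 1 :=
  div_mul_cancel₀ _ (sieveRatio_bounds hp).1.ne'

/-- For a prime `p`, the condition that `p` divides `a * (u ^ 2 + v ^ 2) + h` exactly once. -/
def SieveCond (a h : ℤ) (p : ℕ) (u v : ZMod (p ^ 2)) : Prop :=
  ¬ IsUnit ((a : ZMod (p ^ 2)) * (u ^ 2 + v ^ 2) + (h : ZMod (p ^ 2))) ∧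
    (a : ZMod (p ^ 2)) * (u ^ 2 + v ^ 2) + (h : ZMod (p ^ 2)) ≠ 0

/-- A function on pairs of residues modulo `p ^ 2` with mean zero which is constant on the pairs for
which `p` does not divide `a * (u ^ 2 + v ^ 2) + h` exactly once. -/
noncomputable def sieveFn (a h : ℤ) (p : ℕ) (u v : ZMod (p ^ 2)) : ℝ :=
  if SieveCond a h p u v then -1 else sieveRatio p

theorem abs_sieveFn_le_one {p : ℕ} (hp : 2 ≤ p) (a h : ℤ) (u v : ZMod (p ^ 2)) :
    |sieveFn a h p u v| ≤ 1 := by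
  obtain ⟨-, -, h0, h1⟩ := sieveRatio_bounds hp
  rw [sieveFn]
  split_ifs
  · simp
  · rwa [abs_of_nonneg h0]

theorem isUnit_intCast_zmod_sq {p : ℕ} [hp : Fact p.Prime] {a : ℤ} (ha : ¬ (p : ℤ) ∣ a) :
    IsUnit (a : ZMod (p ^ 2)) := by
  rw [isUnit_zmod_sq_iff, map_intCast]
  rwa [Ne, ZMod.intCast_zmod_eq_zero_iff_dvd]

theorem sum_sum_ite_sieve {p : ℕ} [hp : Fact p.Prime] (hp3 : p % 4 = 3) {a h : ℤ}
    (ha : ¬ (p : ℤ) ∣ a) (hh : ¬ (p : ℤ) ∣ h) (A B : ℝ) :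
    ∑ u : ZMod (p ^ 2), ∑ v : ZMod (p ^ 2),
      (if SieveCond a h p u v then A else B) =
      ((p : ℝ) - 1) * (p * (p + 1)) * A + ((p : ℝ) ^ 4 - ((p : ℝ) - 1) * (p * (p + 1))) * B := by
  have hc := card_nonunit_ne_zero hp3 (isUnit_intCast_zmod_sq ha) (isUnit_intCast_zmod_sq hh)
  have hc' : ((Finset.univ.filter fun z : ZMod (p ^ 2) × ZMod (p ^ 2) =>
      SieveCond a h p z.1 z.2).card : ℝ) =
      ((p : ℝ) - 1) * (p * (p + 1)) := by
    have : (Finset.univ.filter fun z : ZMod (p ^ 2) × ZMod (p ^ 2) =>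
        SieveCond a h p z.1 z.2).card = (p - 1) * (p * (p + 1)) := by
      rw [← hc]
      simp only [SieveCond]
      congr
    rw [this]
    push_cast [Nat.cast_sub hp.out.one_lt.le]
    ring
  rw [← Fintype.sum_prod_type', Finset.sum_ite, Finset.sum_const, Finset.sum_const, nsmul_eq_mul,
    nsmul_eq_mul, hc']
  congr 2
  have h4 := Finset.card_filter_add_card_filter_not
    (s := (Finset.univ : Finset (ZMod (p ^ 2) × ZMod (p ^ 2))))
    (fun z => SieveCond a h p z.1 z.2)
  rw [Finset.card_univ, Fintype.card_prod, ZMod.card] at h4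
  have h5 := congrArg (Nat.cast (R := ℝ)) h4
  push_cast at h5
  rw [hc'] at h5
  linear_combination h5

theorem sum_sum_sieveFn {p : ℕ} [hp : Fact p.Prime] (hp3 : p % 4 = 3) {a h : ℤ}
    (ha : ¬ (p : ℤ) ∣ a) (hh : ¬ (p : ℤ) ∣ h) :
    ∑ u : ZMod (p ^ 2), ∑ v : ZMod (p ^ 2), sieveFn a h p u v = 0 := by
  have hH := sieveRatio_mul hp.out.two_le
  simp only [sieveFn]
  rw [sum_sum_ite_sieve hp3 ha hh]
  linear_combination (p : ℝ) * hH

theorem sum_sum_sieveFn_sq {p : ℕ} [hp : Fact p.Prime] (hp3 : p % 4 = 3) {a h : ℤ}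
    (ha : ¬ (p : ℤ) ∣ a) (hh : ¬ (p : ℤ) ∣ h) :
    ∑ u : ZMod (p ^ 2), ∑ v : ZMod (p ^ 2), sieveFn a h p u v * sieveFn a h p u v =
      p ^ 4 * sieveRatio p := by
  have hH := sieveRatio_mul hp.out.two_le
  simp only [sieveFn, ite_mul_ite]
  rw [sum_sum_ite_sieve hp3 ha hh]
  linear_combination ((p : ℝ) * sieveRatio p - p) * hH

theorem prod_union_le {S T : Finset ℕ} {f : ℕ → ℝ} (hf : ∀ p ∈ S ∪ T, 1 ≤ f p) :
    ∏ p ∈ S ∪ T, f p ≤ (∏ p ∈ S, f p) * ∏ p ∈ T, f p := by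
  rw [← Finset.prod_union_inter]
  refine le_mul_of_one_le_right (Finset.prod_nonneg fun p hp => by linarith [hf p hp]) ?_
  exact Finset.one_le_prod fun p hp => hf p (Finset.mem_union_left _ (Finset.mem_inter.1 hp).1)

theorem abs_sum_sum_sieveFn_mul_sub_le {a h : ℤ} {S T : Finset ℕ}
    (hS : ∀ p ∈ S ∪ T, p.Prime ∧ p % 4 = 3 ∧ ¬ (p : ℤ) ∣ a ∧ ¬ (p : ℤ) ∣ h) (N : ℕ) :
    |∑ u ∈ Finset.range N, ∑ v ∈ Finset.range N,
        (∏ p ∈ S, sieveFn a h p u v) * ∏ p ∈ T, sieveFn a h p u v -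
      N ^ 2 * (if S = T then ∏ p ∈ S, sieveRatio p else 0)| ≤
      4 * N * ((∏ p ∈ S, (p : ℝ)) * ∏ p ∈ T, (p : ℝ)) ^ 2 := by
  have hne : ∀ i : ↥(S ∪ T), NeZero ((i : ℕ) ^ 2) :=
    fun i => ⟨pow_ne_zero 2 (hS i i.2).1.ne_zero⟩
  have hcop : Pairwise (Function.onFun Nat.Coprime fun i : ↥(S ∪ T) => (i : ℕ) ^ 2) := by
    intro i j hij
    refine Nat.Coprime.pow 2 2 ((Nat.coprime_primes (hS i i.2).1 (hS j j.2).1).2 ?_)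
    exact fun h => hij (Subtype.ext h)
  have hle : ∀ (i : ↥(S ∪ T)) (U : Finset ℕ) (x y),
      |if (i : ℕ) ∈ U then sieveFn a h i x y else 1| ≤ 1 := by
    intro i U x y
    split_ifs
    · exact abs_sieveFn_le_one (hS i i.2).1.two_le a h x y
    · simp
  have key := abs_sum_range_sum_range_prod_zmod_sub_le (fun i : ↥(S ∪ T) => (i : ℕ) ^ 2) hcop
    (fun i x y => (if (i : ℕ) ∈ S then sieveFn a h i x y else 1) *
      (if (i : ℕ) ∈ T then sieveFn a h i x y else 1))
    (fun i x y => by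
      rw [abs_mul]
      exact mul_le_one₀ (hle i S x y) (abs_nonneg _) (hle i T x y)) N
  have e1 : ∀ u v : ℕ, ∏ i : ↥(S ∪ T), ((if (i : ℕ) ∈ S then sieveFn a h i u v else 1) *
      (if (i : ℕ) ∈ T then sieveFn a h i u v else 1)) =
      (∏ p ∈ S, sieveFn a h p u v) * ∏ p ∈ T, sieveFn a h p u v := by
    intro u v
    rw [Finset.prod_mul_distrib, Finset.prod_coe_sort (S ∪ T)
      (fun p => if p ∈ S then sieveFn a h p u v else 1), Finset.prod_coe_sort (S ∪ T)
      (fun p => if p ∈ T then sieveFn a h p u v else 1), Finset.prod_ite_mem, Finset.prod_ite_mem,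
      Finset.union_inter_cancel_left, Finset.union_inter_cancel_right]
  have e2 : ∏ i : ↥(S ∪ T), ((∑ x : ZMod ((i : ℕ) ^ 2), ∑ y : ZMod ((i : ℕ) ^ 2),
      (if (i : ℕ) ∈ S then sieveFn a h i x y else 1) *
      (if (i : ℕ) ∈ T then sieveFn a h i x y else 1)) / (((i : ℕ) ^ 2 : ℕ) : ℝ) ^ 2) =
      if S = T then ∏ p ∈ S, sieveRatio p else 0 := by
    split_ifs with hST
    · subst hST
      have : ∏ p ∈ S, sieveRatio p = ∏ i : ↥(S ∪ S), sieveRatio i := by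
        rw [Finset.prod_coe_sort, Finset.union_self]
      rw [this]
      refine Finset.prod_congr rfl fun i _ => ?_
      have hi : (i : ℕ) ∈ S := by simpa using i.2
      obtain ⟨hp, hp3, ha, hh⟩ := hS i i.2
      have : Fact (i : ℕ).Prime := ⟨hp⟩
      have h0 : ((i : ℕ) : ℝ) ≠ 0 := by exact_mod_cast hp.ne_zero
      simp only [hi, if_true]
      rw [sum_sum_sieveFn_sq hp3 ha hh]
      push_cast
      field_simp
    · have : ∃ p ∈ S ∪ T, ¬ (p ∈ S ↔ p ∈ T) := by
        by_contra! hcon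
        refine hST (Finset.ext fun p => ?_)
        by_cases hp : p ∈ S ∪ T
        · exact hcon p hp
        · simp only [Finset.mem_union, not_or] at hp
          simp [hp.1, hp.2]
      obtain ⟨p, hp, hne⟩ := this
      refine Finset.prod_eq_zero (Finset.mem_univ ⟨p, hp⟩) ?_
      obtain ⟨hpp, hp3, ha, hh⟩ := hS p hp
      have : Fact p.Prime := ⟨hpp⟩
      have h0 := sum_sum_sieveFn hp3 ha hh
      by_cases h1 : p ∈ S <;> by_cases h2 : p ∈ T <;> simp [h1, h2] at hne ⊢ <;> left <;> exact h0
  rw [e2] at key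
  simp only [e1] at key
  refine key.trans ?_
  refine mul_le_mul_of_nonneg_left ?_ (by positivity)
  have e3 : ∏ i : ↥(S ∪ T), (((i : ℕ) ^ 2 : ℕ) : ℝ) = (∏ p ∈ S ∪ T, (p : ℝ)) ^ 2 := by
    rw [Finset.prod_coe_sort (S ∪ T) (fun p => ((p ^ 2 : ℕ) : ℝ)), ← Finset.prod_pow]
    simp
  rw [e3]
  refine pow_le_pow_left₀ (Finset.prod_nonneg fun _ _ => Nat.cast_nonneg _) ?_ 2
  exact prod_union_le fun p hp => by exact_mod_cast (hS p hp).1.one_lt.le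

theorem card_mul_sq_le_of_sieve {a h : ℤ} {F : Finset (Finset ℕ)} {R N : ℕ}
    (hF : ∀ S ∈ F, ∀ p ∈ S, p.Prime ∧ p % 4 = 3 ∧ ¬ (p : ℤ) ∣ a ∧ ¬ (p : ℤ) ∣ h)
    (hR : ∀ S ∈ F, ∏ p ∈ S, p ≤ R) {A : Finset (ℕ × ℕ)}
    (hA : A ⊆ Finset.range N ×ˢ Finset.range N)
    (hAF : ∀ z ∈ A, ∀ S ∈ F, ∀ p ∈ S, sieveFn a h p z.1 z.2 = sieveRatio p) :
    (A.card : ℝ) * (∑ S ∈ F, ∏ p ∈ S, sieveRatio p) ^ 2 ≤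
      N ^ 2 * (∑ S ∈ F, ∏ p ∈ S, sieveRatio p) + 4 * N * R ^ 6 := by
  set L := ∑ S ∈ F, ∏ p ∈ S, sieveRatio p with hL
  have hcard : (F.card : ℝ) ≤ R := by
    have : F.card ≤ (Finset.Icc 1 R).card := by
      refine Finset.card_le_card_of_injOn (fun S => ∏ p ∈ S, p) ?_ ?_
      · intro S hS
        simp only [Finset.coe_Icc, Set.mem_Icc]
        exact ⟨Finset.prod_pos fun p hp => (hF S hS p hp).1.pos, hR S hS⟩
      · intro S hS T hT hST
        rw [← Nat.primeFactors_prod fun p hp => (hF S hS p hp).1,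
          ← Nat.primeFactors_prod fun p hp => (hF T hT p hp).1]
        exact congrArg _ hST
    have h2 : F.card ≤ R := by simpa using this
    exact_mod_cast h2
  have h1 : (A.card : ℝ) * L ^ 2 ≤ ∑ u ∈ Finset.range N, ∑ v ∈ Finset.range N,
      (∑ S ∈ F, ∏ p ∈ S, sieveFn a h p u v) ^ 2 := by
    rw [← Finset.sum_product' (f := fun u v : ℕ => (∑ S ∈ F, ∏ p ∈ S, sieveFn a h p u v) ^ 2)]
    refine le_trans ?_ (Finset.sum_le_sum_of_subset_of_nonneg hA fun _ _ _ => sq_nonneg _)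
    rw [← nsmul_eq_mul, ← Finset.sum_const]
    refine Finset.sum_le_sum fun z hz => le_of_eq ?_
    congr 1
    exact Finset.sum_congr rfl fun S hS => Finset.prod_congr rfl fun p hp =>
      (hAF z hz S hS p hp).symm
  refine h1.trans ?_
  have h2 : ∑ u ∈ Finset.range N, ∑ v ∈ Finset.range N,
      (∑ S ∈ F, ∏ p ∈ S, sieveFn a h p u v) ^ 2 = ∑ S ∈ F, ∑ T ∈ F,
      ∑ u ∈ Finset.range N, ∑ v ∈ Finset.range N,
        (∏ p ∈ S, sieveFn a h p u v) * ∏ p ∈ T, sieveFn a h p u v := by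
    simp_rw [sq, Finset.sum_mul_sum]
    rw [Finset.sum_congr rfl fun u _ => Finset.sum_comm, Finset.sum_comm]
    refine Finset.sum_congr rfl fun S _ => ?_
    rw [Finset.sum_congr rfl fun u _ => Finset.sum_comm, Finset.sum_comm]
  rw [h2]
  have h3 : ∀ S ∈ F, ∀ T ∈ F, ∑ u ∈ Finset.range N, ∑ v ∈ Finset.range N,
        (∏ p ∈ S, sieveFn a h p u v) * ∏ p ∈ T, sieveFn a h p u v ≤
      N ^ 2 * (if S = T then ∏ p ∈ S, sieveRatio p else 0) + 4 * N * R ^ 4 := by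
    intro S hS T hT
    have h4 := (abs_le.1 (abs_sum_sum_sieveFn_mul_sub_le (a := a) (h := h) (S := S) (T := T)
      (fun p hp => (Finset.mem_union.1 hp).elim (hF S hS p) (hF T hT p)) N)).2
    have h5 : ∀ S ∈ F, ∏ p ∈ S, (p : ℝ) ≤ R := fun S hS => by
      rw [← Nat.cast_prod]
      exact Nat.cast_le.2 (hR S hS)
    have h6 : ((∏ p ∈ S, (p : ℝ)) * ∏ p ∈ T, (p : ℝ)) ^ 2 ≤ ((R : ℝ) * R) ^ 2 := by
      refine pow_le_pow_left₀ (mul_nonneg (Finset.prod_nonneg fun _ _ => Nat.cast_nonneg _)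
        (Finset.prod_nonneg fun _ _ => Nat.cast_nonneg _)) ?_ 2
      exact mul_le_mul (h5 S hS) (h5 T hT) (Finset.prod_nonneg fun _ _ => Nat.cast_nonneg _)
        (Nat.cast_nonneg _)
    have h7 := mul_le_mul_of_nonneg_left h6 (by positivity : (0 : ℝ) ≤ 4 * N)
    linarith
  refine (Finset.sum_le_sum fun S hS => Finset.sum_le_sum fun T hT => h3 S hS T hT).trans ?_
  have h4 : ∑ S ∈ F, ∑ T ∈ F, ((N : ℝ) ^ 2 * (if S = T then ∏ p ∈ S, sieveRatio p else 0) +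
      4 * N * R ^ 4) = N ^ 2 * L + (F.card : ℝ) ^ 2 * (4 * N * R ^ 4) := by
    simp_rw [Finset.sum_add_distrib, ← Finset.mul_sum]
    congr 1
    · congr 1
      refine Finset.sum_congr rfl fun S hS => ?_
      simp [hS]
    · simp
      ring
  rw [h4]
  have h5 : (F.card : ℝ) ^ 2 ≤ (R : ℝ) ^ 2 := pow_le_pow_left₀ (Nat.cast_nonneg _) hcard 2
  have h6 := mul_le_mul_of_nonneg_right h5 (by positivity : (0 : ℝ) ≤ 4 * N * R ^ 4)
  linarith

theorem sieveFn_eq_sieveRatio {a h : ℤ} {p u v : ℕ} (hp : p.Prime) (hp3 : p % 4 = 3) {s t : ℤ}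
    (hst : s ^ 2 + t ^ 2 = (a : ℤ) * ((u : ℤ) ^ 2 + (v : ℤ) ^ 2) + h) :
    sieveFn a h p u v = sieveRatio p := by
  have : Fact p.Prime := ⟨hp⟩
  rw [sieveFn, if_neg]
  rintro ⟨h1, h2⟩
  have e : (a : ZMod (p ^ 2)) * ((u : ZMod (p ^ 2)) ^ 2 + (v : ZMod (p ^ 2)) ^ 2) + h =
      (s : ZMod (p ^ 2)) ^ 2 + (t : ZMod (p ^ 2)) ^ 2 := by
    have := congrArg (Int.cast (R := ZMod (p ^ 2))) hst
    push_cast at this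
    exact this.symm
  rw [e] at h1 h2
  rw [isUnit_sq_add_sq_iff hp3, not_or] at h1
  have hd : ∀ s : ℤ, ¬ IsUnit (s : ZMod (p ^ 2)) → (s : ZMod (p ^ 2)) ^ 2 = 0 := by
    intro s hs
    have : (p : ℤ) ∣ s := by
      by_contra hcon
      exact hs (isUnit_intCast_zmod_sq hcon)
    rw [← Int.cast_pow, ZMod.intCast_zmod_eq_zero_iff_dvd]
    push_cast
    exact pow_dvd_pow_of_dvd this 2
  rw [hd s h1.1, hd t h1.2, add_zero] at h2
  exact h2 rfl

theorem int_abs_le_sq (x : ℤ) : |x| ≤ x ^ 2 := by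
  rw [← sq_abs]
  exact Int.le_self_sq |x|

theorem sum_le_sum_of_mapsTo_injOn {ι κ : Type*} {s : Finset ι} {t : Finset κ} (e : ι → κ)
    (he : ∀ i ∈ s, e i ∈ t) (hinj : ∀ i ∈ s, ∀ j ∈ s, e i = e j → i = j) {f : ι → ℝ} {g : κ → ℝ}
    (hg : ∀ j ∈ t, 0 ≤ g j) (hfg : ∀ i ∈ s, f i ≤ g (e i)) : ∑ i ∈ s, f i ≤ ∑ j ∈ t, g j := by
  refine (Finset.sum_le_sum hfg).trans ?_
  rw [← Finset.sum_image (f := g) (g := e) fun i hi j hj h => hinj i hi j hj h]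
  refine Finset.sum_le_sum_of_subset_of_nonneg ?_ fun j hj _ => hg j hj
  intro j hj
  obtain ⟨i, hi, rfl⟩ := Finset.mem_image.1 hj
  exact he i hi

theorem sum_Icc_inv_sq_le_two (R : ℕ) : ∑ t ∈ Finset.Icc 1 R, ((t : ℝ) ^ 2)⁻¹ ≤ 2 := by
  have := sum_Ioo_inv_sq_le (α := ℝ) 0 (R + 1)
  have e : Finset.Ioo 0 (R + 1) = Finset.Icc 1 R := by ext; simp; omega
  rw [e] at this
  norm_num at this
  exact this

/-- The nonzero points of `ℤ × ℤ` in the closed disc of squared radius `Y`. -/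
noncomputable def puncturedDisc (Y : ℕ) : Finset (ℤ × ℤ) :=
  (Finset.Icc (-(Y : ℤ)) Y ×ˢ Finset.Icc (-(Y : ℤ)) Y).filter
    fun z => 1 ≤ z.1 ^ 2 + z.2 ^ 2 ∧ z.1 ^ 2 + z.2 ^ 2 ≤ Y

theorem mem_puncturedDisc {Y : ℕ} {z : ℤ × ℤ} :
    z ∈ puncturedDisc Y ↔ 1 ≤ z.1 ^ 2 + z.2 ^ 2 ∧ z.1 ^ 2 + z.2 ^ 2 ≤ Y := by
  simp only [puncturedDisc, Finset.mem_filter, Finset.mem_product, Finset.mem_Icc,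
    and_iff_right_iff_imp]
  rintro ⟨-, h⟩
  have h1 := int_abs_le_sq z.1
  have h2 := int_abs_le_sq z.2
  rw [← abs_le, ← abs_le]
  constructor <;> nlinarith [sq_nonneg z.1, sq_nonneg z.2]

theorem sum_puncturedDisc_inv_le (Y : ℕ) :
    ∑ z ∈ puncturedDisc Y, (((z.1 ^ 2 + z.2 ^ 2 : ℤ) : ℝ))⁻¹ ≤ 8 * (1 + Real.log Y) := by
  have hmaps : ∀ z ∈ puncturedDisc Y, max z.1.natAbs z.2.natAbs ∈ Finset.Icc 1 Y := by
    intro z hz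
    rw [mem_puncturedDisc] at hz
    have h1 := Int.natAbs_le_self_sq z.1
    have h2 := Int.natAbs_le_self_sq z.2
    have h3 := sq_nonneg z.1
    have h4 := sq_nonneg z.2
    rw [Finset.mem_Icc]
    constructor
    · by_contra hcon
      have h5 : z.1 = 0 := by omega
      have h6 : z.2 = 0 := by omega
      rw [h5, h6] at hz
      norm_num at hz
    · omega
  rw [← Finset.sum_fiberwise_of_maps_to hmaps]
  have h1 : ∀ n ∈ Finset.Icc 1 Y, ∑ z ∈ (puncturedDisc Y).filter
      (fun z => max z.1.natAbs z.2.natAbs = n), (((z.1 ^ 2 + z.2 ^ 2 : ℤ) : ℝ))⁻¹ ≤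
      8 * (n : ℝ)⁻¹ := by
    intro n hn
    have hn1 : 1 ≤ n := (Finset.mem_Icc.1 hn).1
    have hn0 : (0 : ℝ) < n := by exact_mod_cast hn1
    have h2 : ∑ z ∈ (puncturedDisc Y).filter
      (fun z => max z.1.natAbs z.2.natAbs = n), (((z.1 ^ 2 + z.2 ^ 2 : ℤ) : ℝ))⁻¹ ≤
        ∑ z ∈ (Finset.box n : Finset (ℤ × ℤ)), ((n : ℝ) ^ 2)⁻¹ := by
      refine sum_le_sum_of_mapsTo_injOn id ?_ (fun _ _ _ _ h => h) (fun _ _ => by positivity) ?_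
      · intro z hz
        exact Int.mem_box.2 (Finset.mem_filter.1 hz).2
      · intro z hz
        have hz := (Finset.mem_filter.1 hz).2
        refine inv_anti₀ (by positivity) ?_
        have : (n : ℤ) ^ 2 ≤ z.1 ^ 2 + z.2 ^ 2 := by
          have h3 := sq_nonneg z.1
          have h4 := sq_nonneg z.2
          rcases max_choice z.1.natAbs z.2.natAbs with h | h
          · rw [← hz, h, Int.natAbs_sq]; linarith
          · rw [← hz, h, Int.natAbs_sq]; linarith
        exact_mod_cast this
    refine h2.trans (le_of_eq ?_)
    rw [Finset.sum_const, Int.card_box (by omega), nsmul_eq_mul]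
    push_cast
    field_simp
  refine (Finset.sum_le_sum h1).trans ?_
  rw [← Finset.mul_sum]
  have h2 := harmonic_le_one_add_log Y
  rw [harmonic_eq_sum_Icc] at h2
  push_cast at h2
  linarith

/-- The sets of primes congruent to `r` modulo `4`, not dividing `k`, with product at most `R`. -/
noncomputable def primeSets (r R k : ℕ) : Finset (Finset ℕ) :=
  (((Finset.Icc 1 R).filter fun p => p.Prime ∧ p % 4 = r ∧ ¬ p ∣ k).powerset).filter
    fun S => ∏ p ∈ S, p ≤ R

theorem mem_primeSets {r R k : ℕ} {S : Finset ℕ} :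
    S ∈ primeSets r R k ↔
      (∀ p ∈ S, p.Prime ∧ p % 4 = r ∧ ¬ p ∣ k) ∧ ∏ p ∈ S, p ≤ R := by
  simp only [primeSets, Finset.mem_filter, Finset.mem_powerset, and_congr_left_iff]
  intro hR
  constructor
  · intro h p hp
    exact (Finset.mem_filter.1 (h hp)).2
  · intro h p hp
    rw [Finset.mem_filter, Finset.mem_Icc]
    refine ⟨⟨(h p hp).1.one_lt.le, le_trans ?_ hR⟩, h p hp⟩
    exact Nat.le_of_dvd (Finset.prod_pos fun q hq => (h q hq).1.pos) (Finset.dvd_prod_of_mem _ hp)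

/-- The sum of reciprocals of the squarefree integers up to `R` which are coprime to `k` and have
all prime factors congruent to `r` modulo `4`. -/
noncomputable def primeSetsSum (r R k : ℕ) : ℝ := ∑ S ∈ primeSets r R k, ∏ p ∈ S, (p : ℝ)⁻¹

/-- The product of `1 + 1 / p` over the primes `p ≡ 3 mod 4` dividing `n`. -/
noncomputable def inertFactor (n : ℕ) : ℝ :=
  ∏ p ∈ n.primeFactors.filter (fun p => p % 4 = 3), (1 + (p : ℝ)⁻¹)

theorem prod_inv_nonneg (S : Finset ℕ) : 0 ≤ ∏ p ∈ S, (p : ℝ)⁻¹ :=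
  Finset.prod_nonneg fun _ _ => by positivity

theorem inertFactor_eq_sum (n : ℕ) : inertFactor n =
    ∑ T ∈ (n.primeFactors.filter (fun p => p % 4 = 3)).powerset, ∏ p ∈ T, (p : ℝ)⁻¹ :=
  Finset.prod_one_add _

theorem eq_of_prod_eq {S T : Finset ℕ} (hS : ∀ p ∈ S, p.Prime) (hT : ∀ p ∈ T, p.Prime)
    (h : ∏ p ∈ S, p = ∏ p ∈ T, p) : S = T := by
  rw [← Nat.primeFactors_prod hS, ← Nat.primeFactors_prod hT, h]

theorem primeSetsSum_le_mul_inertFactor (R : ℕ) {k : ℕ} (hk : k ≠ 0) :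
    primeSetsSum 3 R 1 ≤ primeSetsSum 3 R k * inertFactor k := by
  rw [primeSetsSum, primeSetsSum, inertFactor_eq_sum, Finset.sum_mul_sum, ← Finset.sum_product']
  refine sum_le_sum_of_mapsTo_injOn
    (fun S => (S.filter (fun p => ¬ p ∣ k), S.filter (fun p => p ∣ k))) ?_ ?_ ?_ ?_
  · intro S hS
    rw [mem_primeSets] at hS
    rw [Finset.mem_product, mem_primeSets, Finset.mem_powerset]
    refine ⟨⟨?_, ?_⟩, ?_⟩
    · intro p hp
      rw [Finset.mem_filter] at hp
      exact ⟨(hS.1 p hp.1).1, (hS.1 p hp.1).2.1, hp.2⟩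
    · refine le_trans (Nat.le_of_dvd (Finset.prod_pos fun q hq => (hS.1 q hq).1.pos) ?_) hS.2
      exact Finset.prod_dvd_prod_of_subset _ _ _ (Finset.filter_subset _ _)
    · intro p hp
      rw [Finset.mem_filter] at hp
      rw [Finset.mem_filter, Nat.mem_primeFactors]
      exact ⟨⟨(hS.1 p hp.1).1, hp.2, hk⟩, (hS.1 p hp.1).2.1⟩
  · intro S _ T _ h
    rw [Prod.mk.injEq] at h
    rw [← Finset.filter_union_filter_not_eq (fun p => p ∣ k) S,
      ← Finset.filter_union_filter_not_eq (fun p => p ∣ k) T, h.1, h.2]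
  · intro z _
    exact mul_nonneg (prod_inv_nonneg _) (prod_inv_nonneg _)
  · intro S _
    rw [mul_comm, Finset.prod_filter_mul_prod_filter_not]

theorem log_add_one_le_primeSetsSum (R : ℕ) :
    Real.log (R + 1) ≤ 3 * primeSetsSum 1 R 1 * primeSetsSum 3 R 1 := by
  have h0 := log_add_one_le_harmonic R
  rw [harmonic_eq_sum_Icc] at h0
  push_cast at h0
  refine h0.trans ?_
  have hex : ∀ n : ℕ, ∃ z : ℕ × ℕ, 0 < n → 0 < z.1 ∧ 0 < z.2 ∧ z.2 ^ 2 * z.1 = n ∧ Squarefree z.1 := by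
    intro n
    by_cases hn : 0 < n
    · obtain ⟨a, b, h⟩ := Nat.sq_mul_squarefree_of_pos hn
      exact ⟨(a, b), fun _ => h⟩
    · exact ⟨(0, 0), fun h => absurd h hn⟩
  choose z hz using hex
  have hprod : ∀ n, 0 < n → ((z n).2 ^ 2) * ((∏ p ∈ (z n).1.primeFactors.filter (fun p => p % 2 = 0), p) *
      ((∏ p ∈ (z n).1.primeFactors.filter (fun p => p % 4 = 1), p) *
      ∏ p ∈ (z n).1.primeFactors.filter (fun p => p % 4 = 3), p)) = n := by
    intro n hn
    obtain ⟨h1, h2, h3, h4⟩ := hz n hn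
    conv_rhs => rw [← h3]
    congr 1
    conv_rhs => rw [← Nat.prod_primeFactors_of_squarefree h4]
    rw [← Finset.prod_filter_mul_prod_filter_not (z n).1.primeFactors (fun p => p % 2 = 0)]
    congr 1
    rw [← Finset.prod_filter_mul_prod_filter_not ((z n).1.primeFactors.filter (fun p => ¬ p % 2 = 0))
      (fun p => p % 4 = 1), Finset.filter_filter, Finset.filter_filter]
    congr 1
    · refine Finset.prod_congr (Finset.filter_congr fun p _ => ?_) fun _ _ => rfl
      omega
    · refine Finset.prod_congr (Finset.filter_congr fun p _ => ?_) fun _ _ => rfl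
      omega
  have key : ∑ n ∈ Finset.Icc 1 R, ((n : ℝ))⁻¹ ≤
      ∑ x ∈ Finset.Icc 1 R ×ˢ (({2} : Finset ℕ).powerset ×ˢ (primeSets 1 R 1 ×ˢ primeSets 3 R 1)),
        ((x.1 : ℝ) ^ 2)⁻¹ * ((∏ p ∈ x.2.1, (p : ℝ)⁻¹) * ((∏ p ∈ x.2.2.1, (p : ℝ)⁻¹) *
          ∏ p ∈ x.2.2.2, (p : ℝ)⁻¹)) := by
    refine sum_le_sum_of_mapsTo_injOn (fun n => ((z n).2,
      ((z n).1.primeFactors.filter (fun p => p % 2 = 0),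
      ((z n).1.primeFactors.filter (fun p => p % 4 = 1),
      (z n).1.primeFactors.filter (fun p => p % 4 = 3))))) ?_ ?_ ?_ ?_
    · intro n hn
      rw [Finset.mem_Icc] at hn
      obtain ⟨h1, h2, h3, h4⟩ := hz n hn.1
      have hle1 : (z n).1 ≤ R := (Nat.le_of_dvd hn.1 ⟨_, by rw [mul_comm]; exact h3.symm⟩).trans hn.2
      have hle2 : (z n).2 ≤ R := by nlinarith
      have hmem : ∀ r, (z n).1.primeFactors.filter (fun p => p % 4 = r) ∈ primeSets r R 1 := by
        intro r
        rw [mem_primeSets]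
        constructor
        · intro p hp
          rw [Finset.mem_filter, Nat.mem_primeFactors] at hp
          exact ⟨hp.1.1, hp.2, fun h => hp.1.1.one_lt.ne' (Nat.dvd_one.1 h)⟩
        · refine le_trans (Nat.le_of_dvd h1 ?_) hle1
          exact (Finset.prod_dvd_prod_of_subset _ _ _ (Finset.filter_subset _ _)).trans
            (Nat.prod_primeFactors_dvd _)
      simp only [Finset.mem_product, Finset.mem_Icc, Finset.mem_powerset]
      refine ⟨⟨h2, hle2⟩, ?_, hmem 1, hmem 3⟩
      intro p hp
      rw [Finset.mem_filter, Nat.mem_primeFactors] at hp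
      rw [Finset.mem_singleton]
      exact (Nat.prime_dvd_prime_iff_eq Nat.prime_two hp.1.1).1 (Nat.dvd_of_mod_eq_zero hp.2) |>.symm
    · intro n hn m hm h
      rw [Finset.mem_Icc] at hn hm
      simp only [Prod.mk.injEq] at h
      rw [← hprod n hn.1, ← hprod m hm.1, h.1, h.2.1, h.2.2.1, h.2.2.2]
    · intro x _
      have := prod_inv_nonneg
      exact mul_nonneg (by positivity) (mul_nonneg (this _) (mul_nonneg (this _) (this _)))
    · intro n hn
      rw [Finset.mem_Icc] at hn
      apply le_of_eq
      simp only [Finset.prod_inv_distrib]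
      rw [← mul_inv, ← mul_inv, ← mul_inv]
      congr 1
      have h := congrArg (Nat.cast (R := ℝ)) (hprod n hn.1)
      push_cast at h
      exact h.symm
  refine key.trans ?_
  rw [Finset.sum_product]
  simp_rw [Finset.sum_product, ← Finset.mul_sum, ← Finset.sum_mul]
  have e2 : ∑ T ∈ ({2} : Finset ℕ).powerset, ∏ p ∈ T, (p : ℝ)⁻¹ = 3 / 2 := by
    rw [← Finset.prod_one_add]
    norm_num
  rw [e2]
  have h1 := sum_Icc_inv_sq_le_two R
  have hn : ∀ r, 0 ≤ primeSetsSum r R 1 := fun r => Finset.sum_nonneg fun S _ => prod_inv_nonneg S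
  have h2 : (0 : ℝ) ≤ 3 / 2 * (primeSetsSum 1 R 1 * primeSetsSum 3 R 1) :=
    mul_nonneg (by norm_num) (mul_nonneg (hn 1) (hn 3))
  have h3 := mul_le_mul_of_nonneg_right h1 h2
  simp only [primeSetsSum] at *
  linarith

theorem gaussianInt_norm_eq (z : GaussianInt) : z.norm = z.re ^ 2 + z.im ^ 2 := by
  rw [Zsqrtd.norm_def]; ring

theorem gaussianInt_norm_prod {ι : Type*} (S : Finset ι) (f : ι → GaussianInt) :
    (∏ p ∈ S, f p).norm = ∏ p ∈ S, (f p).norm :=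
  map_prod (Zsqrtd.normMonoidHom (d := -1)) f S

theorem isCoprime_star_of_norm_eq {p q : ℕ} (hp : p.Prime) (hq : q.Prime) (hp2 : p ≠ 2)
    {z w : GaussianInt} (hz : z.norm = p) (hw : w.norm = q) (hzw : p = q → z = w) :
    IsCoprime z (star w) := by
  rcases eq_or_ne p q with rfl | hpq
  · obtain rfl := hzw rfl
    have hodd : IsCoprime (2 * z.re) (p : ℤ) := by
      have hpI : Prime (p : ℤ) := Nat.prime_iff_prime_int.1 hp
      rw [isCoprime_comm, hpI.coprime_iff_not_dvd]
      intro hdvd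
      rw [gaussianInt_norm_eq] at hz
      have hp0 : (0 : ℤ) < p := by exact_mod_cast hp.pos
      rcases hpI.dvd_or_dvd hdvd with h | h
      · have h1 : p ∣ 2 := by exact_mod_cast h
        exact hp2 ((Nat.prime_dvd_prime_iff_eq hp Nat.prime_two).1 h1)
      · have h2 : (p : ℤ) ∣ z.im := by
          refine hpI.dvd_of_dvd_pow (n := 2) ?_
          have : z.im ^ 2 = p - z.re * z.re := by linarith
          rw [this]
          exact dvd_sub (dvd_refl _) (h.mul_left _)
        have h3 : (p : ℤ) ^ 2 ∣ p := by
          conv_rhs => rw [← hz]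
          exact dvd_add (pow_dvd_pow_of_dvd h 2) (pow_dvd_pow_of_dvd h2 2)
        have h4 := Int.le_of_dvd hp0 h3
        have h5 : (2 : ℤ) ≤ p := by exact_mod_cast hp.two_le
        nlinarith
    obtain ⟨u, v, huv⟩ := hodd
    refine ⟨u + v * star z, u, ?_⟩
    have h1 : z + star z = ((2 * z.re : ℤ) : GaussianInt) := by
      ext <;> simp [two_mul]
    have h2 : z * star z = ((p : ℤ) : GaussianInt) := by
      rw [← hz, Zsqrtd.norm_eq_mul_conj]
    have h3 := congrArg (Int.cast (R := GaussianInt)) huv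
    rw [Int.cast_add, Int.cast_mul u, Int.cast_mul v, ← h1, ← h2] at h3
    rw [Int.cast_one] at h3
    linear_combination h3
  · have h1 : IsCoprime (p : ℤ) (q : ℤ) :=
      Nat.isCoprime_iff_coprime.2 ((Nat.coprime_primes hp hq).2 hpq)
    have h2 : IsCoprime ((p : ℤ) : GaussianInt) ((q : ℤ) : GaussianInt) :=
      h1.map (Int.castRingHom GaussianInt)
    refine h2.of_isCoprime_of_dvd_left ?_ |>.of_isCoprime_of_dvd_right ?_
    · exact ⟨star z, by rw [← hz, Zsqrtd.norm_eq_mul_conj]⟩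
    · exact ⟨w, by rw [← hw, Zsqrtd.norm_eq_mul_conj, mul_comm]⟩

theorem gaussianInt_norm_dvd_norm {z w : GaussianInt} (h : z ∣ w) : z.norm ∣ w.norm :=
  map_dvd (Zsqrtd.normMonoidHom (d := -1)) h

theorem primeSetsSum_one_sq_le (R : ℕ) :
    primeSetsSum 1 R 1 ^ 2 ≤ 8 * (1 + Real.log ((R ^ 2 : ℕ) : ℝ)) := by
  refine le_trans ?_ (sum_puncturedDisc_inv_le (R ^ 2))
  have hex : ∀ p : ℕ, ∃ z : GaussianInt, p.Prime → p % 4 = 1 → z.norm = p := by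
    intro p
    by_cases hp : p.Prime ∧ p % 4 = 1
    · have : Fact p.Prime := ⟨hp.1⟩
      obtain ⟨a, b, h⟩ := Nat.Prime.sq_add_sq (p := p) (by omega)
      refine ⟨⟨a, b⟩, fun _ _ => ?_⟩
      rw [gaussianInt_norm_eq]
      dsimp only
      exact_mod_cast h
    · exact ⟨0, fun h1 h2 => absurd ⟨h1, h2⟩ hp⟩
  choose ϖ hϖ using hex
  have hcop : ∀ S ∈ primeSets 1 R 1, ∀ T ∈ primeSets 1 R 1,
      IsCoprime (∏ p ∈ S, ϖ p) (star (∏ p ∈ T, ϖ p)) := by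
    intro S hS T hT
    rw [star_prod]
    refine IsCoprime.prod_left fun p hp => IsCoprime.prod_right fun q hq => ?_
    obtain ⟨h1, h2, -⟩ := (mem_primeSets.1 hS).1 p hp
    obtain ⟨h3, h4, -⟩ := (mem_primeSets.1 hT).1 q hq
    exact isCoprime_star_of_norm_eq h1 h3 (by rintro rfl; omega) (hϖ p h1 h2) (hϖ q h3 h4)
      fun h => h ▸ rfl
  have hnorm : ∀ S ∈ primeSets 1 R 1, (∏ p ∈ S, ϖ p).norm = ((∏ p ∈ S, p : ℕ) : ℤ) := by
    intro S hS
    rw [gaussianInt_norm_prod, Nat.cast_prod]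
    refine Finset.prod_congr rfl fun p hp => ?_
    obtain ⟨h1, h2, -⟩ := (mem_primeSets.1 hS).1 p hp
    exact hϖ p h1 h2
  have hnorm2 : ∀ S ∈ primeSets 1 R 1, ∀ T ∈ primeSets 1 R 1,
      ((∏ p ∈ S, ϖ p) * star (∏ p ∈ T, ϖ p)).norm =
        (((∏ p ∈ S, p) * ∏ p ∈ T, p : ℕ) : ℤ) := by
    intro S hS T hT
    rw [Zsqrtd.norm_mul, Zsqrtd.norm_conj, hnorm S hS, hnorm T hT]
    push_cast
    rfl
  have hdvd : ∀ S ∈ primeSets 1 R 1, ∀ T ∈ primeSets 1 R 1, ∀ S' ∈ primeSets 1 R 1,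
      ∀ T' ∈ primeSets 1 R 1, (∏ p ∈ S, ϖ p) * star (∏ p ∈ T, ϖ p) =
        (∏ p ∈ S', ϖ p) * star (∏ p ∈ T', ϖ p) →
      ∏ p ∈ S, p ∣ ∏ p ∈ S', p ∧ ∏ p ∈ T, p ∣ ∏ p ∈ T', p := by
    intro S hS T hT S' hS' T' hT' h
    constructor
    · have h1 : (∏ p ∈ S, ϖ p) ∣ ∏ p ∈ S', ϖ p :=
        (hcop S hS T' hT').dvd_of_dvd_mul_right ⟨_, h.symm⟩
      have h2 := gaussianInt_norm_dvd_norm h1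
      rw [hnorm S hS, hnorm S' hS'] at h2
      exact Int.natCast_dvd_natCast.1 h2
    · have h1 : star (∏ p ∈ T, ϖ p) ∣ star (∏ p ∈ T', ϖ p) :=
        (hcop S' hS' T hT).symm.dvd_of_dvd_mul_left ⟨_, by rw [← h, mul_comm]⟩
      have h2 := gaussianInt_norm_dvd_norm h1
      rw [Zsqrtd.norm_conj, Zsqrtd.norm_conj, hnorm T hT, hnorm T' hT'] at h2
      exact Int.natCast_dvd_natCast.1 h2
  have hprime : ∀ S ∈ primeSets 1 R 1, ∀ p ∈ S, p.Prime :=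
    fun S hS p hp => ((mem_primeSets.1 hS).1 p hp).1
  rw [primeSetsSum, sq, Finset.sum_mul_sum, ← Finset.sum_product']
  refine sum_le_sum_of_mapsTo_injOn (fun x =>
    (((∏ p ∈ x.1, ϖ p) * star (∏ p ∈ x.2, ϖ p)).re,
      ((∏ p ∈ x.1, ϖ p) * star (∏ p ∈ x.2, ϖ p)).im)) ?_ ?_ ?_ ?_
  · rintro ⟨S, T⟩ hx
    obtain ⟨hS, hT⟩ := Finset.mem_product.1 hx
    rw [mem_puncturedDisc, ← gaussianInt_norm_eq, hnorm2 S hS T hT]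
    have h1 := Finset.prod_pos fun p hp => (hprime S hS p hp).pos
    have h2 := Finset.prod_pos fun p hp => (hprime T hT p hp).pos
    have h3 := Nat.mul_le_mul (mem_primeSets.1 hS).2 (mem_primeSets.1 hT).2
    rw [← sq] at h3
    have h4 := Nat.mul_pos h1 h2
    exact ⟨by exact_mod_cast h4, by exact_mod_cast h3⟩
  · rintro ⟨S, T⟩ hx ⟨S', T'⟩ hx' h
    obtain ⟨hS, hT⟩ := Finset.mem_product.1 hx
    obtain ⟨hS', hT'⟩ := Finset.mem_product.1 hx'
    rw [Prod.mk.injEq] at h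
    have h1 := Zsqrtd.ext h.1 h.2
    have h2 := hdvd S hS T hT S' hS' T' hT' h1
    have h3 := hdvd S' hS' T' hT' S hS T hT h1.symm
    rw [Prod.mk.injEq]
    exact ⟨eq_of_prod_eq (hprime S hS) (hprime S' hS') (Nat.dvd_antisymm h2.1 h3.1),
      eq_of_prod_eq (hprime T hT) (hprime T' hT') (Nat.dvd_antisymm h2.2 h3.2)⟩
  · intro z _
    have h1 := sq_nonneg z.1
    have h2 := sq_nonneg z.2
    exact inv_nonneg.2 (by exact_mod_cast add_nonneg h1 h2)
  · rintro ⟨S, T⟩ hx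
    obtain ⟨hS, hT⟩ := Finset.mem_product.1 hx
    rw [← gaussianInt_norm_eq, hnorm2 S hS T hT, Finset.prod_inv_distrib, Finset.prod_inv_distrib,
      ← mul_inv]
    push_cast
    exact le_rfl

theorem log_le_mul_primeSetsSum_sq {R : ℕ} (hR : 1 ≤ R) :
    Real.log (R + 1) ≤ 288 * primeSetsSum 3 R 1 ^ 2 := by
  have h1 := log_add_one_le_primeSetsSum R
  have h2 := primeSetsSum_one_sq_le R
  have hR' : (1 : ℝ) ≤ R := by exact_mod_cast hR
  have h3 : Real.log ((R ^ 2 : ℕ) : ℝ) ≤ 2 * Real.log (R + 1) := by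
    push_cast
    rw [Real.log_pow]
    have := Real.log_le_log (by linarith) (by linarith : (R : ℝ) ≤ R + 1)
    push_cast
    linarith
  have h4 : Real.log 2 ≤ Real.log (R + 1) := Real.log_le_log (by norm_num) (by linarith)
  have h5 := Real.log_two_gt_d9
  set l := Real.log (R + 1)
  set G := primeSetsSum 1 R 1
  set F := primeSetsSum 3 R 1
  have h6 : G ^ 2 ≤ 32 * l := by linarith
  have hl : 0 < l := by linarith
  have h7 : l ^ 2 ≤ (3 * G * F) ^ 2 := pow_le_pow_left₀ hl.le h1 2
  have h8 : (3 * G * F) ^ 2 ≤ 9 * (32 * l) * F ^ 2 := by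
    have := mul_le_mul_of_nonneg_right h6 (sq_nonneg F)
    nlinarith
  have h9 : l * l ≤ l * (288 * F ^ 2) := by nlinarith
  exact le_of_mul_le_mul_left h9 hl

theorem one_le_prod_one_add_inv (S : Finset ℕ) : (1 : ℝ) ≤ ∏ p ∈ S, (1 + (p : ℝ)⁻¹) := by
  refine Finset.one_le_prod fun p _ => ?_
  have : (0 : ℝ) ≤ (p : ℝ)⁻¹ := by positivity
  linarith

theorem one_le_inertFactor (n : ℕ) : 1 ≤ inertFactor n := one_le_prod_one_add_inv _

theorem inertFactor_mul_le {a b : ℕ} (ha : a ≠ 0) (hb : b ≠ 0) :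
    inertFactor (a * b) ≤ inertFactor a * inertFactor b := by
  rw [inertFactor, Nat.primeFactors_mul ha hb, Finset.filter_union, inertFactor, inertFactor,
    ← Finset.prod_union_inter]
  exact le_mul_of_one_le_right (zero_le_one.trans (one_le_prod_one_add_inv _))
    (one_le_prod_one_add_inv _)

theorem inertFactor_le_sq {n : ℕ} (hn : n ≠ 0) :
    inertFactor n ≤ ((n : ℝ) / (Nat.totient n : ℝ)) ^ 2 := by
  have h1 : inertFactor n ≤ ∏ p ∈ n.primeFactors, (1 - (p : ℝ)⁻¹)⁻¹ := by
    have hone : ∀ p ∈ n.primeFactors, (1 : ℝ) ≤ (1 - (p : ℝ)⁻¹)⁻¹ ∧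
        1 + (p : ℝ)⁻¹ ≤ (1 - (p : ℝ)⁻¹)⁻¹ := by
      intro p hp
      have hp1 : (1 : ℝ) < p := by exact_mod_cast (Nat.prime_of_mem_primeFactors hp).one_lt
      have hp2 : (p : ℝ)⁻¹ < 1 := inv_lt_one_of_one_lt₀ hp1
      have hp3 : 0 < (p : ℝ)⁻¹ := by positivity
      have hp4 : 0 < 1 - (p : ℝ)⁻¹ := by linarith
      constructor
      · exact (one_le_inv₀ hp4).2 (by linarith)
      · rw [← one_div (1 - _), le_div_iff₀ hp4]
        nlinarith
    rw [← Finset.prod_filter_mul_prod_filter_not n.primeFactors (fun p => p % 4 = 3)]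
    have h2 : inertFactor n ≤ ∏ p ∈ n.primeFactors.filter (fun p => p % 4 = 3),
        (1 - (p : ℝ)⁻¹)⁻¹ :=
      Finset.prod_le_prod (fun p _ => by positivity)
        fun p hp => (hone p (Finset.mem_filter.1 hp).1).2
    refine h2.trans (le_mul_of_one_le_right ?_ ?_)
    · linarith [one_le_inertFactor n]
    · exact Finset.one_le_prod fun p hp => (hone p (Finset.mem_filter.1 hp).1).1
  have h2 : (n : ℝ) / (Nat.totient n : ℝ) = ∏ p ∈ n.primeFactors, (1 - (p : ℝ)⁻¹)⁻¹ := by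
    have h3 := Nat.totient_eq_mul_prod_factors n
    have h4 : ((Nat.totient n : ℚ) : ℝ) = n * ∏ p ∈ n.primeFactors, (1 - (p : ℝ)⁻¹) := by
      rw [h3]; push_cast; rfl
    rw [Rat.cast_natCast] at h4
    rw [h4, Finset.prod_inv_distrib, div_mul_cancel_left₀ (by exact_mod_cast hn)]
  have h5 : (1 : ℝ) ≤ (n : ℝ) / (Nat.totient n : ℝ) := by
    rw [one_le_div₀ (by exact_mod_cast Nat.totient_pos.2 (Nat.pos_of_ne_zero hn))]
    exact_mod_cast Nat.totient_le n
  rw [← h2] at h1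
  nlinarith

/-- The points `(u, v)` of the square `[0, N) × [0, N)` such that `a (u² + v²) + h` is a sum of
two squares. -/
noncomputable def sieveSet (a h : ℤ) (N : ℕ) : Finset (ℕ × ℕ) :=
  (Finset.range N ×ˢ Finset.range N).filter
    fun z => ∃ s t : ℤ, s ^ 2 + t ^ 2 = a * ((z.1 : ℤ) ^ 2 + (z.2 : ℤ) ^ 2) + h

theorem card_sieveSet_mul_sqrt_log_le {a h : ℤ} (ha : a ≠ 0) (hh : h ≠ 0) {N : ℕ} (hN : 1 ≤ N) :
    ((sieveSet a h N).card : ℝ) * √(Real.log N) ≤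
      210 * N ^ 2 * inertFactor (a * h).natAbs := by
  set R := Nat.nthRoot 6 N with hRdef
  set k := (a * h).natAbs with hkdef
  have hk : k ≠ 0 := Int.natAbs_ne_zero.2 (mul_ne_zero ha hh)
  have hR6 : R ^ 6 ≤ N := Nat.pow_nthRoot_le (Or.inl (by norm_num))
  have hNR : N < (R + 1) ^ 6 := Nat.lt_pow_nthRoot_add_one (by norm_num) N
  have hR1 : 1 ≤ R := by
    by_contra hcon
    have : R = 0 := by omega
    rw [this] at hNR
    omega
  set F := primeSets 3 R k with hFdef
  set L := ∑ S ∈ F, ∏ p ∈ S, sieveRatio p with hLdef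
  have hprime : ∀ S ∈ F, ∀ p ∈ S, p.Prime ∧ p % 4 = 3 ∧ ¬ p ∣ k :=
    fun S hS => (mem_primeSets.1 hS).1
  have hsieve := card_mul_sq_le_of_sieve (a := a) (h := h) (F := F) (R := R) (N := N)
    (A := sieveSet a h N) ?_ (fun S hS => (mem_primeSets.1 hS).2) (Finset.filter_subset _ _) ?_
  rotate_left
  · intro S hS p hp
    obtain ⟨h1, h2, h3⟩ := hprime S hS p hp
    refine ⟨h1, h2, fun h4 => h3 ?_, fun h4 => h3 ?_⟩
    · exact Int.natCast_dvd.1 (h4.mul_right h)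
    · exact Int.natCast_dvd.1 (h4.mul_left a)
  · intro z hz S hS p hp
    obtain ⟨h1, h2, -⟩ := hprime S hS p hp
    obtain ⟨s, t, hst⟩ := (Finset.mem_filter.1 hz).2
    exact sieveFn_eq_sieveRatio h1 h2 hst
  rw [← hLdef] at hsieve
  have hPL : primeSetsSum 3 R k ≤ L := by
    refine Finset.sum_le_sum fun S hS => Finset.prod_le_prod (fun p _ => by positivity) ?_
    intro p hp
    rw [← one_div]
    exact (sieveRatio_bounds (hprime S hS p hp).1.two_le).2.1
  have hL1 : 1 ≤ L := by
    have hmem : ∅ ∈ F := by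
      rw [hFdef, mem_primeSets]
      simpa using hR1
    have := Finset.single_le_sum (f := fun S => ∏ p ∈ S, sieveRatio p) (fun S hS =>
      Finset.prod_nonneg fun p hp =>
        (sieveRatio_bounds (hprime S hS p hp).1.two_le).2.2.1) hmem
    simpa using this
  have hI := one_le_inertFactor k
  have hPI : primeSetsSum 3 R 1 ≤ L * inertFactor k :=
    (primeSetsSum_le_mul_inertFactor R hk).trans
      (mul_le_mul_of_nonneg_right hPL (by linarith))
  have hN1 : (1 : ℝ) ≤ N := by exact_mod_cast hN
  have hP0 : 0 ≤ primeSetsSum 3 R 1 := Finset.sum_nonneg fun S _ => prod_inv_nonneg S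
  have hlog : √(Real.log N) ≤ 42 * primeSetsSum 3 R 1 := by
    rw [Real.sqrt_le_iff]
    refine ⟨by positivity, ?_⟩
    have h1 : Real.log N ≤ 6 * Real.log (R + 1) := by
      have h2 := Real.log_le_log (by linarith) (by exact_mod_cast hNR.le :
        (N : ℝ) ≤ ((R : ℝ) + 1) ^ 6)
      rw [Real.log_pow] at h2
      exact_mod_cast h2
    have h2 := log_le_mul_primeSetsSum_sq hR1
    nlinarith [sq_nonneg (primeSetsSum 3 R 1)]
  have hR6' : (R : ℝ) ^ 6 ≤ N := by exact_mod_cast hR6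
  set C : ℝ := ((sieveSet a h N).card : ℝ) with hC
  have hC0 : 0 ≤ C := by positivity
  have hCL : C * L ≤ 5 * N ^ 2 := by
    have h1 : C * L ^ 2 ≤ 5 * N ^ 2 * L := by nlinarith
    refine le_of_mul_le_mul_right ?_ (by linarith : 0 < L)
    linarith
  calc C * √(Real.log N) ≤ C * (42 * (L * inertFactor k)) :=
        mul_le_mul_of_nonneg_left (by linarith) hC0
    _ = 42 * (C * L) * inertFactor k := by ring
    _ ≤ 42 * (5 * N ^ 2) * inertFactor k :=
        mul_le_mul_of_nonneg_right (by linarith) (by linarith)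
    _ = _ := by ring

theorem dvd_of_dvd_sq_add_sq {p : ℕ} (hp : p.Prime) (hp3 : p % 4 = 3) {x y : ℤ}
    (h : (p : ℤ) ∣ x ^ 2 + y ^ 2) : (p : ℤ) ∣ x := by
  have : Fact p.Prime := ⟨hp⟩
  rw [← ZMod.intCast_zmod_eq_zero_iff_dvd] at h ⊢
  push_cast at h
  by_contra hx
  exact ZMod.mod_four_ne_three_of_sq_eq_neg_sq' hx (x := (y : ZMod p))
    (by linear_combination h) hp3

theorem prod_natCast_dvd {T : Finset ℕ} (hT : ∀ p ∈ T, p.Prime) {x : ℤ}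
    (h : ∀ p ∈ T, (p : ℤ) ∣ x) : ((∏ p ∈ T, p : ℕ) : ℤ) ∣ x := by
  rw [Int.natCast_dvd]
  exact Finset.prod_primes_dvd _ (fun p hp => (hT p hp).prime) fun p hp =>
    Int.natCast_dvd.1 (h p hp)

theorem sum_inertFactor_mul_inv_le (Y : ℕ) :
    ∑ z ∈ puncturedDisc Y, inertFactor (z.1 ^ 2 + z.2 ^ 2).natAbs *
      (((z.1 ^ 2 + z.2 ^ 2 : ℤ) : ℝ))⁻¹ ≤ 16 * (1 + Real.log Y) := by
  have h1 := mul_le_mul (sum_Icc_inv_sq_le_two Y) (sum_puncturedDisc_inv_le Y)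
    (Finset.sum_nonneg fun z _ => inv_nonneg.2 (by positivity)) zero_le_two
  refine le_trans ?_ (h1.trans (le_of_eq (by ring)))
  rw [Finset.sum_mul_sum, ← Finset.sum_product']
  simp_rw [inertFactor_eq_sum, Finset.sum_mul]
  rw [Finset.sum_sigma']
  have hprime : ∀ z : ℤ × ℤ, ∀ T ∈ ((z.1 ^ 2 + z.2 ^ 2).natAbs.primeFactors.filter
      (fun p => p % 4 = 3)).powerset, ∀ p ∈ T, p.Prime ∧ p % 4 = 3 ∧
        (p : ℤ) ∣ z.1 ^ 2 + z.2 ^ 2 := by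
    intro z T hT p hp
    have h2 := Finset.mem_filter.1 (Finset.mem_powerset.1 hT hp)
    exact ⟨Nat.prime_of_mem_primeFactors h2.1, h2.2,
      Int.natCast_dvd.2 (Nat.dvd_of_mem_primeFactors h2.1)⟩
  have hdvd : ∀ z : ℤ × ℤ, ∀ T ∈ ((z.1 ^ 2 + z.2 ^ 2).natAbs.primeFactors.filter
      (fun p => p % 4 = 3)).powerset, 0 < ∏ p ∈ T, p ∧
        ∃ u v : ℤ, z = (((∏ p ∈ T, p : ℕ) : ℤ) * u, ((∏ p ∈ T, p : ℕ) : ℤ) * v) := by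
    intro z T hT
    have h2 := hprime z T hT
    refine ⟨Finset.prod_pos fun p hp => (h2 p hp).1.pos, ?_⟩
    obtain ⟨u, hu⟩ := prod_natCast_dvd (fun p hp => (h2 p hp).1) fun p hp =>
      dvd_of_dvd_sq_add_sq (h2 p hp).1 (h2 p hp).2.1 (h2 p hp).2.2
    obtain ⟨v, hv⟩ := prod_natCast_dvd (fun p hp => (h2 p hp).1) fun p hp =>
      dvd_of_dvd_sq_add_sq (h2 p hp).1 (h2 p hp).2.1 (add_comm (z.1 ^ 2) _ ▸ (h2 p hp).2.2)
    exact ⟨u, v, Prod.ext hu hv⟩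
  refine sum_le_sum_of_mapsTo_injOn (fun x : (_ : ℤ × ℤ) × Finset ℕ =>
    (∏ p ∈ x.2, p, (x.1.1 / ((∏ p ∈ x.2, p : ℕ) : ℤ), x.1.2 / ((∏ p ∈ x.2, p : ℕ) : ℤ))))
    ?_ ?_ ?_ ?_
  · rintro ⟨z, T⟩ hx
    obtain ⟨hz, hT⟩ := Finset.mem_sigma.1 hx
    obtain ⟨hd, u, v, huv⟩ := hdvd z T hT
    dsimp only at hz hT ⊢
    generalize ∏ p ∈ T, p = d at *
    have hd0 : (d : ℤ) ≠ 0 := by exact_mod_cast hd.ne'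
    have hd1 : (1 : ℤ) ≤ d := by exact_mod_cast hd
    subst huv
    rw [mem_puncturedDisc] at hz
    dsimp only at hz ⊢
    rw [Int.mul_ediv_cancel_left _ hd0, Int.mul_ediv_cancel_left _ hd0, Finset.mem_product,
      mem_puncturedDisc, Finset.mem_Icc]
    dsimp only
    have h3 : ((d : ℤ) * u) ^ 2 + (d * v) ^ 2 = d ^ 2 * (u ^ 2 + v ^ 2) := by ring
    rw [h3] at hz
    have h4 : 1 ≤ u ^ 2 + v ^ 2 := by
      by_contra hcon
      nlinarith [sq_nonneg u, sq_nonneg v, sq_nonneg (d : ℤ)]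
    have h5 : (d : ℤ) ≤ d ^ 2 := by nlinarith
    refine ⟨⟨hd, ?_⟩, h4, ?_⟩
    · have : (d : ℤ) ≤ Y := by nlinarith
      exact_mod_cast this
    · nlinarith
  · rintro ⟨z, T⟩ hx ⟨z', T'⟩ hx' h
    obtain ⟨hz, hT⟩ := Finset.mem_sigma.1 hx
    obtain ⟨hz', hT'⟩ := Finset.mem_sigma.1 hx'
    dsimp only at hT hT' h
    have h1 := (Prod.ext_iff.1 h).1
    have h2 := (Prod.ext_iff.1 (Prod.ext_iff.1 h).2)
    dsimp only at h1 h2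
    obtain rfl := eq_of_prod_eq (fun p hp => (hprime z T hT p hp).1)
      (fun p hp => (hprime z' T' hT' p hp).1) h1
    obtain ⟨hd, u, v, rfl⟩ := hdvd z T hT
    obtain ⟨hd', u', v', rfl⟩ := hdvd z' T hT'
    have hd0 : ((∏ p ∈ T, p : ℕ) : ℤ) ≠ 0 := by exact_mod_cast hd.ne'
    dsimp only at h2
    rw [Int.mul_ediv_cancel_left _ hd0, Int.mul_ediv_cancel_left _ hd0,
      Int.mul_ediv_cancel_left _ hd0, Int.mul_ediv_cancel_left _ hd0] at h2
    rw [h2.1, h2.2]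
  · intro z _
    positivity
  · rintro ⟨z, T⟩ hx
    obtain ⟨hz, hT⟩ := Finset.mem_sigma.1 hx
    obtain ⟨hd, u, v, huv⟩ := hdvd z T hT
    dsimp only at hz hT ⊢
    rw [Finset.prod_inv_distrib, ← Nat.cast_prod]
    generalize ∏ p ∈ T, p = d at *
    have hd0 : (d : ℤ) ≠ 0 := by exact_mod_cast hd.ne'
    have hd1 : (1 : ℝ) ≤ d := by exact_mod_cast hd
    subst huv
    dsimp only
    rw [Int.mul_ediv_cancel_left _ hd0, Int.mul_ediv_cancel_left _ hd0]
    have h3 : ((d : ℤ) * u) ^ 2 + (d * v) ^ 2 = d ^ 2 * (u ^ 2 + v ^ 2) := by ring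
    rw [h3, Int.cast_mul, mul_inv, ← mul_assoc]
    refine mul_le_mul_of_nonneg_right ?_ (by positivity)
    push_cast
    exact mul_le_of_le_one_left (by positivity) (inv_le_one_of_one_le₀ hd1)

theorem exists_eq_mul_star_of_norm_eq {z w : GaussianInt} (hz : z ≠ 0) (h : z.norm = w.norm) :
    ∃ α β ε : GaussianInt, ε.norm = 1 ∧ z = α * β ∧ w = ε * (α * star β) := by
  obtain ⟨β, hβ⟩ := EuclideanDomain.gcd_dvd_left z w
  obtain ⟨γ, hγ⟩ := EuclideanDomain.gcd_dvd_right z w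
  have hbez := EuclideanDomain.gcd_eq_gcd_ab z w
  set α := EuclideanDomain.gcd z w
  have hα : α ≠ 0 := by
    intro h0
    rw [h0, zero_mul] at hβ
    exact hz hβ
  have hβ0 : β ≠ 0 := by
    intro h0
    rw [h0, mul_zero] at hβ
    exact hz hβ
  have hcop : IsCoprime β γ := by
    refine ⟨EuclideanDomain.gcdA z w, EuclideanDomain.gcdB z w, mul_left_cancel₀ hα ?_⟩
    calc _ = (α * β) * EuclideanDomain.gcdA z w + (α * γ) * EuclideanDomain.gcdB z w := by ring
      _ = α * 1 := by rw [← hβ, ← hγ, mul_one, ← hbez]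
  have hα' : α.norm ≠ 0 := fun h0 => hα ((Zsqrtd.norm_eq_zero_iff (by norm_num) _).1 h0)
  have hβ' : β.norm ≠ 0 := fun h0 => hβ0 ((Zsqrtd.norm_eq_zero_iff (by norm_num) _).1 h0)
  have hnorm : β.norm = γ.norm := by
    rw [hβ, hγ, Zsqrtd.norm_mul, Zsqrtd.norm_mul] at h
    exact mul_left_cancel₀ hα' h
  have hdvd : β ∣ star γ := by
    refine hcop.dvd_of_dvd_mul_left ⟨star β, ?_⟩
    rw [← Zsqrtd.norm_eq_mul_conj, ← Zsqrtd.norm_eq_mul_conj, hnorm]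
  obtain ⟨δ, hδ⟩ := hdvd
  refine ⟨α, β, star δ, ?_, hβ, ?_⟩
  · have h2 := congrArg Zsqrtd.norm hδ
    rw [Zsqrtd.norm_conj, Zsqrtd.norm_mul, ← hnorm] at h2
    rw [Zsqrtd.norm_conj]
    exact mul_left_cancel₀ hβ' (by rw [← h2, mul_one])
  · rw [hγ, ← star_star γ, hδ, star_mul]
    ring

theorem natCast_bind_Icc_eq (X : ℕ) :
    (Finset.Icc 1 X >>= fun a => pure (a : ℤ) : Finset ℤ) = Finset.Icc 1 (X : ℤ) := by
  ext n
  simp only [Finset.bind_def, Finset.pure_def, Finset.mem_sup, Finset.mem_Icc,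
    Finset.mem_singleton]
  constructor
  · rintro ⟨a, ha, rfl⟩
    omega
  · intro hn
    exact ⟨n.toNat, by omega, by omega⟩

theorem rTwoSquaresZ_eq_card {X : ℕ} {n : ℤ} (hn : n ∈ Finset.Icc 1 (X : ℤ)) :
    rTwoSquaresZ n = ((puncturedDisc X).filter fun z => z.1 ^ 2 + z.2 ^ 2 = n).card := by
  rw [rTwoSquaresZ, ← Set.ncard_coe_finset]
  congr 1
  ext z
  rw [Finset.mem_Icc] at hn
  simp only [Set.mem_ofPred_eq, Finset.coe_filter, mem_puncturedDisc]
  constructor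
  · intro h
    rw [h]
    exact ⟨hn, rfl⟩
  · exact fun h => h.2

theorem exists_of_mem_sumTwoSquaresSet {n : ℤ} (hn : n ∈ sumTwoSquaresSet) :
    ∃ s t : ℤ, s ^ 2 + t ^ 2 = n := by
  obtain ⟨z, hz⟩ := Set.nonempty_of_ncard_ne_zero hn.2.ne'
  exact ⟨z.1, z.2, hz⟩

/-- The pairs of nonzero Gaussian integers `α, β` such that `N(αβ) ≤ X` and `N(αβ) + h` is a sum
of two squares. -/
noncomputable def factorPairs (h : ℤ) (X : ℕ) : Finset ((ℤ × ℤ) × (ℤ × ℤ)) :=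
  (puncturedDisc X ×ˢ puncturedDisc X).filter fun y =>
    (y.1.1 ^ 2 + y.1.2 ^ 2) * (y.2.1 ^ 2 + y.2.2 ^ 2) ≤ X ∧
      ∃ s t : ℤ, s ^ 2 + t ^ 2 = (y.1.1 ^ 2 + y.1.2 ^ 2) * (y.2.1 ^ 2 + y.2.2 ^ 2) + h

theorem sum_rTwoSquaresZ_sq_le_card (h : ℤ) (X : ℕ) :
    ∑ n ∈ (Finset.Icc 1 (X : ℤ)).filter (fun n => n + h ∈ sumTwoSquaresSet),
      rTwoSquaresZ n ^ 2 ≤ 9 * (factorPairs h X).card := by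
  set P := (puncturedDisc X ×ˢ puncturedDisc X).filter fun y =>
    y.1.1 ^ 2 + y.1.2 ^ 2 = y.2.1 ^ 2 + y.2.2 ^ 2 ∧
      ∃ s t : ℤ, s ^ 2 + t ^ 2 = y.1.1 ^ 2 + y.1.2 ^ 2 + h with hP
  set I := Finset.Icc (-1 : ℤ) 1 ×ˢ Finset.Icc (-1 : ℤ) 1 with hI
  have hIcard : I.card = 9 := by rw [hI, Finset.card_product]; simp
  have h1 : ∑ n ∈ (Finset.Icc 1 (X : ℤ)).filter (fun n => n + h ∈ sumTwoSquaresSet),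
      rTwoSquaresZ n ^ 2 ≤ P.card := by
    have h2 : ∀ n ∈ (Finset.Icc 1 (X : ℤ)).filter (fun n => n + h ∈ sumTwoSquaresSet),
        rTwoSquaresZ n ^ 2 = (((puncturedDisc X).filter fun z => z.1 ^ 2 + z.2 ^ 2 = n) ×ˢ
          ((puncturedDisc X).filter fun z => z.1 ^ 2 + z.2 ^ 2 = n)).card := by
      intro n hn
      rw [rTwoSquaresZ_eq_card (Finset.mem_filter.1 hn).1, sq, ← Finset.card_product]
    rw [Finset.sum_congr rfl h2, ← Finset.card_sigma]
    refine Finset.card_le_card_of_injOn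
      (fun x : (_ : ℤ) × ((ℤ × ℤ) × (ℤ × ℤ)) => x.2) ?_ ?_
    · rintro ⟨n, z, w⟩ hx
      obtain ⟨hn, hzw⟩ := Finset.mem_sigma.1 hx
      obtain ⟨hz, hw⟩ := Finset.mem_product.1 hzw
      dsimp only at hn hz hw
      rw [Finset.mem_filter] at hz hw hn
      obtain ⟨s, t, hst⟩ := exists_of_mem_sumTwoSquaresSet hn.2
      rw [hP, Finset.mem_coe, Finset.mem_filter, Finset.mem_product]
      exact ⟨⟨hz.1, hw.1⟩, hz.2.trans hw.2.symm, s, t, by rw [hst, hz.2]⟩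
    · rintro ⟨n, z, w⟩ hx ⟨n', z', w'⟩ hx' hh
      obtain ⟨-, hzw⟩ := Finset.mem_sigma.1 hx
      obtain ⟨-, hzw'⟩ := Finset.mem_sigma.1 hx'
      dsimp only at hh
      obtain ⟨rfl, rfl⟩ := Prod.mk.inj hh
      have h2 := (Finset.mem_filter.1 (Finset.mem_product.1 hzw).1).2
      have h3 := (Finset.mem_filter.1 (Finset.mem_product.1 hzw').1).2
      dsimp only at h2 h3
      rw [← h2, ← h3]
  refine h1.trans ?_
  rw [mul_comm, ← hIcard, ← Finset.card_product]
  refine Finset.card_le_card_of_surjOn (fun y =>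
    let α : GaussianInt := ⟨y.1.1.1, y.1.1.2⟩
    let β : GaussianInt := ⟨y.1.2.1, y.1.2.2⟩
    let ε : GaussianInt := ⟨y.2.1, y.2.2⟩
    (((α * β).re, (α * β).im), ((ε * (α * star β)).re, (ε * (α * star β)).im))) ?_
  rintro ⟨⟨z₁, z₂⟩, ⟨w₁, w₂⟩⟩ hzw
  rw [hP, Finset.mem_coe, Finset.mem_filter, Finset.mem_product, mem_puncturedDisc] at hzw
  dsimp only at hzw
  obtain ⟨⟨⟨hz1, hzX⟩, -⟩, hnorm, hrep⟩ := hzw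
  obtain ⟨z, hz1', hz2'⟩ : ∃ z : GaussianInt, z.re = z₁ ∧ z.im = z₂ := ⟨⟨z₁, z₂⟩, rfl, rfl⟩
  obtain ⟨w, hw1', hw2'⟩ : ∃ w : GaussianInt, w.re = w₁ ∧ w.im = w₂ := ⟨⟨w₁, w₂⟩, rfl, rfl⟩
  subst hz1' hz2' hw1' hw2'
  have hzn : z.norm = z.re ^ 2 + z.im ^ 2 := gaussianInt_norm_eq z
  have hwn : w.norm = w.re ^ 2 + w.im ^ 2 := gaussianInt_norm_eq w
  have hz0 : z ≠ 0 := by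
    intro h0
    have h2 : z.norm = 0 := by rw [h0, Zsqrtd.norm_zero]
    omega
  obtain ⟨α, β, ε, hε, hzαβ, hwαβ⟩ := exists_eq_mul_star_of_norm_eq (w := w) hz0 (by rw [hzn, hwn, hnorm])
  have hαβ : (α.re ^ 2 + α.im ^ 2) * (β.re ^ 2 + β.im ^ 2) = z.re ^ 2 + z.im ^ 2 := by
    rw [← gaussianInt_norm_eq, ← gaussianInt_norm_eq, ← hzn, hzαβ, Zsqrtd.norm_mul]
  refine ⟨((⟨α.re, α.im⟩, ⟨β.re, β.im⟩), (ε.re, ε.im)), ?_, ?_⟩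
  · have hα0 : 0 ≤ α.re ^ 2 + α.im ^ 2 := by positivity
    have hβ0 : 0 ≤ β.re ^ 2 + β.im ^ 2 := by positivity
    have hα1 : 1 ≤ α.re ^ 2 + α.im ^ 2 := by
      by_contra hcon
      have : α.re ^ 2 + α.im ^ 2 = 0 := by omega
      rw [this, zero_mul] at hαβ
      omega
    have hβ1 : 1 ≤ β.re ^ 2 + β.im ^ 2 := by
      by_contra hcon
      have : β.re ^ 2 + β.im ^ 2 = 0 := by omega
      rw [this, mul_zero] at hαβ
      omega
    rw [gaussianInt_norm_eq] at hε
    rw [Finset.mem_coe, Finset.mem_product, factorPairs, Finset.mem_filter, Finset.mem_product,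
      mem_puncturedDisc, mem_puncturedDisc, hI, Finset.mem_product, Finset.mem_Icc, Finset.mem_Icc]
    dsimp only
    rw [hαβ]
    refine ⟨⟨⟨⟨hα1, by nlinarith⟩, hβ1, by nlinarith⟩, hzX, hrep⟩, ⟨?_, ?_⟩, ?_, ?_⟩ <;>
      nlinarith [sq_nonneg ε.re, sq_nonneg ε.im]
  · dsimp only
    rw [← hzαβ, ← hwαβ]

theorem card_factorPairs_le (h : ℤ) (X : ℕ) :
    (factorPairs h X).card ≤ 2 * ∑ α ∈ (puncturedDisc X).filter
      (fun α => (α.1 ^ 2 + α.2 ^ 2) * (α.1 ^ 2 + α.2 ^ 2) ≤ (X : ℤ)), ((puncturedDisc X).filter fun β =>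
        (α.1 ^ 2 + α.2 ^ 2) * (β.1 ^ 2 + β.2 ^ 2) ≤ (X : ℤ) ∧
        ∃ s t : ℤ, s ^ 2 + t ^ 2 = (α.1 ^ 2 + α.2 ^ 2) * (β.1 ^ 2 + β.2 ^ 2) + h).card := by
  set T := (factorPairs h X).filter fun y =>
    y.1.1 ^ 2 + y.1.2 ^ 2 ≤ y.2.1 ^ 2 + y.2.2 ^ 2 with hT
  have h1 : (factorPairs h X).card ≤ T.card + T.card := by
    rw [← Finset.card_image_of_injective T Prod.swap_injective]
    conv_rhs => rw [Finset.card_image_of_injective T Prod.swap_injective]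
    rw [← Finset.card_filter_add_card_filter_not (s := factorPairs h X) fun y =>
      y.1.1 ^ 2 + y.1.2 ^ 2 ≤ y.2.1 ^ 2 + y.2.2 ^ 2]
    refine Nat.add_le_add_left (Finset.card_le_card_of_injOn Prod.swap ?_
      Prod.swap_injective.injOn) _
    rintro ⟨α, β⟩ hy
    rw [Finset.mem_coe, Finset.mem_filter, factorPairs, Finset.mem_filter, Finset.mem_product,
      mul_comm] at hy
    rw [Finset.mem_coe, Finset.mem_filter, factorPairs, Finset.mem_filter, Finset.mem_product]
    exact ⟨⟨⟨hy.1.1.2, hy.1.1.1⟩, hy.1.2⟩, (not_le.1 hy.2).le⟩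
  refine h1.trans ?_
  rw [← two_mul, ← Finset.card_sigma]
  refine Nat.mul_le_mul_left 2 (Finset.card_le_card_of_injOn (fun y => ⟨y.1, y.2⟩) ?_ ?_)
  · rintro ⟨α, β⟩ hy
    rw [Finset.mem_coe, hT, Finset.mem_filter, factorPairs, Finset.mem_filter,
      Finset.mem_product] at hy
    obtain ⟨⟨⟨hα, hβ⟩, hX, hrep⟩, hle⟩ := hy
    dsimp only at hα hβ hX hrep hle
    rw [Finset.mem_coe, Finset.mem_sigma, Finset.mem_filter, Finset.mem_filter]
    exact ⟨⟨hα, (mul_le_mul_of_nonneg_left hle (by positivity)).trans hX⟩, hβ, hX, hrep⟩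
  · rintro ⟨α, β⟩ _ ⟨α', β'⟩ _ hh
    simpa using hh

theorem card_filter_puncturedDisc_le {a h : ℤ} (ha : 1 ≤ a) {X N : ℕ}
    (hN : (X : ℤ) < a * N ^ 2) :
    ((puncturedDisc X).filter fun β => a * (β.1 ^ 2 + β.2 ^ 2) ≤ (X : ℤ) ∧
      ∃ s t : ℤ, s ^ 2 + t ^ 2 = a * (β.1 ^ 2 + β.2 ^ 2) + h).card ≤
      4 * (sieveSet a h N).card := by
  set I : Finset (ℤ × ℤ) := {1, -1} ×ˢ {1, -1} with hI
  have hIcard : I.card = 4 := by rw [hI, Finset.card_product]; rfl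
  rw [← hIcard, ← Finset.card_product]
  refine Finset.card_le_card_of_surjOn (fun y => (y.1.1 * (y.2.1 : ℤ), y.1.2 * (y.2.2 : ℤ))) ?_
  rintro ⟨u, v⟩ hy
  rw [Finset.mem_coe, Finset.mem_filter] at hy
  obtain ⟨-, hX, hrep⟩ := hy
  dsimp only at hX hrep
  have hsign : ∀ u : ℤ, ∃ e : ℤ, e ∈ ({1, -1} : Finset ℤ) ∧ e * (u.natAbs : ℤ) = u := by
    intro u
    rcases Int.natAbs_eq u with hu | hu
    · exact ⟨1, by simp, by rw [one_mul, ← hu]⟩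
    · exact ⟨-1, by simp, by rw [neg_one_mul, ← hu]⟩
  have hlt : u ^ 2 + v ^ 2 < (N : ℤ) ^ 2 := by
    by_contra hcon
    nlinarith
  obtain ⟨e, he, heu⟩ := hsign u
  obtain ⟨f, hf, hfv⟩ := hsign v
  refine ⟨((e, f), (u.natAbs, v.natAbs)), ?_, Prod.ext heu hfv⟩
  rw [Finset.mem_coe, Finset.mem_product, hI, Finset.mem_product, sieveSet, Finset.mem_filter,
    Finset.mem_product, Finset.mem_range, Finset.mem_range]
  dsimp only
  rw [Int.natAbs_sq, Int.natAbs_sq]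
  refine ⟨⟨he, hf⟩, ⟨?_, ?_⟩, hrep⟩
  · rw [← Int.ofNat_lt, Int.natCast_natAbs]
    exact abs_lt_of_sq_lt_sq (by nlinarith [sq_nonneg v]) (by positivity)
  · rw [← Int.ofNat_lt, Int.natCast_natAbs]
    exact abs_lt_of_sq_lt_sq (by nlinarith [sq_nonneg u]) (by positivity)

theorem card_filter_puncturedDisc_mul_sqrt_log_le {a h : ℤ} (ha : 1 ≤ a) (hh : h ≠ 0) {x : ℝ}
    (hx : 2 ≤ x) (haX : a * a ≤ (⌊x⌋₊ : ℤ)) :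
    (((puncturedDisc ⌊x⌋₊).filter fun β => a * (β.1 ^ 2 + β.2 ^ 2) ≤ (⌊x⌋₊ : ℤ) ∧
      ∃ s t : ℤ, s ^ 2 + t ^ 2 = a * (β.1 ^ 2 + β.2 ^ 2) + h).card : ℝ) * √(Real.log x) ≤
      6720 * x * inertFactor h.natAbs * (inertFactor a.natAbs * (a : ℝ)⁻¹) := by
  obtain ⟨b, rfl⟩ := Int.eq_ofNat_of_zero_le (by omega : 0 ≤ a)
  have hb : 1 ≤ b := by exact_mod_cast ha
  have hbX : b * b ≤ ⌊x⌋₊ := by exact_mod_cast haX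
  set X := ⌊x⌋₊ with hX
  set q := Nat.sqrt (X / b) with hq
  have hbq : b ≤ X / b := (Nat.le_div_iff_mul_le hb).2 hbX
  have hq1 : 1 ≤ q := Nat.sqrt_pos.2 (hb.trans hbq)
  have hqle : q * q ≤ X / b := Nat.sqrt_le _
  have hqlt : X / b < (q + 1) * (q + 1) := Nat.lt_succ_sqrt _
  have hXlt : X < b * ((q + 1) * (q + 1)) := by
    rw [mul_comm]
    exact (Nat.div_lt_iff_lt_mul hb).1 hqlt
  have hcard := card_filter_puncturedDisc_le (h := h) ha (X := X) (N := q + 1)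
    (by push_cast; rw [sq]; exact_mod_cast hXlt)
  have hsieve := card_sieveSet_mul_sqrt_log_le (a := (b : ℤ)) (by omega) hh
    (N := q + 1) (by omega)
  have hlog : √(Real.log x) ≤ 2 * √(Real.log ((q + 1 : ℕ) : ℝ)) := by
    have h1 : x ≤ ((q + 1 : ℕ) : ℝ) ^ 4 := by
      have h2 : X + 1 ≤ (q + 1) ^ 4 := by nlinarith
      have h3 : ((X + 1 : ℕ) : ℝ) ≤ ((q + 1) ^ 4 : ℕ) := by exact_mod_cast h2
      have h4 := (Nat.lt_floor_add_one x).le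
      push_cast at h3 ⊢
      linarith
    have h2 := Real.log_le_log (by linarith) h1
    rw [Real.log_pow] at h2
    rw [Real.sqrt_le_iff]
    have h3 : 0 ≤ Real.log ((q + 1 : ℕ) : ℝ) := Real.log_natCast_nonneg _
    refine ⟨by positivity, ?_⟩
    rw [mul_pow, Real.sq_sqrt h3]
    push_cast at h2 ⊢
    linarith
  have hqx : (((q + 1 : ℕ) : ℝ)) ^ 2 ≤ 4 * x * ((b : ℤ) : ℝ)⁻¹ := by
    rw [← div_eq_mul_inv, le_div_iff₀ (by exact_mod_cast hb)]
    have h1 : b * (q * q) ≤ X := (Nat.mul_le_mul_left b hqle).trans (Nat.mul_div_le X b)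
    have h2 : (q + 1) ^ 2 * b ≤ 4 * X := by
      have h3 : (q + 1) ^ 2 ≤ 4 * (q * q) := by nlinarith
      nlinarith
    have h3 : (((q + 1) ^ 2 * b : ℕ) : ℝ) ≤ (4 * X : ℕ) := by exact_mod_cast h2
    have h4 : (X : ℝ) ≤ x := Nat.floor_le (by linarith)
    push_cast at h3 ⊢
    linarith
  have hI : inertFactor ((b : ℤ) * h).natAbs ≤
      inertFactor h.natAbs * inertFactor (b : ℤ).natAbs := by
    rw [Int.natAbs_mul, mul_comm]
    exact inertFactor_mul_le (Int.natAbs_ne_zero.2 hh) (by omega)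
  have hI1 := one_le_inertFactor ((b : ℤ) * h).natAbs
  calc _ ≤ ((4 * (sieveSet b h (q + 1)).card : ℕ) : ℝ) *
        (2 * √(Real.log ((q + 1 : ℕ) : ℝ))) :=
        mul_le_mul (by exact_mod_cast hcard) hlog (by positivity) (by positivity)
    _ = 8 * ((sieveSet b h (q + 1)).card * √(Real.log ((q + 1 : ℕ) : ℝ))) := by
        push_cast; ring
    _ ≤ 8 * (210 * ((q + 1 : ℕ) : ℝ) ^ 2 * inertFactor ((b : ℤ) * h).natAbs) := by linarith
    _ ≤ 8 * (210 * (4 * x * ((b : ℤ) : ℝ)⁻¹) *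
        (inertFactor h.natAbs * inertFactor (b : ℤ).natAbs)) := by
        gcongr
    _ = _ := by ring

theorem shifted_two_squares_correlation_bound :
    ∃ c : ℝ, 0 < c ∧ ∀ h : ℤ, h ≠ 0 → ∀ x : ℝ, 2 ≤ x →
      ∑ n ∈ (Finset.Icc 1 ⌊x⌋₊).filter (fun n => ((n : ℤ) + h) ∈ sumTwoSquaresSet),
          (rTwoSquaresZ (n : ℤ) : ℝ) ^ 2 ≤
        c * ((h.natAbs : ℝ) / (Nat.totient h.natAbs : ℝ)) ^ 2 * x *
          Real.log x ^ ((1 : ℝ) / 2) := by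
  refine ⟨18 * 6720 * 48, by norm_num, fun h hh x hx => ?_⟩
  rw [← Real.sqrt_eq_rpow]
  set X := ⌊x⌋₊ with hX
  rw [natCast_bind_Icc_eq]
  set W := ∑ n ∈ (Finset.Icc 1 (X : ℤ)).filter (fun n => n + h ∈ sumTwoSquaresSet),
    (rTwoSquaresZ n : ℝ) ^ 2 with hW
  set V := ∑ α ∈ (puncturedDisc X).filter
    (fun α => (α.1 ^ 2 + α.2 ^ 2) * (α.1 ^ 2 + α.2 ^ 2) ≤ (X : ℤ)), ((puncturedDisc X).filter fun β =>
      (α.1 ^ 2 + α.2 ^ 2) * (β.1 ^ 2 + β.2 ^ 2) ≤ (X : ℤ) ∧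
      ∃ s t : ℤ, s ^ 2 + t ^ 2 = (α.1 ^ 2 + α.2 ^ 2) * (β.1 ^ 2 + β.2 ^ 2) + h).card with hV
  have hWV : W ≤ 18 * V := by
    have h1 := (sum_rTwoSquaresZ_sq_le_card h X).trans
      (Nat.mul_le_mul_left 9 (card_factorPairs_le h X))
    rw [← mul_assoc, ← hV] at h1
    rw [hW]
    exact_mod_cast h1
  have hlog2 : Real.log 2 ≤ Real.log x := Real.log_le_log (by norm_num) hx
  have hlogpos : 0 < Real.log x := (Real.log_pos (by norm_num)).trans_le hlog2
  have hlogX : 1 + Real.log X ≤ 3 * Real.log x := by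
    have h1 : (1 : ℝ) ≤ X := by
      exact_mod_cast Nat.le_floor (by push_cast; linarith)
    have h2 := Real.log_le_log (by linarith) (Nat.floor_le (by linarith : 0 ≤ x))
    have h3 := Real.log_two_gt_d9
    linarith
  have hI := one_le_inertFactor h.natAbs
  have hIsq := inertFactor_le_sq (Int.natAbs_ne_zero.2 hh)
  have hVlog : (V : ℝ) * √(Real.log x) ≤
      6720 * x * inertFactor h.natAbs * (48 * Real.log x) := by
    rw [hV, Nat.cast_sum, Finset.sum_mul]
    calc _ ≤ ∑ α ∈ (puncturedDisc X).filter
          (fun α => (α.1 ^ 2 + α.2 ^ 2) * (α.1 ^ 2 + α.2 ^ 2) ≤ (X : ℤ)),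
          6720 * x * inertFactor h.natAbs * (inertFactor (α.1 ^ 2 + α.2 ^ 2).natAbs *
            ((α.1 ^ 2 + α.2 ^ 2 : ℤ) : ℝ)⁻¹) := by
          refine Finset.sum_le_sum fun α hα => ?_
          rw [Finset.mem_filter, mem_puncturedDisc] at hα
          exact card_filter_puncturedDisc_mul_sqrt_log_le hα.1.1 hh hx hα.2
      _ ≤ ∑ α ∈ puncturedDisc X,
          6720 * x * inertFactor h.natAbs * (inertFactor (α.1 ^ 2 + α.2 ^ 2).natAbs *
            ((α.1 ^ 2 + α.2 ^ 2 : ℤ) : ℝ)⁻¹) := by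
          refine Finset.sum_le_sum_of_subset_of_nonneg (Finset.filter_subset _ _) fun α _ _ => ?_
          have := one_le_inertFactor (α.1 ^ 2 + α.2 ^ 2).natAbs
          positivity
      _ = 6720 * x * inertFactor h.natAbs * ∑ α ∈ puncturedDisc X,
          (inertFactor (α.1 ^ 2 + α.2 ^ 2).natAbs * ((α.1 ^ 2 + α.2 ^ 2 : ℤ) : ℝ)⁻¹) := by
          rw [Finset.mul_sum]
      _ ≤ _ := by
          refine mul_le_mul_of_nonneg_left ?_ (by positivity)
          linarith [sum_inertFactor_mul_inv_le X]
  have hsq : Real.log x = √(Real.log x) * √(Real.log x) := (Real.mul_self_sqrt hlogpos.le).symm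
  refine le_of_mul_le_mul_right ?_ (Real.sqrt_pos.2 hlogpos)
  calc W * √(Real.log x) ≤ 18 * V * √(Real.log x) :=
        mul_le_mul_of_nonneg_right hWV (Real.sqrt_nonneg _)
    _ ≤ 18 * (6720 * x * inertFactor h.natAbs * (48 * Real.log x)) := by linarith
    _ ≤ 18 * (6720 * x * ((h.natAbs : ℝ) / (Nat.totient h.natAbs : ℝ)) ^ 2 *
        (48 * Real.log x)) := by gcongr
    _ = 18 * (6720 * x * ((h.natAbs : ℝ) / (Nat.totient h.natAbs : ℝ)) ^ 2 *
        (48 * (√(Real.log x) * √(Real.log x)))) := by rw [← hsq]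
    _ = _ := by ring
end
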